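/- Let W be irreducible and let g ∈ W be a regular element of order d whose reflection length satisfies d · l_R(g) = |R| + |A| (this holds in particular when d equals the largest fundamental degree of W). Then for every l ≥ 0, the number of reflection factorizations of g of length l satisfies |W| · Fact_{W,g}(l) = Σ_{k=0}^{l_R(g)} (−1)^k · binom(l_R(g), k) · (|R| − k·d)^l. -/

import Mathlib

open scoped BigOperators

noncomputable section

/-- `χ` is an irreducible complex character of the group `G`. -/
def IsIrredChar (G : Type*) [Group G] (χ : G → ℂ) : Prop :=
  ∃ (n : ℕ) (ρ : Representation ℂ G (Fin n → ℂ)),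
    0 < n ∧
    (∀ U : Submodule ℂ (Fin n → ℂ), (∀ g : G, U.map (ρ g) ≤ U) → U = ⊥ ∨ U = ⊤) ∧
    ∀ g : G, χ g = LinearMap.trace ℂ (Fin n → ℂ) (ρ g)

variable {V : Type*} [AddCommGroup V] [Module ℂ V]

/-- The fixed space `ker (w - id)` of an invertible linear map `w`. -/
def fixedSpace (w : (V →ₗ[ℂ] V)ˣ) : Submodule ℂ V :=
  LinearMap.ker ((w : V →ₗ[ℂ] V) - LinearMap.id)

/-- `w` is a reflection: its fixed space is a hyperplane (codimension 1). -/
def IsReflection (w : (V →ₗ[ℂ] V)ˣ) : Prop :=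
  Module.finrank ℂ V = Module.finrank ℂ (fixedSpace w) + 1

/-- The linear map underlying an element of `W`. -/
def toLin (W : Subgroup (V →ₗ[ℂ] V)ˣ) (w : W) : V →ₗ[ℂ] V :=
  ((w : (V →ₗ[ℂ] V)ˣ) : V →ₗ[ℂ] V)

/-- The set of reflections of `W`. -/
def refls (W : Subgroup (V →ₗ[ℂ] V)ˣ) : Set W :=
  {t | IsReflection (t : (V →ₗ[ℂ] V)ˣ)}

/-- The arrangement of reflecting hyperplanes of `W`. -/
def arrangement (W : Subgroup (V →ₗ[ℂ] V)ˣ) : Set (Submodule ℂ V) :=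
  {H | ∃ t : W, t ∈ refls W ∧ H = fixedSpace (t : (V →ₗ[ℂ] V)ˣ)}

/-- The pointwise stabilizer of a subspace `H` in `W`. -/
def ptStab (W : Subgroup (V →ₗ[ℂ] V)ˣ) (H : Submodule ℂ V) : Set W :=
  {w | ∀ v ∈ H, toLin W w v = v}

/-- The `W`-orbit of a hyperplane `H`. -/
def orbitOf (W : Subgroup (V →ₗ[ℂ] V)ˣ) (H : Submodule ℂ V) : Set (Submodule ℂ V) :=
  {H' | ∃ w : W, H' = H.map (toLin W w)}

/-- The reflections of `W` whose hyperplane lies in the orbit of `H`. -/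
def Cref (W : Subgroup (V →ₗ[ℂ] V)ˣ) (H : Submodule ℂ V) : Set W :=
  {t | t ∈ refls W ∧ fixedSpace (t : (V →ₗ[ℂ] V)ˣ) ∈ orbitOf W H}

/-- `g ∈ W` is a regular element of order `d`: it has a nonzero eigenvector,
with eigenvalue a primitive `d`-th root of unity, lying on no reflecting hyperplane. -/
def IsRegularElt (W : Subgroup (V →ₗ[ℂ] V)ˣ) (g : W) (d : ℕ) : Prop :=
  orderOf g = d ∧ ∃ (ζ : ℂ) (v : V), v ≠ 0 ∧ IsPrimitiveRoot ζ d ∧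
    toLin W g v = ζ • v ∧ ∀ H ∈ arrangement W, v ∉ H

/-- The action of `W` on `V` is irreducible. -/
def IsIrredAction (W : Subgroup (V →ₗ[ℂ] V)ˣ) : Prop :=
  ∀ U : Submodule ℂ V, (∀ w : W, U.map (toLin W w) ≤ U) → U = ⊥ ∨ U = ⊤

/-- `f` is a length-`l` reflection factorization of `g`. -/
def IsReflFac (W : Subgroup (V →ₗ[ℂ] V)ˣ) (g : W) (l : ℕ) (f : Fin l → W) : Prop :=
  (∀ i, f i ∈ refls W) ∧ (List.ofFn f).prod = g

/-- `l` is the reflection length of `g`: the minimal length of a reflection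
factorization of `g`. -/
def IsReflLength (W : Subgroup (V →ₗ[ℂ] V)ˣ) (g : W) (l : ℕ) : Prop :=
  (∃ f : Fin l → W, IsReflFac W g l f) ∧
    ∀ (k : ℕ) (f : Fin k → W), IsReflFac W g k f → l ≤ k

open Classical in
/-- `n` is the minimal number of factors whose hyperplane lies in the orbit `C`,
over all reflection factorizations of `g` (of any length). -/
def IsMinOrbitCount (W : Subgroup (V →ₗ[ℂ] V)ˣ) (g : W)
    (C : Set (Submodule ℂ V)) (n : ℕ) : Prop :=
  (∃ (N : ℕ) (f : Fin N → W), IsReflFac W g N f ∧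
      (Finset.univ.filter fun i => fixedSpace (f i : (V →ₗ[ℂ] V)ˣ) ∈ C).card = n) ∧
  ∀ (N : ℕ) (f : Fin N → W), IsReflFac W g N f →
      n ≤ (Finset.univ.filter fun i => fixedSpace (f i : (V →ₗ[ℂ] V)ˣ) ∈ C).card


set_option linter.all false
namespace KZ
section Loc
variable {A K : Type*} [CommRing A] [IsDomain A] [Field K] [Algebra A K] [IsFractionRing A K]

/-- The local ring of fractions whose denominator is not divisible by the prime `p`. -/
def locRing (K : Type*) [Field K] [Algebra A K] (p : A) (hp : Prime p) : Subring K where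
  carrier := {x | ∃ s q : A, ¬ p ∣ q ∧ x * algebraMap A K q = algebraMap A K s}
  zero_mem' := ⟨0, 1, fun h => hp.not_isUnit (isUnit_of_dvd_one h), by simp⟩
  one_mem' := ⟨1, 1, fun h => hp.not_isUnit (isUnit_of_dvd_one h), by simp⟩
  add_mem' := by
    rintro x y ⟨s, q, hq, hx⟩ ⟨s', q', hq', hy⟩
    refine ⟨s * q' + s' * q, q * q', fun h => (hp.dvd_or_dvd h).elim hq hq', ?_⟩
    simp only [map_mul, map_add, ← hx, ← hy]; ring
  mul_mem' := by
    rintro x y ⟨s, q, hq, hx⟩ ⟨s', q', hq', hy⟩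
    refine ⟨s * s', q * q', fun h => (hp.dvd_or_dvd h).elim hq hq', ?_⟩
    simp only [map_mul, ← hx, ← hy]; ring
  neg_mem' := by
    rintro x ⟨s, q, hq, hx⟩
    exact ⟨-s, q, hq, by simp [← hx]⟩

variable {p : A} {hp : Prime p}

lemma mem_locRing {x : K} : x ∈ locRing K p hp ↔
    ∃ s q : A, ¬ p ∣ q ∧ x * algebraMap A K q = algebraMap A K s := Iff.rfl

lemma algebraMap_mem_locRing (a : A) : algebraMap A K a ∈ locRing K p hp :=
  ⟨a, 1, fun h => hp.not_isUnit (isUnit_of_dvd_one h), by simp⟩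

lemma inv_mem_locRing {q : A} (hq : ¬ p ∣ q) : (algebraMap A K q)⁻¹ ∈ locRing K p hp := by
  have h0 : algebraMap A K q ≠ 0 := by
    intro h
    apply hq
    rw [(IsFractionRing.injective A K) (h.trans (map_zero _).symm)]
    exact dvd_zero p
  exact ⟨1, q, hq, by simp [h0]⟩

/-- If `p ∤ q` and `q x ∈ p O` with `x ∈ O` then `x ∈ p O`. -/
lemma mem_of_mul_mem {x y : K} {q : A} (hq : ¬ p ∣ q)
    (hy : y ∈ locRing K p hp) (h : algebraMap A K q * x = algebraMap A K p * y) :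
    ∃ z ∈ locRing K p hp, x = algebraMap A K p * z := by
  have h0 : algebraMap A K q ≠ 0 := by
    intro h
    apply hq
    rw [(IsFractionRing.injective A K) (h.trans (map_zero _).symm)]
    exact dvd_zero p
  refine ⟨(algebraMap A K q)⁻¹ * y, mul_mem (inv_mem_locRing hq) hy, ?_⟩
  field_simp
  linear_combination h

variable [UniqueFactorizationMonoid A]

lemma exists_pow_mul_mem (p : A) (hp : Prime p) (x : K) :
    ∃ r : ℕ, algebraMap A K p ^ r * x ∈ locRing K p hp := by
  obtain ⟨s, t, ht, rfl⟩ := IsFractionRing.div_surjective (A := A) x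
  have ht0 : t ≠ 0 := nonZeroDivisors.ne_zero ht
  obtain ⟨n, c, hc, h⟩ := WfDvdMonoid.max_power_factor ht0 hp.irreducible
  refine ⟨n, s, c, hc, ?_⟩
  have h0 : algebraMap A K t ≠ 0 := by
    simpa using ht0
  rw [mul_assoc, div_mul_eq_mul_div, mul_div_assoc', div_eq_iff h0, h, map_mul, map_pow]
  ring

lemma mem_range_of_forall (x : K) (h : ∀ (p : A) (hp : Prime p), x ∈ locRing K p hp) :
    ∃ a : A, x = algebraMap A K a := by
  obtain ⟨s, t, hco, hx⟩ := IsFractionRing.exists_reduced_fraction (A := A) x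
  have ht0 : (t : A) ≠ 0 := nonZeroDivisors.ne_zero t.2
  have h0 : algebraMap A K t ≠ 0 := by simpa using ht0
  have hx' : x * algebraMap A K t = algebraMap A K s := by
    rw [← hx]; exact IsLocalization.mk'_spec K s t
  by_cases hu : IsUnit (t : A)
  · obtain ⟨u, hu⟩ := hu
    refine ⟨s * (↑u⁻¹ : A), ?_⟩
    rw [map_mul, ← hx', ← hu, mul_assoc, ← map_mul]; simp
  · exfalso
    obtain ⟨p, hpi, hpt⟩ := WfDvdMonoid.exists_irreducible_factor hu ht0
    have hp := UniqueFactorizationMonoid.irreducible_iff_prime.mp hpi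
    obtain ⟨s', q, hq, h'⟩ := h p hp
    have : s * q = s' * t := by
      apply IsFractionRing.injective A K
      rw [map_mul, map_mul, ← hx', ← h']; ring
    have h2 : p ∣ s * q := this ▸ (hpt.mul_left s')
    rcases hp.dvd_or_dvd h2 with h3 | h3
    · exact hpi.not_isUnit (hco h3 hpt)
    · exact hq h3

end Loc

section Der
variable {A K : Type*} [CommRing A] [IsDomain A] [Field K] [Algebra A K] [IsFractionRing A K]
  [Algebra ℂ A] [Algebra ℂ K] [IsScalarTower ℂ A K]

/-- Auxiliary homomorphism into dual numbers attached to a derivation. -/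
def dualHom (D : Derivation ℂ A A) : A →+* TrivSqZeroExt K K where
  toFun a := TrivSqZeroExt.inl (algebraMap A K a) + TrivSqZeroExt.inr (algebraMap A K (D a))
  map_zero' := by simp
  map_one' := by simp
  map_add' a b := by
    ext
    · simp
    · simp only [map_add, TrivSqZeroExt.snd_add, TrivSqZeroExt.snd_inl, TrivSqZeroExt.snd_inr]
      ring
  map_mul' a b := by
    ext
    · simp
    · simp only [map_mul, TrivSqZeroExt.snd_add, TrivSqZeroExt.snd_inl, TrivSqZeroExt.snd_inr,
        TrivSqZeroExt.snd_mul, TrivSqZeroExt.fst_add, TrivSqZeroExt.fst_inl,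
        TrivSqZeroExt.fst_inr, Derivation.leibniz, smul_eq_mul, map_add,
        MulOpposite.smul_eq_mul_unop, MulOpposite.unop_op]
      ring

lemma dualHom_isUnit (D : Derivation ℂ A A) (y : nonZeroDivisors A) :
    IsUnit (dualHom (K := K) D y) := by
  rw [TrivSqZeroExt.isUnit_iff_isUnit_fst]
  simp [dualHom, nonZeroDivisors.ne_zero y.2]

/-- The lift of `dualHom` to the fraction field. -/
def dualLift (D : Derivation ℂ A A) : K →+* TrivSqZeroExt K K :=
  IsLocalization.lift (M := nonZeroDivisors A) (dualHom_isUnit (K := K) D)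

lemma dualLift_algebraMap (D : Derivation ℂ A A) (a : A) :
    dualLift (K := K) D (algebraMap A K a) = dualHom D a :=
  IsLocalization.lift_eq _ _

lemma dualLift_fst (D : Derivation ℂ A A) (x : K) : (dualLift (K := K) D x).fst = x := by
  have : ((TrivSqZeroExt.fstHom K K K : TrivSqZeroExt K K →ₐ[K] K) : _ →+* K).comp
      (dualLift (K := K) D) = RingHom.id K := by
    apply IsLocalization.ringHom_ext (nonZeroDivisors A)
    ext a
    simp [dualLift_algebraMap, dualHom]
  exact congrArg (fun f : K →+* K => f x) this

/-- Extension of a derivation to the fraction field. -/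
def extDer (K : Type*) [Field K] [Algebra A K] [IsFractionRing A K] [Algebra ℂ K]
    [IsScalarTower ℂ A K] (D : Derivation ℂ A A) : Derivation ℂ K K :=
  Derivation.mk'
    { toFun := fun x => (dualLift (K := K) D x).snd
      map_add' := fun x y => by simp
      map_smul' := fun c x => by
        rw [Algebra.smul_def, map_mul, TrivSqZeroExt.snd_mul, dualLift_fst, dualLift_fst,
          IsScalarTower.algebraMap_apply ℂ A K, dualLift_algebraMap]
        simp [dualHom, Algebra.smul_def, IsScalarTower.algebraMap_apply ℂ A K] }
    (fun x y => by simp [dualLift_fst, mul_comm])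

@[simp] lemma extDer_algebraMap (D : Derivation ℂ A A) (a : A) :
    extDer K D (algebraMap A K a) = algebraMap A K (D a) := by
  change (dualLift (K := K) D _).snd = _
  rw [dualLift_algebraMap]
  change (TrivSqZeroExt.inl (algebraMap A K a) +
    TrivSqZeroExt.inr (algebraMap A K (D a)) : TrivSqZeroExt K K).snd = _
  simp only [TrivSqZeroExt.snd_add, TrivSqZeroExt.snd_inl, TrivSqZeroExt.snd_inr, zero_add]

/-- Derivations of the fraction field agreeing on the ring are equal. -/
lemma der_eq_zero (D : Derivation ℂ K K) (h : ∀ a : A, D (algebraMap A K a) = 0) (x : K) :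
    D x = 0 := by
  obtain ⟨s, t, ht, rfl⟩ := IsFractionRing.div_surjective (A := A) x
  have h0 : algebraMap A K t ≠ 0 := by simpa using nonZeroDivisors.ne_zero ht
  have h1 : algebraMap A K t * (algebraMap A K s / algebraMap A K t) = algebraMap A K s := by
    field_simp
  have h2 := congrArg D h1
  rw [Derivation.leibniz, h, h] at h2
  simpa [h0, nonZeroDivisors.ne_zero ht] using h2

lemma der_ext (D D' : Derivation ℂ K K)
    (h : ∀ a : A, D (algebraMap A K a) = D' (algebraMap A K a)) (x : K) : D x = D' x := by
  have := der_eq_zero (A := A) (D - D') (fun a => by simp [h]) x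
  simpa [sub_eq_zero] using this

lemma der_mem_locRing {p : A} {hp : Prime p} (D : Derivation ℂ A A) {x : K}
    (hx : x ∈ locRing K p hp) : extDer K D x ∈ locRing K p hp := by
  obtain ⟨s, q, hq, h⟩ := hx
  refine ⟨D s * q - s * D q, q * q, fun h => (hp.dvd_or_dvd h).elim hq hq, ?_⟩
  have h2 := congrArg (extDer K D) h
  rw [Derivation.leibniz, extDer_algebraMap, extDer_algebraMap] at h2
  simp only [smul_eq_mul] at h2
  simp only [map_mul, map_sub, ← h2, ← h]
  ring

end Der
end KZ

namespace KZ
open MvPolynomial Matrix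
section Poly
variable {ι : Type*} [Fintype ι] [DecidableEq ι]

/-- The linear form with coefficient vector `α`. -/
def lf (α : ι → ℂ) : MvPolynomial ι ℂ := ∑ i, C (α i) * X i

/-- Directional derivative on polynomials. -/
def dP (y : ι → ℂ) : Derivation ℂ (MvPolynomial ι ℂ) (MvPolynomial ι ℂ) :=
  mkDerivation ℂ (fun i => C (y i))

/-- The Euler derivation on polynomials. -/
def eP (ι : Type*) : Derivation ℂ (MvPolynomial ι ℂ) (MvPolynomial ι ℂ) :=
  mkDerivation ℂ (fun i => X i)

/-- Linear substitution: `(subP g p)(x) = p(g x)`. -/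
def subP (g : Matrix ι ι ℂ) : MvPolynomial ι ℂ →ₐ[ℂ] MvPolynomial ι ℂ :=
  aeval (fun i => lf (g i))

@[simp] lemma dP_X (y : ι → ℂ) (i : ι) : dP y (X i) = C (y i) := by simp [dP]
@[simp] lemma dP_C (y : ι → ℂ) (c : ℂ) : dP y (C c) = 0 := (dP y).map_algebraMap c
@[simp] lemma eP_X (i : ι) : eP ι (X i) = X i := by simp [eP]
@[simp] lemma eP_C (c : ℂ) : eP ι (C c) = 0 := (eP ι).map_algebraMap c
@[simp] lemma subP_X (g : Matrix ι ι ℂ) (i : ι) : subP g (X i) = lf (g i) := by simp [subP]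
@[simp] lemma subP_C (g : Matrix ι ι ℂ) (c : ℂ) : subP g (C c) = C c := by simp [subP]

lemma lf_add (α β : ι → ℂ) : lf (α + β) = lf α + lf β := by
  simp [lf, add_mul, Finset.sum_add_distrib]
lemma lf_smul (c : ℂ) (α : ι → ℂ) : lf (c • α) = C c * lf α := by
  simp [lf, Finset.mul_sum, mul_assoc]
@[simp] lemma lf_zero : lf (0 : ι → ℂ) = 0 := by simp [lf]
lemma eval_lf (α x : ι → ℂ) : eval x (lf α) = α ⬝ᵥ x := by simp [lf, dotProduct]
lemma lf_single (i : ι) : lf (Pi.single i 1) = X i := by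
  rw [lf, Finset.sum_eq_single i] <;> simp +contextual [Pi.single_apply]
lemma lf_inj {α : ι → ℂ} (h : lf α = 0) : α = 0 := by
  funext i
  have := congrArg (eval (Pi.single i 1)) h
  rw [eval_lf] at this
  simpa using this
@[simp] lemma dP_lf (y α : ι → ℂ) : dP y (lf α) = C (α ⬝ᵥ y) := by
  simp [lf, dotProduct, Derivation.leibniz]
@[simp] lemma eP_lf (α : ι → ℂ) : eP ι (lf α) = lf α := by
  simp [lf, Derivation.leibniz]

lemma dP_add (x y : ι → ℂ) (p) : dP (x + y) p = dP x p + dP y p := by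
  have : dP (x + y) = dP x + dP y := by
    apply MvPolynomial.derivation_ext; intro i; simp
  rw [this]; rfl
lemma dP_smul (c : ℂ) (y : ι → ℂ) (p) : dP (c • y) p = C c * dP y p := by
  have : dP (c • y) = c • dP y := by
    apply MvPolynomial.derivation_ext; intro i; simp [smul_eq_C_mul]
  rw [this, Derivation.smul_apply, smul_eq_C_mul]

lemma eP_eq (p : MvPolynomial ι ℂ) : eP ι p = ∑ i, X i * dP (Pi.single i 1) p := by
  have : eP ι = ∑ i, (X i : MvPolynomial ι ℂ) • dP (Pi.single i 1) := by
    apply MvPolynomial.derivation_ext; intro j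
    have : ∀ s : Finset ι, (∑ i ∈ s, (X i : MvPolynomial ι ℂ) • dP (Pi.single i 1)) (X j) =
        ∑ i ∈ s, X i * dP (Pi.single i 1) (X j) := by
      intro s
      induction s using Finset.induction_on with
      | empty => simp
      | insert a s ha ih => rw [Finset.sum_insert ha, Finset.sum_insert ha, ← ih]; rfl
    rw [this, Finset.sum_eq_single j] <;> simp +contextual [Pi.single_apply]
  rw [this]
  have : ∀ s : Finset ι, (∑ i ∈ s, (X i : MvPolynomial ι ℂ) • dP (Pi.single i 1)) p =
      ∑ i ∈ s, X i * dP (Pi.single i 1) p := by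
    intro s
    induction s using Finset.induction_on with
    | empty => simp
    | insert a s ha ih => rw [Finset.sum_insert ha, Finset.sum_insert ha, ← ih]; rfl
  exact this _

lemma dP_single (i : ι) (p : MvPolynomial ι ℂ) : dP (Pi.single i 1) p = pderiv i p := by
  have : dP (Pi.single i (1 : ℂ)) = pderiv i := by
    apply MvPolynomial.derivation_ext; intro j
    simp only [dP_X, pderiv_X, Pi.single_apply]; split_ifs <;> simp
  rw [this]

lemma dP_comm (x y : ι → ℂ) (p) : dP x (dP y p) = dP y (dP x p) := by
  have : ⁅dP x, dP y⁆ = 0 := by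
    apply MvPolynomial.derivation_ext; intro i; simp [Derivation.commutator_apply]
  have := congrArg (fun D : Derivation ℂ _ _ => D p) this
  simpa [Derivation.commutator_apply, sub_eq_zero] using this

lemma eP_dP (y : ι → ℂ) (p) : eP ι (dP y p) = dP y (eP ι p) - dP y p := by
  have : ⁅eP ι, dP y⁆ = - dP y := by
    apply MvPolynomial.derivation_ext; intro i; simp [Derivation.commutator_apply]
  have := congrArg (fun D : Derivation ℂ _ _ => D p) this
  simp [Derivation.commutator_apply] at this
  linear_combination this

lemma subP_lf (g : Matrix ι ι ℂ) (α : ι → ℂ) : subP g (lf α) = lf (α ᵥ* g) := by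
  simp only [lf, map_sum, map_mul, subP_C, subP_X, Finset.mul_sum, vecMul, dotProduct,
    Finset.sum_mul]
  rw [Finset.sum_comm]
  refine Finset.sum_congr rfl fun j _ => Finset.sum_congr rfl fun i _ => ?_
  ring

lemma subP_mul (g h : Matrix ι ι ℂ) (p) : subP (g * h) p = subP h (subP g p) := by
  have : subP (g * h) = (subP h).comp (subP g) := by
    apply MvPolynomial.algHom_ext; intro i
    simp only [subP_X, AlgHom.comp_apply, subP_lf]
    rfl
  rw [this]; rfl

lemma subP_one (p : MvPolynomial ι ℂ) : subP 1 p = p := by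
  have : subP (1 : Matrix ι ι ℂ) = AlgHom.id ℂ _ := by
    apply MvPolynomial.algHom_ext; intro i
    simp only [subP_X, AlgHom.id_apply]
    rw [← lf_single]; congr 1; funext j; simp [Matrix.one_apply, Pi.single_apply, eq_comm]
  rw [this]; rfl

lemma eval_subP (g : Matrix ι ι ℂ) (x : ι → ℂ) (p) : eval x (subP g p) = eval (g *ᵥ x) p := by
  have : (aeval x : MvPolynomial ι ℂ →ₐ[ℂ] ℂ).comp (subP g) = aeval (g *ᵥ x) := by
    apply MvPolynomial.algHom_ext; intro i
    simp only [subP_X, AlgHom.comp_apply, aeval_X]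
    exact eval_lf _ _
  have := congrArg (fun f : _ →ₐ[ℂ] ℂ => f p) this
  simpa [AlgHom.comp_apply, coe_aeval_eq_eval] using this

lemma dP_subP (y : ι → ℂ) (g : Matrix ι ι ℂ) (p) :
    dP y (subP g p) = subP g (dP (g *ᵥ y) p) := by
  induction p using MvPolynomial.induction_on with
  | C a => simp
  | add p q hp hq => simp [hp, hq]
  | mul_X p i hp =>
    simp only [map_mul, Derivation.leibniz, hp, subP_X, dP_lf, dP_X, map_add, smul_eq_mul, subP_C]
    simp [mulVec]

lemma coeff_eP (p : MvPolynomial ι ℂ) (s : ι →₀ ℕ) :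
    coeff s (eP ι p) = (s.degree : ℂ) * coeff s p := by
  induction p using MvPolynomial.induction_on' with
  | monomial t a =>
    have h := (isHomogeneous_monomial (σ := ι) (R := ℂ) (d := t) (n := t.degree) a rfl)
    have h2 := h.sum_X_mul_pderiv
    rw [eP_eq]
    simp only [dP_single]
    rw [h2, coeff_smul, coeff_monomial]
    split_ifs with h3
    · subst h3; simp
    · simp
  | add p q hp hq => simp [hp, hq]; ring

lemma eP_eq_zero_of_neg {p : MvPolynomial ι ℂ} {c : ℤ} (hc : c < 0)
    (h : eP ι p = C (c : ℂ) * p) : p = 0 := by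
  ext s
  have := congrArg (coeff s) h
  rw [coeff_eP, coeff_C_mul] at this
  have h2 : ((s.degree : ℂ) - (c : ℂ)) * coeff s p = 0 := by linear_combination this
  rcases mul_eq_zero.mp h2 with h3 | h3
  · exfalso
    have : ((s.degree : ℤ) - c : ℤ) = 0 := by exact_mod_cast h3
    omega
  · simpa using h3

lemma eq_C_of_eP {p : MvPolynomial ι ℂ} (h : eP ι p = 0) : p = C (coeff 0 p) := by
  ext s
  have := congrArg (coeff s) h
  rw [coeff_eP, coeff_zero] at this
  rw [coeff_C]
  split_ifs with h0
  · rw [h0]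
  · rcases mul_eq_zero.mp this with h3 | h3
    · exfalso
      apply h0
      have : s.degree = 0 := by exact_mod_cast h3
      rw [Finsupp.degree_eq_zero_iff] at this
      exact this.symm
    · exact h3

lemma eq_C_of_dP {p : MvPolynomial ι ℂ} (h : ∀ i, dP (Pi.single i 1) p = 0) :
    p = C (coeff 0 p) := eq_C_of_eP (by rw [eP_eq]; simp [h])

lemma exists_not_dvd_dP {p : MvPolynomial ι ℂ} (hp : Prime p) :
    ∃ i, ¬ p ∣ dP (Pi.single i 1) p := by
  by_contra! hcon
  have key : ∀ i, dP (Pi.single i 1) p = 0 := by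
    intro i
    by_contra h0
    have h1 := totalDegree_le_of_dvd_of_isDomain (hcon i) h0
    rw [dP_single] at h0 h1
    obtain ⟨s, hs, hs'⟩ := Finset.exists_mem_eq_sup (pderiv i p).support
      (by simpa using h0) (fun s => s.sum fun _ e => e)
    have h2 : s + Finsupp.single i 1 ∈ p.support := by
      rw [mem_support_iff] at hs ⊢
      rw [coeff_pderiv] at hs
      intro h; rw [h] at hs; simp at hs
    have h3 := le_totalDegree h2
    rw [Finsupp.sum_add_index' (by simp) (by simp)] at h3
    simp at h3
    have : (pderiv i p).totalDegree = s.sum fun _ e => e := hs'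
    omega
  have h := eq_C_of_dP key
  have h0 : coeff 0 p ≠ 0 := by
    intro h0; rw [h0, C_0] at h; exact hp.ne_zero h
  apply hp.not_isUnit
  rw [h]
  exact (isUnit_iff_ne_zero.mpr h0).map C

lemma dvd_sub_of_X (q : MvPolynomial ι ℂ) (f g : MvPolynomial ι ℂ →ₐ[ℂ] MvPolynomial ι ℂ)
    (h : ∀ i, q ∣ f (X i) - g (X i)) (p) : q ∣ f p - g p := by
  have : (Ideal.Quotient.mkₐ ℂ (Ideal.span {q})).comp f =
      (Ideal.Quotient.mkₐ ℂ (Ideal.span {q})).comp g := by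
    apply MvPolynomial.algHom_ext; intro i
    exact Ideal.Quotient.eq.mpr (Ideal.mem_span_singleton.mpr (h i))
  have := congrArg (fun f : _ →ₐ[ℂ] _ => f p) this
  exact Ideal.mem_span_singleton.mp (Ideal.Quotient.eq.mp this)

/-- The projector onto `ker α` along `a`. -/
def prM (a α : ι → ℂ) : Matrix ι ι ℂ := 1 - vecMulVec a α

lemma vecMul_vecMulVec' (β a α : ι → ℂ) : β ᵥ* vecMulVec a α = (β ⬝ᵥ a) • α := by
  funext j
  simp [vecMul, dotProduct, vecMulVec_apply, Finset.sum_mul, mul_assoc]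

lemma vecMul_prM (a α β : ι → ℂ) : β ᵥ* prM a α = β - (β ⬝ᵥ a) • α := by
  rw [prM, vecMul_sub, vecMul_one, vecMul_vecMulVec']

lemma lf_dvd_iff {a α : ι → ℂ} (h : α ⬝ᵥ a = 1) (p) : lf α ∣ p ↔ subP (prM a α) p = 0 := by
  constructor
  · rintro ⟨q, rfl⟩
    rw [map_mul, subP_lf, vecMul_prM, h]; simp
  · intro hp
    have := dvd_sub_of_X (lf α) (AlgHom.id ℂ _) (subP (prM a α)) (fun i => by
      have : subP (prM a α) (X i) = X i - C (a i) * lf α := by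
        rw [← lf_single, subP_lf, vecMul_prM, sub_eq_add_neg, lf_add, ← neg_smul, lf_smul]
        simp [sub_eq_add_neg]
      rw [this]; simp) p
    simpa [hp] using this

lemma prime_lf {a α : ι → ℂ} (h : α ⬝ᵥ a = 1) : Prime (lf α) := by
  have h0 : lf α ≠ 0 := by
    intro h0; rw [lf_inj h0] at h; simp at h
  refine ⟨h0, ?_, ?_⟩
  · intro hu
    have := (lf_dvd_iff h 1).mp hu.dvd
    simp at this
  · intro p q hpq
    rw [lf_dvd_iff h, map_mul] at hpq
    rw [lf_dvd_iff h, lf_dvd_iff h]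
    exact mul_eq_zero.mp hpq

end Poly
end KZ

namespace KZ
open MvPolynomial Matrix
section MatDer
variable {κ K : Type*} [Fintype κ] [DecidableEq κ] [Field K] [Algebra ℂ K]

/-- Entrywise derivation of a matrix. -/
def dm (D : Derivation ℂ K K) (F : Matrix κ κ K) : Matrix κ κ K := F.map D

/-- Scalar extension of a complex matrix. -/
def cM (K : Type*) [Field K] [Algebra ℂ K] : Matrix κ κ ℂ →+* Matrix κ κ K :=
  (algebraMap ℂ K).mapMatrix

lemma dm_apply (D : Derivation ℂ K K) (F : Matrix κ κ K) (i j) : dm D F i j = D (F i j) := rfl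
lemma cM_apply (T : Matrix κ κ ℂ) (i j) : cM K T i j = algebraMap ℂ K (T i j) := rfl
lemma dm_mul (D : Derivation ℂ K K) (F G : Matrix κ κ K) :
    dm D (F * G) = dm D F * G + F * dm D G := by
  ext i j
  simp [dm_apply, Matrix.mul_apply, Matrix.add_apply, Finset.sum_add_distrib, map_sum,
    Derivation.leibniz, mul_comm, add_comm]
lemma dm_add (D : Derivation ℂ K K) (F G : Matrix κ κ K) : dm D (F + G) = dm D F + dm D G := by
  ext i j; simp [dm_apply]
lemma dm_sub (D : Derivation ℂ K K) (F G : Matrix κ κ K) : dm D (F - G) = dm D F - dm D G := by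
  ext i j; simp [dm_apply]
lemma dm_zero (D : Derivation ℂ K K) : dm D (0 : Matrix κ κ K) = 0 := by
  ext i j; simp [dm_apply]
lemma dm_smul (D : Derivation ℂ K K) (c : K) (F : Matrix κ κ K) :
    dm D (c • F) = D c • F + c • dm D F := by
  ext i j; simp [dm_apply, mul_comm, add_comm]
lemma dm_sum (D : Derivation ℂ K K) {J : Type*} (s : Finset J) (F : J → Matrix κ κ K) :
    dm D (∑ j ∈ s, F j) = ∑ j ∈ s, dm D (F j) := by
  ext i j; simp [dm_apply, Matrix.sum_apply]
@[simp] lemma dm_cM (D : Derivation ℂ K K) (T : Matrix κ κ ℂ) : dm D (cM K T) = 0 := by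
  ext i j; simp [dm_apply, cM_apply]
@[simp] lemma dm_one (D : Derivation ℂ K K) : dm D (1 : Matrix κ κ K) = 0 := by
  have := dm_cM (K := K) D (1 : Matrix κ κ ℂ)
  simpa using this
lemma cM_smul (c : ℂ) (T : Matrix κ κ ℂ) : cM K (c • T) = algebraMap ℂ K c • cM K T := by
  ext i j; simp [cM_apply]
lemma cM_injective : Function.Injective (cM K : Matrix κ κ ℂ →+* Matrix κ κ K) := by
  intro S T h
  ext i j
  have := congrFun (congrFun h i) j
  rw [cM_apply, cM_apply] at this
  exact (algebraMap ℂ K).injective this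
end MatDer

/-- The data of a complex reflection arrangement together with a matrix representation. -/
structure Arr (W ι κ H : Type*) [Group W] [Fintype W] [Fintype ι] [DecidableEq ι]
    [Fintype κ] [DecidableEq κ] [Fintype H] [DecidableEq H] [MulAction W H] where
  act : W →* Matrix ι ι ℂ
  lam : W →* Matrix κ κ ℂ
  α : H → ι → ℂ
  a : H → ι → ℂ
  α_a : ∀ h, α h ⬝ᵥ a h = 1
  S : H → Subgroup W
  ω : ∀ h, S h →* ℂ
  ω_ne_one : ∀ h (w : S h), w ≠ 1 → ω h w ≠ 1
  act_S : ∀ h (w : S h), act w = 1 + (ω h w - 1) • vecMulVec (a h) (α h)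
  indep : ∀ h k, h ≠ k → ∀ c : ℂ, α k ≠ c • α h
  act_α : ∀ w h, ∃ c : ℂ, c ≠ 0 ∧ α (w • h) ᵥ* act w = c • α h
  S_conj : ∀ w h x, x ∈ S h → w * x * w⁻¹ ∈ S (w • h)
  v : ι → ℂ
  v_reg : ∀ h, α h ⬝ᵥ v ≠ 0

namespace Arr
variable {W ι κ H : Type*} [Group W] [Fintype W] [Fintype ι] [DecidableEq ι]
    [Fintype κ] [DecidableEq κ] [Fintype H] [DecidableEq H] [MulAction W H] (R : Arr W ι κ H)

open Classical in
/-- The residue at the hyperplane `h`. -/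
def A (h : H) : Matrix κ κ ℂ := ∑ w : R.S h, (1 - R.lam w)

/-- The sum of all residues. -/
def N : Matrix κ κ ℂ := ∑ h, R.A h

lemma lam_A (w : W) (h : H) : R.lam w * R.A h = R.A (w • h) * R.lam w := by
  classical
  simp only [A, Finset.mul_sum, Finset.sum_mul]
  refine Finset.sum_bij' (fun x _ => ⟨w * x * w⁻¹, R.S_conj w h x x.2⟩)
    (fun x _ => ⟨w⁻¹ * x * w, by
      have := R.S_conj w⁻¹ (w • h) x x.2
      simpa using this⟩) (by simp) (by simp) ?_ ?_ ?_
  · intro x _; ext; simp [mul_assoc]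
  · intro x _; ext; simp [mul_assoc]
  · intro x _
    simp only [mul_sub, sub_mul, mul_one, one_mul, ← map_mul]
    simp

lemma lam_N (w : W) : R.lam w * R.N = R.N * R.lam w := by
  simp only [N, Finset.mul_sum, Finset.sum_mul, lam_A]
  exact Fintype.sum_equiv (MulAction.toPerm w) _ _ (fun h => rfl)

lemma N_A (h : H) : R.N * R.A h = R.A h * R.N := by
  classical
  simp only [A, Finset.mul_sum, Finset.sum_mul, mul_sub, sub_mul, mul_one, one_mul, lam_N]

lemma lf_ne (h : H) : lf (R.α h) ≠ 0 := (prime_lf (R.α_a h)).ne_zero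

section K
variable (K : Type*) [Field K] [Algebra (MvPolynomial ι ℂ) K] [IsFractionRing (MvPolynomial ι ℂ) K]
  [Algebra ℂ K] [IsScalarTower ℂ (MvPolynomial ι ℂ) K]

/-- The linear form of `h` inside the function field. -/
def ell (h : H) : K := algebraMap (MvPolynomial ι ℂ) K (lf (R.α h))

lemma ell_ne (h : H) : R.ell K h ≠ 0 := by
  intro h0
  exact R.lf_ne h (IsFractionRing.injective (MvPolynomial ι ℂ) K (h0.trans (map_zero _).symm))

/-- Logarithmic derivative of the linear form. -/
def u (h : H) (y : ι → ℂ) : K := algebraMap ℂ K (R.α h ⬝ᵥ y) / R.ell K h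

/-- The connection matrix. -/
def M (y : ι → ℂ) : Matrix κ κ K := ∑ h, R.u K h y • cM K (R.A h)

lemma algC (c : ℂ) : algebraMap (MvPolynomial ι ℂ) K (C c) = algebraMap ℂ K c := by
  rw [IsScalarTower.algebraMap_apply ℂ (MvPolynomial ι ℂ) K]; rfl

end K
section K2
variable {K : Type*} [Field K] [Algebra (MvPolynomial ι ℂ) K] [IsFractionRing (MvPolynomial ι ℂ) K]
  [Algebra ℂ K] [IsScalarTower ℂ (MvPolynomial ι ℂ) K]

/-- The covariant derivative. -/
def nab (y : ι → ℂ) (F : Matrix κ κ K) : Matrix κ κ K :=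
  dm (extDer K (dP y)) F - R.M K y * F

lemma extDer_ell (D : Derivation ℂ (MvPolynomial ι ℂ) (MvPolynomial ι ℂ)) (h : H) :
    extDer K D (R.ell K h) = algebraMap (MvPolynomial ι ℂ) K (D (lf (R.α h))) := by
  rw [ell, extDer_algebraMap]

lemma dK_u (x y : ι → ℂ) (h : H) :
    extDer K (dP x) (R.u K h y) = - (R.u K h x * R.u K h y) := by
  rw [u, Derivation.leibniz_div, extDer_ell, dP_lf, algC]
  have := R.ell_ne K h
  simp [u]
  field_simp

lemma eK_u (y : ι → ℂ) (h : H) :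
    extDer K (eP ι) (R.u K h y) = - R.u K h y := by
  rw [u, Derivation.leibniz_div, extDer_ell, eP_lf]
  have := R.ell_ne K h
  change _ = - (_ / R.ell K h)
  rw [show (algebraMap (MvPolynomial ι ℂ) K) (lf (R.α h)) = R.ell K h from rfl]
  simp
  field_simp

lemma u_add (x y : ι → ℂ) (h : H) : R.u K h (x + y) = R.u K h x + R.u K h y := by
  simp [u, dotProduct_add, add_div]
lemma u_smul (c : ℂ) (y : ι → ℂ) (h : H) : R.u K h (c • y) = algebraMap ℂ K c * R.u K h y := by
  simp [u, dotProduct_smul, mul_div_assoc]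

lemma M_add (x y : ι → ℂ) : R.M K (x + y) = R.M K x + R.M K y := by
  simp [M, u_add, add_smul, Finset.sum_add_distrib]
lemma M_smul (c : ℂ) (y : ι → ℂ) : R.M K (c • y) = algebraMap ℂ K c • R.M K y := by
  simp [M, u_smul, mul_smul, Finset.smul_sum]

lemma dK_add (x y : ι → ℂ) (z : K) :
    extDer K (dP (x + y)) z = extDer K (dP x) z + extDer K (dP y) z := by
  have := der_ext (A := MvPolynomial ι ℂ) (extDer K (dP (x + y)))
    (extDer K (dP x) + extDer K (dP y)) (fun p => by
      simp only [Derivation.add_apply, extDer_algebraMap, dP_add, map_add]) z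
  exact this
lemma dK_smul (c : ℂ) (y : ι → ℂ) (z : K) :
    extDer K (dP (c • y)) z = algebraMap ℂ K c * extDer K (dP y) z := by
  have := der_ext (A := MvPolynomial ι ℂ) (extDer K (dP (c • y)))
    (algebraMap ℂ K c • extDer K (dP y)) (fun p => by
      simp only [Derivation.smul_apply, extDer_algebraMap, dP_smul, map_mul, algC, smul_eq_mul]) z
  exact this
lemma dK_comm (x y : ι → ℂ) (z : K) :
    extDer K (dP x) (extDer K (dP y) z) = extDer K (dP y) (extDer K (dP x) z) := by
  have := der_eq_zero (A := MvPolynomial ι ℂ) ⁅extDer K (dP x), extDer K (dP y)⁆ (fun p => by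
      simp only [Derivation.commutator_apply, extDer_algebraMap, dP_comm x y, sub_self]) z
  rw [Derivation.commutator_apply, sub_eq_zero] at this
  exact this
lemma eK_dK (y : ι → ℂ) (z : K) :
    extDer K (eP ι) (extDer K (dP y) z) =
      extDer K (dP y) (extDer K (eP ι) z) - extDer K (dP y) z := by
  have := der_eq_zero (A := MvPolynomial ι ℂ)
    (⁅extDer K (eP ι), extDer K (dP y)⁆ + extDer K (dP y)) (fun p => by
      simp only [Derivation.add_apply, Derivation.commutator_apply, extDer_algebraMap, eP_dP,
        map_sub]; ring) z
  rw [Derivation.add_apply, Derivation.commutator_apply] at this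
  linear_combination this
lemma eK_eq (z : K) :
    extDer K (eP ι) z = ∑ i, algebraMap (MvPolynomial ι ℂ) K (X i) *
      extDer K (dP (Pi.single i 1)) z := by
  have hs : ∀ (s : Finset ι) (z : K), (∑ i ∈ s, algebraMap (MvPolynomial ι ℂ) K (X i) •
      extDer K (dP (Pi.single i 1))) z = ∑ i ∈ s, algebraMap (MvPolynomial ι ℂ) K (X i) *
      extDer K (dP (Pi.single i 1)) z := by
    intro s z
    induction s using Finset.induction_on with
    | empty => simp
    | insert a s ha ih => rw [Finset.sum_insert ha, Finset.sum_insert ha, ← ih]; rfl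
  have := der_ext (A := MvPolynomial ι ℂ) (extDer K (eP ι))
    (∑ i, algebraMap (MvPolynomial ι ℂ) K (X i) • extDer K (dP (Pi.single i 1))) (fun p => by
      rw [hs]
      simp only [extDer_algebraMap, eP_eq, map_sum, map_mul]) z
  rw [this, hs]

lemma nab_addF (y : ι → ℂ) (F G : Matrix κ κ K) : R.nab y (F + G) = R.nab y F + R.nab y G := by
  simp only [nab, dm_add, mul_add]; abel
lemma nab_subF (y : ι → ℂ) (F G : Matrix κ κ K) : R.nab y (F - G) = R.nab y F - R.nab y G := by
  simp only [nab, dm_sub, mul_sub]; abel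
lemma nab_zeroF (y : ι → ℂ) : R.nab y (0 : Matrix κ κ K) = 0 := by
  simp [nab, dm_zero]
lemma nab_sumF (y : ι → ℂ) {J : Type*} (s : Finset J) (F : J → Matrix κ κ K) :
    R.nab y (∑ j ∈ s, F j) = ∑ j ∈ s, R.nab y (F j) := by
  simp only [nab, dm_sum, Finset.mul_sum, Finset.sum_sub_distrib]
lemma nab_smulF (y : ι → ℂ) (c : K) (F : Matrix κ κ K) :
    R.nab y (c • F) = extDer K (dP y) c • F + c • R.nab y F := by
  simp only [nab, dm_smul, mul_smul_comm, smul_sub]; abel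
lemma nab_mul_cM (y : ι → ℂ) (F : Matrix κ κ K) (T : Matrix κ κ ℂ) :
    R.nab y (F * cM K T) = R.nab y F * cM K T := by
  simp only [nab, dm_mul, dm_cM, mul_zero, add_zero, sub_mul, mul_assoc]
lemma nab_add (x y : ι → ℂ) (F : Matrix κ κ K) : R.nab (x + y) F = R.nab x F + R.nab y F := by
  have : dm (extDer K (dP (x + y))) F = dm (extDer K (dP x)) F + dm (extDer K (dP y)) F := by
    ext i j; simp only [dm_apply, dK_add, Matrix.add_apply]
  simp only [nab, this, M_add, add_mul]; abel
lemma nab_smul (c : ℂ) (y : ι → ℂ) (F : Matrix κ κ K) :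
    R.nab (c • y) F = algebraMap ℂ K c • R.nab y F := by
  have : dm (extDer K (dP (c • y))) F = algebraMap ℂ K c • dm (extDer K (dP y)) F := by
    ext i j; simp only [dm_apply, dK_smul, Matrix.smul_apply, smul_eq_mul]
  simp only [nab, this, M_smul, smul_mul_assoc, smul_sub]

/-- The commutation of connection matrices, summed over one rank two flat. -/
lemma flat_local (L : Submodule ℂ (ι → ℂ)) (h₀ h₁ : H)
    (hL : L = Submodule.span ℂ {R.α h₀, R.α h₁}) (x y : ι → ℂ) (s : Finset H)
    (hs : ∀ h, h ∈ s ↔ R.α h ∈ L) :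
    ∑ h ∈ s, ∑ k ∈ s, (R.u K h x * R.u K k y - R.u K h y * R.u K k x) •
      (cM K (R.A h) * cM K (R.A k)) = 0 := by
  classical
  have hr : ∀ h ∈ s, ∃ r : K, ∀ z, R.u K h z =
      R.u K h₀ z + r * (R.u K h₁ z - R.u K h₀ z) := by
    intro h hh
    rw [hs, hL, Submodule.mem_span_pair] at hh
    obtain ⟨c, d, hcd⟩ := hh
    have hl : R.ell K h = algebraMap ℂ K c * R.ell K h₀ + algebraMap ℂ K d * R.ell K h₁ := by
      rw [ell, ← hcd, lf_add, lf_smul, lf_smul, map_add, map_mul, map_mul, algC, algC]; rfl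
    refine ⟨algebraMap ℂ K d * R.ell K h₁ / R.ell K h, fun z => ?_⟩
    have h1 := R.ell_ne K h
    have h2 := R.ell_ne K h₀
    have h3 := R.ell_ne K h₁
    have hz : algebraMap ℂ K (R.α h ⬝ᵥ z) = algebraMap ℂ K c * algebraMap ℂ K (R.α h₀ ⬝ᵥ z) +
        algebraMap ℂ K d * algebraMap ℂ K (R.α h₁ ⬝ᵥ z) := by
      rw [← hcd, add_dotProduct, smul_dotProduct, smul_dotProduct]; simp
    simp only [u]
    rw [hz]
    field_simp
    rw [hl]
    ring
  choose! r hr using hr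
  set AS : Matrix κ κ ℂ := ∑ k ∈ s, R.A k with hAS
  have hlam : ∀ h ∈ s, ∀ w : R.S h, R.lam w * AS = AS * R.lam w := by
    intro h hh w
    have hmem : ∀ k, R.α ((w : W) • k) ∈ L → R.α k ∈ L := by
      intro k hk
      obtain ⟨c, hc, hck⟩ := R.act_α w k
      have : R.α k = c⁻¹ • (R.α ((w : W) • k) ᵥ* R.act w) := by
        rw [hck, smul_smul, inv_mul_cancel₀ hc, one_smul]
      rw [this, R.act_S h w, vecMul_add, vecMul_one, vecMul_smul, vecMul_vecMulVec']
      exact L.smul_mem _ (L.add_mem hk (L.smul_mem _ (L.smul_mem _ ((hs h).mp hh))))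
    rw [hAS, Finset.mul_sum, Finset.sum_mul]
    simp only [lam_A]
    have hinj : Set.InjOn (fun k => (w : W)⁻¹ • k) (s : Set H) := fun k _ k' _ h =>
      smul_left_cancel _ h
    have himg : s.image (fun k => (w : W)⁻¹ • k) = s := by
      apply Finset.eq_of_subset_of_card_le
      · intro k hk
        obtain ⟨k', hk', rfl⟩ := Finset.mem_image.mp hk
        rw [hs] at hk' ⊢
        apply hmem
        simpa using hk'
      · rw [Finset.card_image_of_injOn hinj]
    conv_lhs => rw [← himg]
    rw [Finset.sum_image hinj]
    simp
  have hcomm : ∀ h ∈ s, R.A h * AS = AS * R.A h := by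
    intro h hh
    simp only [A, Finset.sum_mul, Finset.mul_sum, sub_mul, mul_sub, one_mul, mul_one]
    refine Finset.sum_congr rfl fun w _ => ?_
    rw [hlam h hh w]
  have hcommK : ∀ h ∈ s, cM K (R.A h) * cM K AS = cM K AS * cM K (R.A h) := by
    intro h hh; rw [← map_mul, hcomm h hh, map_mul]
  set c := R.u K h₀ x * (R.u K h₁ y - R.u K h₀ y) - R.u K h₀ y * (R.u K h₁ x - R.u K h₀ x) with hc
  have h1 : ∀ h ∈ s, ∑ k ∈ s, (R.u K h x * R.u K k y - R.u K h y * R.u K k x) •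
      (cM K (R.A h) * cM K (R.A k)) = c • (cM K (R.A h) * ∑ k ∈ s, r k • cM K (R.A k)) -
        (c * r h) • (cM K (R.A h) * cM K AS) := by
    intro h hh
    rw [hAS, map_sum, Finset.mul_sum, Finset.mul_sum, Finset.smul_sum, Finset.smul_sum,
      ← Finset.sum_sub_distrib]
    refine Finset.sum_congr rfl fun k hk => ?_
    rw [mul_smul_comm, smul_smul, ← sub_smul, hr h hh, hr k hk, hr h hh, hr k hk]
    congr 1
    rw [hc]; ring
  rw [Finset.sum_congr rfl h1, Finset.sum_sub_distrib, ← Finset.smul_sum, ← Finset.sum_mul,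
    ← map_sum, ← hAS, Finset.mul_sum, Finset.smul_sum, ← Finset.sum_sub_distrib]
  refine Finset.sum_eq_zero fun h hh => ?_
  rw [hcommK h hh, mul_smul_comm, smul_smul, sub_self]

lemma M_comm (x y : ι → ℂ) : R.M K x * R.M K y = R.M K y * R.M K x := by
  classical
  set f : H × H → Matrix κ κ K := fun q => (R.u K q.1 x * R.u K q.2 y - R.u K q.1 y * R.u K q.2 x) •
      (cM K (R.A q.1) * cM K (R.A q.2)) with hf
  have hff : ∀ h, f (h, h) = 0 := by
    intro h; simp only [hf]; rw [mul_comm, sub_self, zero_smul]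
  have h0 : R.M K x * R.M K y - R.M K y * R.M K x = ∑ q : H × H, f q := by
    rw [Fintype.sum_prod_type]
    simp only [M, Finset.sum_mul, Finset.mul_sum, hf, sub_smul, Finset.sum_sub_distrib,
      smul_mul_assoc, mul_smul_comm, smul_smul]
    congr 1
    · rw [Finset.sum_comm]
      refine Finset.sum_congr rfl fun h _ => ?_
      rw [Finset.smul_sum]
      refine Finset.sum_congr rfl fun k _ => ?_
      rw [smul_smul]
      congr 1; ring
    · rw [Finset.sum_comm]
      refine Finset.sum_congr rfl fun h _ => ?_
      rw [Finset.smul_sum]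
      refine Finset.sum_congr rfl fun k _ => ?_
      rw [smul_smul]
      congr 1; ring
  rw [← sub_eq_zero, h0]
  have h1 : ∑ q : H × H, f q = ∑ q ∈ (Finset.univ : Finset H).offDiag, f q := by
    symm
    apply Finset.sum_subset (Finset.subset_univ _)
    rintro ⟨h, k⟩ _ hn
    have : h = k := by simpa using hn
    rw [this, hff]
  rw [h1]
  set g : H × H → Submodule ℂ (ι → ℂ) := fun q => Submodule.span ℂ {R.α q.1, R.α q.2} with hg
  rw [← Finset.sum_fiberwise_of_maps_to (t := ((Finset.univ : Finset H).offDiag).image g)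
    (g := g) (fun q hq => Finset.mem_image_of_mem g hq)]
  refine Finset.sum_eq_zero fun L hL => ?_
  obtain ⟨⟨h₀, h₁⟩, h01, rfl⟩ := Finset.mem_image.mp hL
  set s : Finset H := Finset.univ.filter (fun h => R.α h ∈ g (h₀, h₁)) with hs
  have hloc := R.flat_local (K := K) (g (h₀, h₁)) h₀ h₁ rfl x y s (fun h => by simp [hs])
  rw [← Finset.sum_product'] at hloc
  rw [← hloc]
  apply Finset.sum_subset
  · rintro ⟨h, k⟩ hq
    simp only [Finset.mem_filter] at hq
    rw [Finset.mem_product, hs]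
    simp only [Finset.mem_filter, Finset.mem_univ, true_and]
    rw [← hq.2]
    exact ⟨Submodule.subset_span (by simp), Submodule.subset_span (by simp)⟩
  · rintro ⟨h, k⟩ hq hn
    rw [Finset.mem_product, hs] at hq
    simp only [Finset.mem_filter, Finset.mem_univ, true_and] at hq
    by_cases hk : h = k
    · rw [hk]; exact hff k
    · exfalso
      apply hn
      simp only [Finset.mem_filter, Finset.mem_offDiag, Finset.mem_univ, true_and]
      refine ⟨hk, ?_⟩
      -- two independent vectors of the plane span it
      have hle : g (h, k) ≤ g (h₀, h₁) := by
        rw [hg]; simp only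
        rw [Submodule.span_le]
        intro z hz
        rcases hz with rfl | rfl
        · exact hq.1
        · exact hq.2
      apply Submodule.eq_of_le_of_finrank_le hle
      have hli : LinearIndependent ℂ ![R.α h, R.α k] := by
        rw [LinearIndependent.pair_iff' (by
          intro h0; have := R.α_a h; rw [h0] at this; simp at this)]
        intro c hc
        exact R.indep h k hk c hc.symm
      have hr2 := finrank_span_eq_card hli
      have hset : Set.range ![R.α h, R.α k] = {R.α h, R.α k} := by
        simp [Matrix.range_cons, Set.pair_comm]
      rw [hset] at hr2
      change Module.finrank ℂ (Submodule.span ℂ {R.α h₀, R.α h₁}) ≤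
        Module.finrank ℂ (Submodule.span ℂ {R.α h, R.α k})
      rw [hr2]
      refine (finrank_span_le_card _).trans ?_
      simp only [Set.toFinset_insert, Set.toFinset_singleton, Fintype.card_fin]
      exact Finset.card_le_two

lemma nab_comm (x y : ι → ℂ) (F : Matrix κ κ K) :
    R.nab x (R.nab y F) = R.nab y (R.nab x F) := by
  have h1 : dm (extDer K (dP x)) (dm (extDer K (dP y)) F) =
      dm (extDer K (dP y)) (dm (extDer K (dP x)) F) := by
    ext i j; simp only [dm_apply, dK_comm x y]
  have h2 : ∀ x y, dm (extDer K (dP x)) (R.M K y) =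
      ∑ h, (-(R.u K h x * R.u K h y)) • cM K (R.A h) := by
    intro x y
    simp only [M, dm_sum, dm_smul, dm_cM, smul_zero, add_zero, dK_u]
  have h3 : dm (extDer K (dP x)) (R.M K y) = dm (extDer K (dP y)) (R.M K x) := by
    rw [h2, h2]; simp only [mul_comm]
  simp only [nab, dm_sub, dm_mul, mul_sub]
  rw [h1, h3, ← mul_assoc, ← mul_assoc, R.M_comm x y]
  abel

end K2
end Arr
end KZ

namespace KZ
open MvPolynomial Matrix
namespace Arr
variable {W ι κ H : Type*} [Group W] [Fintype W] [Fintype ι] [DecidableEq ι]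
    [Fintype κ] [DecidableEq κ] [Fintype H] [DecidableEq H] [MulAction W H] (R : Arr W ι κ H)

/-- The action of the group on polynomials. -/
def sigP (w : W) : MvPolynomial ι ℂ →ₐ[ℂ] MvPolynomial ι ℂ := subP (R.act w⁻¹)

lemma act_inv_mul (w : W) : R.act w⁻¹ * R.act w = 1 := by rw [← map_mul]; simp
lemma act_mul_inv (w : W) : R.act w * R.act w⁻¹ = 1 := by rw [← map_mul]; simp

lemma sigP_injective (w : W) : Function.Injective (R.sigP w) := by
  intro p q h
  have : ∀ p, subP (R.act w) (R.sigP w p) = p := by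
    intro p; rw [sigP, ← subP_mul, act_inv_mul, subP_one]
  rw [← this p, h, this]

lemma sigP_mul (w w' : W) (p) : R.sigP (w * w') p = R.sigP w (R.sigP w' p) := by
  rw [sigP, sigP, sigP, ← subP_mul, ← map_mul, _root_.mul_inv_rev]

lemma sigP_dP (w : W) (y : ι → ℂ) (p) : R.sigP w (dP y p) = dP (R.act w *ᵥ y) (R.sigP w p) := by
  rw [sigP, dP_subP, mulVec_mulVec, act_inv_mul, one_mulVec]

lemma vecMul_act_inv (w : W) (h : H) : ∃ c : ℂ, c ≠ 0 ∧
    R.α h ᵥ* R.act w⁻¹ = c • R.α (w • h) ∧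
    ∀ y, R.α h ⬝ᵥ y = c * (R.α (w • h) ⬝ᵥ (R.act w *ᵥ y)) := by
  obtain ⟨c, hc, h1⟩ := R.act_α w h
  refine ⟨c⁻¹, inv_ne_zero hc, ?_, fun y => ?_⟩
  · have : R.α h = c⁻¹ • (R.α (w • h) ᵥ* R.act w) := by
      rw [h1, smul_smul, inv_mul_cancel₀ hc, one_smul]
    rw [this, smul_vecMul, vecMul_vecMul, act_mul_inv, vecMul_one]
  · rw [dotProduct_mulVec, h1, smul_dotProduct, smul_eq_mul, ← mul_assoc, inv_mul_cancel₀ hc,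
      one_mul]

lemma ω_ne (h : H) (w : R.S h) : R.ω h w ≠ 0 := by
  intro h0
  have : R.ω h w * R.ω h w⁻¹ = 1 := by rw [← map_mul]; simp
  rw [h0] at this; simp at this

lemma ω_inv (h : H) (w : R.S h) : R.ω h w⁻¹ = (R.ω h w)⁻¹ := by
  have : R.ω h w * R.ω h w⁻¹ = 1 := by rw [← map_mul]; simp
  exact eq_inv_of_mul_eq_one_right this

lemma act_a (h : H) (w : R.S h) : R.act w *ᵥ R.a h = R.ω h w • R.a h := by
  rw [R.act_S h w, add_mulVec, one_mulVec, smul_mulVec, vecMulVec_mulVec, R.α_a]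
  funext i; simp; ring

lemma act_ker (h : H) (w : R.S h) (y : ι → ℂ) (hy : R.α h ⬝ᵥ y = 0) : R.act w *ᵥ y = y := by
  rw [R.act_S h w, add_mulVec, one_mulVec, smul_mulVec, vecMulVec_mulVec, hy]
  funext i; simp

lemma α_act_inv (h : H) (w : R.S h) : R.α h ᵥ* R.act (w : W)⁻¹ = (R.ω h w)⁻¹ • R.α h := by
  have := R.act_S h w⁻¹
  rw [show R.act (w : W)⁻¹ = R.act ((w⁻¹ : R.S h) : W) from rfl, this, vecMul_add, vecMul_one,
    vecMul_smul, vecMul_vecMulVec', R.α_a, ω_inv]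
  funext i; simp; ring

section K2
variable {K : Type*} [Field K] [Algebra (MvPolynomial ι ℂ) K] [IsFractionRing (MvPolynomial ι ℂ) K]
  [Algebra ℂ K] [IsScalarTower ℂ (MvPolynomial ι ℂ) K]

variable (K) in
/-- The action of the group on rational functions. -/
def sigK (w : W) : K →+* K :=
  IsFractionRing.lift (A := MvPolynomial ι ℂ) (K := K)
    (g := (algebraMap (MvPolynomial ι ℂ) K).comp (R.sigP w : MvPolynomial ι ℂ →+* MvPolynomial ι ℂ))
    ((IsFractionRing.injective (MvPolynomial ι ℂ) K).comp (R.sigP_injective w))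

@[simp] lemma sigK_alg (w : W) (p : MvPolynomial ι ℂ) :
    R.sigK K w (algebraMap _ K p) = algebraMap _ K (R.sigP w p) :=
  IsFractionRing.lift_algebraMap _ _

@[simp] lemma sigK_C (w : W) (c : ℂ) : R.sigK K w (algebraMap ℂ K c) = algebraMap ℂ K c := by
  rw [← algC (ι := ι), sigK_alg, sigP, subP_C]

lemma sigK_mul (w w' : W) (x : K) : R.sigK K (w * w') x = R.sigK K w (R.sigK K w' x) := by
  have : R.sigK K (w * w') = (R.sigK K w).comp (R.sigK K w') := by
    apply IsLocalization.ringHom_ext (nonZeroDivisors (MvPolynomial ι ℂ))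
    ext p <;> simp [sigP_mul]
  rw [this]; rfl

lemma sigK_dK (w : W) (y : ι → ℂ) (x : K) :
    R.sigK K w (extDer K (dP y) x) = extDer K (dP (R.act w *ᵥ y)) (R.sigK K w x) := by
  obtain ⟨s, t, ht, rfl⟩ := IsFractionRing.div_surjective (A := MvPolynomial ι ℂ) x
  have h0 : algebraMap (MvPolynomial ι ℂ) K t ≠ 0 := by simpa using nonZeroDivisors.ne_zero ht
  set x := algebraMap (MvPolynomial ι ℂ) K s / algebraMap (MvPolynomial ι ℂ) K t with hx
  have h1 : algebraMap (MvPolynomial ι ℂ) K t * x = algebraMap (MvPolynomial ι ℂ) K s := by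
    rw [hx]; field_simp
  have h2 := congrArg (R.sigK K w) (congrArg (extDer K (dP y)) h1)
  have h3 := congrArg (extDer K (dP (R.act w *ᵥ y))) (congrArg (R.sigK K w) h1)
  simp only [map_mul, sigK_alg, Derivation.leibniz, extDer_algebraMap, smul_eq_mul, map_add,
    sigP_dP] at h2 h3
  have h4 : algebraMap (MvPolynomial ι ℂ) K (R.sigP w t) ≠ 0 := by
    rw [← sigK_alg]; exact (map_ne_zero (R.sigK K w)).mpr h0
  apply mul_left_cancel₀ h4
  linear_combination h2 - h3

lemma sigK_ell (w : W) (h : H) : R.sigK K w (R.ell K h) =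
    algebraMap (MvPolynomial ι ℂ) K (lf (R.α h ᵥ* R.act w⁻¹)) := by
  rw [ell, sigK_alg, sigP, subP_lf]

lemma sigK_u (w : W) (h : H) (y : ι → ℂ) :
    R.sigK K w (R.u K h y) = R.u K (w • h) (R.act w *ᵥ y) := by
  obtain ⟨c, hc, h1, h2⟩ := R.vecMul_act_inv w h
  rw [u, map_div₀, sigK_C, sigK_ell, h1, h2, lf_smul, map_mul (algebraMap (MvPolynomial ι ℂ) K), algC, map_mul, u]
  have hc' : algebraMap ℂ K c ≠ 0 := by simpa using hc
  rw [mul_div_mul_left _ _ hc']; rfl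

/-- The twisted action on matrix valued functions. -/
def tau (w : W) (F : Matrix κ κ K) : Matrix κ κ K := cM K (R.lam w) * (R.sigK K w).mapMatrix F

lemma sig_cM (w : W) (T : Matrix κ κ ℂ) : (R.sigK K w).mapMatrix (cM K T) = cM K T := by
  ext i j; simp [cM_apply]

lemma sig_smul (w : W) (c : K) (F : Matrix κ κ K) :
    (R.sigK K w).mapMatrix (c • F) = R.sigK K w c • (R.sigK K w).mapMatrix F := by
  ext i j; simp

lemma sig_dm (w : W) (y : ι → ℂ) (F : Matrix κ κ K) :
    (R.sigK K w).mapMatrix (dm (extDer K (dP y)) F) =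
      dm (extDer K (dP (R.act w *ᵥ y))) ((R.sigK K w).mapMatrix F) := by
  ext i j; simp [dm_apply, sigK_dK]

lemma sig_mul (w w' : W) (F : Matrix κ κ K) :
    (R.sigK K (w * w')).mapMatrix F = (R.sigK K w).mapMatrix ((R.sigK K w').mapMatrix F) := by
  ext i j; simp [sigK_mul]

lemma sig_M (w : W) (y : ι → ℂ) :
    cM K (R.lam w) * (R.sigK K w).mapMatrix (R.M K y) = R.M K (R.act w *ᵥ y) * cM K (R.lam w) := by
  simp only [M, map_sum, sig_smul, sig_cM, sigK_u, Finset.mul_sum, Finset.sum_mul, mul_smul_comm,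
    ← map_mul, lam_A, smul_mul_assoc]
  exact Fintype.sum_equiv (MulAction.toPerm w) _ _ (fun h => rfl)

lemma tau_nab (w : W) (y : ι → ℂ) (F : Matrix κ κ K) :
    R.tau w (R.nab y F) = R.nab (R.act w *ᵥ y) (R.tau w F) := by
  rw [tau, nab, map_sub, sig_dm, map_mul, mul_sub, ← mul_assoc, sig_M, nab, tau, dm_mul, dm_cM,
    zero_mul, zero_add, mul_assoc]

lemma tau_smul (w : W) (c : K) (F : Matrix κ κ K) :
    R.tau w (c • F) = R.sigK K w c • R.tau w F := by
  rw [tau, sig_smul, mul_smul_comm]; rfl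
lemma tau_add (w : W) (F G : Matrix κ κ K) : R.tau w (F + G) = R.tau w F + R.tau w G := by
  simp only [tau, map_add, mul_add]
lemma tau_sum (w : W) {J : Type*} (s : Finset J) (F : J → Matrix κ κ K) :
    R.tau w (∑ j ∈ s, F j) = ∑ j ∈ s, R.tau w (F j) := by
  simp only [tau, map_sum, Finset.mul_sum]
lemma tau_mul (w w' : W) (F : Matrix κ κ K) : R.tau (w * w') F = R.tau w (R.tau w' F) := by
  simp only [tau, sig_mul, map_mul, sig_cM, mul_assoc]
lemma tau_mul_cM (w : W) (F : Matrix κ κ K) (T : Matrix κ κ ℂ) :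
    R.tau w (F * cM K T) = R.tau w F * cM K T := by
  simp only [tau, map_mul, sig_cM, mul_assoc]

lemma sigK_ell_S (h : H) (w : R.S h) : R.sigK K w (R.ell K h) =
    algebraMap ℂ K (R.ω h w)⁻¹ * R.ell K h := by
  rw [sigK_ell, α_act_inv, lf_smul, map_mul, algC]; rfl

end K2
end Arr
end KZ

namespace KZ
open MvPolynomial Matrix

section LocMat
variable {A κ K : Type*} [CommRing A] [IsDomain A] [Field K] [Algebra A K] [IsFractionRing A K]
  [Fintype κ] [DecidableEq κ]

lemma smul_mem_mat {O : Subring K} {c : K} (hc : c ∈ O) {F : Matrix κ κ K}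
    (hF : F ∈ O.matrix) : c • F ∈ O.matrix := fun i j => O.mul_mem hc (hF i j)

end LocMat

namespace Arr
variable {W ι κ H : Type*} [Group W] [Fintype W] [Fintype ι] [DecidableEq ι]
    [Fintype κ] [DecidableEq κ] [Fintype H] [DecidableEq H] [MulAction W H] (R : Arr W ι κ H)
open scoped Classical

section K2
variable {K : Type*} [Field K] [Algebra (MvPolynomial ι ℂ) K] [IsFractionRing (MvPolynomial ι ℂ) K]
  [Algebra ℂ K] [IsScalarTower ℂ (MvPolynomial ι ℂ) K]

lemma C_mem_loc {p : MvPolynomial ι ℂ} {hp : Prime p} (c : ℂ) : algebraMap ℂ K c ∈ locRing K p hp := by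
  rw [← algC (ι := ι)]; exact algebraMap_mem_locRing _
lemma cM_mem_loc {p : MvPolynomial ι ℂ} {hp : Prime p} (T : Matrix κ κ ℂ) :
    cM K T ∈ (locRing K p hp).matrix := fun i j => C_mem_loc (hp := hp) _
lemma dm_mem_loc {p : MvPolynomial ι ℂ} {hp : Prime p}
    (D : Derivation ℂ (MvPolynomial ι ℂ) (MvPolynomial ι ℂ)) {F : Matrix κ κ K}
    (hF : F ∈ (locRing K p hp).matrix) : dm (extDer K D) F ∈ (locRing K p hp).matrix :=
  fun i j => der_mem_locRing (hp := hp) D (hF i j)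

variable (K) in
/-- The local ring at the hyperplane `h`. -/
def O (h : H) : Subring K := locRing K (lf (R.α h)) (prime_lf (R.α_a h))

variable (K) in
/-- Matrices over the local ring at `h`. -/
def MO (h : H) : Subring (Matrix κ κ K) := (R.O K h).matrix

lemma cM_mem (h : H) (T : Matrix κ κ ℂ) : cM K T ∈ R.MO K h := cM_mem_loc T
lemma C_mem (h : H) (c : ℂ) : algebraMap ℂ K c ∈ R.O K h := C_mem_loc c
lemma P_mem (h : H) (p : MvPolynomial ι ℂ) : algebraMap _ K p ∈ R.O K h := algebraMap_mem_locRing p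
lemma ell_mem (h k : H) : R.ell K k ∈ R.O K h := R.P_mem h _
lemma dm_mem (h : H) (y : ι → ℂ) {F : Matrix κ κ K} (hF : F ∈ R.MO K h) :
    dm (extDer K (dP y)) F ∈ R.MO K h := dm_mem_loc _ hF
lemma smul_mem (h : H) {c : K} (hc : c ∈ R.O K h) {F : Matrix κ κ K} (hF : F ∈ R.MO K h) :
    c • F ∈ R.MO K h := smul_mem_mat hc hF

lemma not_dvd (h k : H) (hk : k ≠ h) : ¬ lf (R.α h) ∣ lf (R.α k) := by
  rw [lf_dvd_iff (R.α_a h), subP_lf, vecMul_prM]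
  intro h0
  have := lf_inj h0
  exact R.indep h k hk.symm _ (sub_eq_zero.mp this)

lemma u_mem (h k : H) (hk : k ≠ h) (y : ι → ℂ) : R.u K k y ∈ R.O K h := by
  rw [u, div_eq_mul_inv]
  exact (R.O K h).mul_mem (R.C_mem h _) (inv_mem_locRing (R.not_dvd h k hk))

lemma M_split (h : H) (y : ι → ℂ) : ∃ B ∈ R.MO K h,
    R.M K y = R.u K h y • cM K (R.A h) + B := by
  refine ⟨∑ k ∈ Finset.univ.erase h, R.u K k y • cM K (R.A k), ?_, ?_⟩
  · exact (R.MO K h).sum_mem fun k hk =>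
      R.smul_mem h (R.u_mem h k (Finset.ne_of_mem_erase hk) y) (R.cM_mem h _)
  · rw [M, Finset.add_sum_erase Finset.univ (fun k => R.u K k y • cM K (R.A k)) (Finset.mem_univ h)]

lemma u_a (h : H) : R.u K h (R.a h) = (R.ell K h)⁻¹ := by rw [u, R.α_a]; simp

/-- If `y` lies in the hyperplane then `nab y` preserves regularity. -/
lemma nab_tangent_mem (h : H) (y : ι → ℂ) (hy : R.α h ⬝ᵥ y = 0) {F : Matrix κ κ K}
    (hF : F ∈ R.MO K h) : R.nab y F ∈ R.MO K h := by
  obtain ⟨B, hB, hM⟩ := R.M_split (K := K) h y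
  have : R.u K h y = 0 := by rw [u, hy]; simp
  rw [nab, hM, this, zero_smul, zero_add]
  exact (R.MO K h).sub_mem (R.dm_mem h y hF) ((R.MO K h).mul_mem hB hF)

lemma sigP_sub_dvd (h : H) (w : R.S h) (p) : lf (R.α h) ∣ R.sigP w p - p := by
  have := dvd_sub_of_X (lf (R.α h)) (R.sigP w) (AlgHom.id ℂ _) (fun i => by
    have hh := R.act_S h w⁻¹
    rw [sigP, show R.act (w : W)⁻¹ = R.act ((w⁻¹ : R.S h) : W) from rfl, subP_X, hh]
    rw [show (1 + (R.ω h w⁻¹ - 1) • vecMulVec (R.a h) (R.α h)) i =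
      Pi.single i 1 + ((R.ω h w⁻¹ - 1) * R.a h i) • R.α h from ?_, lf_add, lf_single, lf_smul]
    · simp
    · funext j
      simp [Matrix.add_apply, Matrix.smul_apply, vecMulVec_apply, Matrix.one_apply,
        Pi.single_apply, eq_comm, mul_assoc]) p
  exact this

lemma sigP_not_dvd (h : H) (w : R.S h) (p) (hp : ¬ lf (R.α h) ∣ p) : ¬ lf (R.α h) ∣ R.sigP w p := by
  intro h1
  apply hp
  have := dvd_sub h1 (R.sigP_sub_dvd h w p)
  simpa using this

lemma sigK_sub_mem (h : H) (w : R.S h) {x : K} (hx : x ∈ R.O K h) :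
    ∃ z ∈ R.O K h, R.sigK K w x - x = R.ell K h * z := by
  obtain ⟨s, q, hq, hxq⟩ := hx
  obtain ⟨s', hs'⟩ := R.sigP_sub_dvd h w s
  obtain ⟨q', hq'⟩ := R.sigP_sub_dvd h w q
  have hσ := congrArg (R.sigK K w) hxq
  simp only [map_mul, sigK_alg] at hσ
  have e1 : R.sigP w s = s + lf (R.α h) * s' := by rw [← hs']; ring
  have e2 : R.sigP w q = q + lf (R.α h) * q' := by rw [← hq']; ring
  have hx' : x ∈ R.O K h := ⟨s, q, hq, hxq⟩
  refine mem_of_mul_mem (q := R.sigP w q) (y := algebraMap _ K s' - algebraMap _ K q' * x)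
    (R.sigP_not_dvd h w q hq) ?_ ?_
  · exact (R.O K h).sub_mem (R.P_mem h _) ((R.O K h).mul_mem (R.P_mem h _) hx')
  · rw [mul_sub, mul_comm, hσ, e1, e2]
    simp only [map_add, map_mul]
    rw [← hxq]; ring

lemma sig_sub_mem (h : H) (w : R.S h) {F : Matrix κ κ K} (hF : F ∈ R.MO K h) :
    ∃ Z ∈ R.MO K h, (R.sigK K w).mapMatrix F - F = R.ell K h • Z := by
  choose Z hZ hZ' using fun i j => R.sigK_sub_mem h w (hF i j)
  exact ⟨Matrix.of Z, hZ, by ext i j; simpa using hZ' i j⟩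

lemma sig_mem (h : H) (w : R.S h) {F : Matrix κ κ K} (hF : F ∈ R.MO K h) :
    (R.sigK K w).mapMatrix F ∈ R.MO K h := by
  obtain ⟨Z, hZ, h1⟩ := R.sig_sub_mem h w hF
  rw [sub_eq_iff_eq_add.mp h1]
  exact (R.MO K h).add_mem (R.smul_mem h (R.ell_mem h h) hZ) hF

lemma tau_mem (h : H) (w : R.S h) {F : Matrix κ κ K} (hF : F ∈ R.MO K h) :
    R.tau w F ∈ R.MO K h := (R.MO K h).mul_mem (R.cM_mem h _) (R.sig_mem h w hF)

variable (K) in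
/-- The order filtration at `h`. -/
def Fil (h : H) (n : ℕ) : Submodule ℂ (Matrix κ κ K) where
  carrier := {F | ∃ Y ∈ R.MO K h, F = R.ell K h ^ n • Y}
  zero_mem' := ⟨0, zero_mem _, by simp⟩
  add_mem' := by
    rintro _ _ ⟨Y, hY, rfl⟩ ⟨Z, hZ, rfl⟩
    exact ⟨Y + Z, add_mem hY hZ, by rw [smul_add]⟩
  smul_mem' := by
    rintro c _ ⟨Y, hY, rfl⟩
    refine ⟨algebraMap ℂ K c • Y, R.smul_mem h (R.C_mem h c) hY, ?_⟩
    rw [algebraMap_smul, smul_comm]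

lemma mem_Fil {h : H} {n : ℕ} {F : Matrix κ κ K} :
    F ∈ R.Fil K h n ↔ ∃ Y ∈ R.MO K h, F = R.ell K h ^ n • Y := Iff.rfl

lemma Fil_anti (h : H) {m n : ℕ} (hmn : m ≤ n) {F : Matrix κ κ K} (hF : F ∈ R.Fil K h n) :
    F ∈ R.Fil K h m := by
  obtain ⟨Y, hY, rfl⟩ := hF
  refine ⟨R.ell K h ^ (n - m) • Y, R.smul_mem h (pow_mem (R.ell_mem h h) _) hY, ?_⟩
  rw [smul_smul, ← pow_add, Nat.add_sub_cancel' hmn]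

lemma tau_Fil (h : H) (w : R.S h) {n : ℕ} {F : Matrix κ κ K} (hF : F ∈ R.Fil K h n) :
    R.tau w F ∈ R.Fil K h n := by
  obtain ⟨Y, hY, rfl⟩ := hF
  refine ⟨algebraMap ℂ K ((R.ω h w)⁻¹ ^ n) • R.tau w Y,
    R.smul_mem h (R.C_mem h _) (R.tau_mem h w hY), ?_⟩
  rw [tau_smul, map_pow, sigK_ell_S, smul_smul, mul_pow, map_pow, mul_comm]

variable (K) in
/-- The logarithmic covariant derivative transverse to `h`. -/
def Th (h : H) : Module.End ℂ (Matrix κ κ K) where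
  toFun F := R.ell K h • R.nab (R.a h) F
  map_add' F G := by rw [nab_addF, smul_add]
  map_smul' c F := by
    rw [← algebraMap_smul K c F, nab_smulF]
    simp only [Derivation.map_algebraMap, zero_smul, zero_add, RingHom.id_apply]
    rw [algebraMap_smul, smul_comm]

lemma Th_apply (h : H) (F : Matrix κ κ K) : R.Th K h F = R.ell K h • R.nab (R.a h) F := rfl

lemma dK_ell (h : H) : extDer K (dP (R.a h)) (R.ell K h) = 1 := by
  rw [extDer_ell, dP_lf, R.α_a]; simp

lemma dK_ell_pow (h : H) (n : ℕ) :
    R.ell K h * extDer K (dP (R.a h)) (R.ell K h ^ n) = n * R.ell K h ^ n := by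
  rw [Derivation.leibniz_pow, dK_ell]
  cases n with
  | zero => simp
  | succ n => simp; ring

lemma Th_pow_smul (h : H) (n : ℕ) (Y : Matrix κ κ K) :
    R.Th K h (R.ell K h ^ n • Y) = (n : K) • R.ell K h ^ n • Y + R.ell K h ^ n • R.Th K h Y := by
  rw [Th_apply, nab_smulF, smul_add, smul_smul, dK_ell_pow, Th_apply, smul_smul, smul_smul,
    smul_smul, mul_comm (R.ell K h)]

lemma Th_local (h : H) {Y : Matrix κ κ K} (hY : Y ∈ R.MO K h) :
    ∃ Z ∈ R.MO K h, R.Th K h Y = - (cM K (R.A h) * Y) + R.ell K h • Z := by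
  obtain ⟨B, hB, hM⟩ := R.M_split (K := K) h (R.a h)
  refine ⟨dm (extDer K (dP (R.a h))) Y - B * Y,
    (R.MO K h).sub_mem (R.dm_mem h _ hY) ((R.MO K h).mul_mem hB hY), ?_⟩
  rw [Th_apply, nab, hM, u_a, add_mul, smul_mul_assoc, smul_sub, smul_add, smul_smul,
    mul_inv_cancel₀ (R.ell_ne K h), one_smul, smul_sub]
  abel

lemma Th_Fil (h : H) {n : ℕ} {F : Matrix κ κ K} (hF : F ∈ R.Fil K h n) :
    R.Th K h F ∈ R.Fil K h n := by
  obtain ⟨Y, hY, rfl⟩ := hF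
  obtain ⟨Z, hZ, h1⟩ := R.Th_local h hY
  refine ⟨(n : K) • Y + R.Th K h Y, ?_, ?_⟩
  · refine add_mem (R.smul_mem h (natCast_mem _ n) hY) ?_
    rw [h1]
    exact add_mem (neg_mem ((R.MO K h).mul_mem (R.cM_mem h _) hY))
      (R.smul_mem h (R.ell_mem h h) hZ)
  · rw [Th_pow_smul, smul_add, smul_comm]

/-- `F` transforms under the stabilizer of `h` by the `j`-th power of the basic character. -/
def Iso (h : H) (j : ℕ) (F : Matrix κ κ K) : Prop :=
  ∀ w : R.S h, R.tau w F = algebraMap ℂ K (R.ω h w ^ j) • F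

lemma tau_Th (h : H) (w : R.S h) (F : Matrix κ κ K) : R.tau w (R.Th K h F) = R.Th K h (R.tau w F) := by
  rw [Th_apply, tau_smul, tau_nab, act_a, nab_smul, sigK_ell_S, smul_smul, mul_right_comm,
    ← map_mul, inv_mul_cancel₀ (R.ω_ne h w), map_one, one_mul]; rfl

lemma Iso_Th (h : H) (j : ℕ) {F : Matrix κ κ K} (hF : R.Iso h j F) : R.Iso h j (R.Th K h F) := by
  intro w
  rw [tau_Th, hF w, algebraMap_smul, map_smul, algebraMap_smul]

/-- The exponent of the connection on the isotypic part. -/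
def ev (h : H) (j n : ℕ) : ℂ := n - (Fintype.card (R.S h) : ℂ) + ∑ w : R.S h, R.ω h w ^ (j + n)

lemma Iso_step (h : H) (j n : ℕ) {F : Matrix κ κ K} (hF : R.Iso h j F) (hn : F ∈ R.Fil K h n) :
    R.Th K h F - R.ev h j n • F ∈ R.Fil K h (n + 1) := by
  obtain ⟨Y, hY, rfl⟩ := hn
  have hl := R.ell_ne K h
  have h1 : ∀ w : R.S h, ∃ Z ∈ R.MO K h,
      cM K (R.lam w) * Y = algebraMap ℂ K (R.ω h w ^ (j + n)) • Y + R.ell K h • Z := by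
    intro w
    obtain ⟨Z, hZ, hZ'⟩ := R.sig_sub_mem h w hY
    have h2 := hF w
    rw [tau_smul, map_pow, sigK_ell_S] at h2
    have h3 : R.tau w Y = algebraMap ℂ K (R.ω h w ^ (j + n)) • Y := by
      have hc : (algebraMap ℂ K (R.ω h w)⁻¹ * R.ell K h) ^ n ≠ 0 :=
        pow_ne_zero _ (mul_ne_zero (by simpa using R.ω_ne h w) hl)
      apply smul_right_injective _ hc
      simp only
      rw [h2, smul_smul, smul_smul, mul_pow, mul_right_comm, ← map_pow (algebraMap ℂ K), ← map_mul,
        inv_pow, pow_add]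
      have := R.ω_ne h w
      congr 3
      field_simp
    refine ⟨- (cM K (R.lam w) * Z), neg_mem ((R.MO K h).mul_mem (R.cM_mem h _) hZ), ?_⟩
    rw [← h3, tau, sub_eq_iff_eq_add.mp hZ', mul_add, mul_smul_comm, smul_neg]
    abel
  choose Z hZ hZ' using h1
  obtain ⟨Z', hZ1, hZ2⟩ := R.Th_local h hY
  refine ⟨Z' + ∑ w, Z w, add_mem hZ1 (sum_mem fun w _ => hZ w), ?_⟩
  rw [Th_pow_smul, hZ2]
  have h4 : cM K (R.A h) * Y = algebraMap ℂ K ((Fintype.card (R.S h) : ℂ) -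
      ∑ w : R.S h, R.ω h w ^ (j + n)) • Y - R.ell K h • ∑ w, Z w := by
    simp only [A, map_sum, map_sub, map_one, Finset.sum_mul, sub_mul, one_mul, hZ',
      Finset.sum_sub_distrib, Finset.sum_add_distrib, sub_smul, Finset.sum_smul, Finset.smul_sum]
    simp
    rw [sub_sub]
    congr 1
    rw [Nat.cast_smul_eq_nsmul, nsmul_eq_mul]
  rw [h4, ev, ← algebraMap_smul K]
  rw [pow_succ]
  generalize ∑ w, Z w = Zs
  generalize ∑ w : R.S h, R.ω h w ^ (j + n) = s
  ext a b
  simp only [map_add, map_sub, map_natCast, Matrix.add_apply, Matrix.sub_apply, Matrix.smul_apply,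
    Matrix.neg_apply, smul_eq_mul]
  simp only [Algebra.smul_def, map_add, map_sub, map_natCast]
  ring

lemma ω_pow_card (h : H) (w : R.S h) : R.ω h w ^ Fintype.card (R.S h) = 1 := by
  rw [← map_pow, pow_card_eq_one, map_one]

lemma ev_cases (h : H) (j n : ℕ) :
    ((∀ w : R.S h, R.ω h w ^ (j + n) = 1) ∧ R.ev h j n = n) ∨
    ((¬ ∀ w : R.S h, R.ω h w ^ (j + n) = 1) ∧ R.ev h j n = n - (Fintype.card (R.S h) : ℂ)) := by
  by_cases hw : ∀ w : R.S h, R.ω h w ^ (j + n) = 1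
  · left; refine ⟨hw, ?_⟩
    simp [ev, hw]
  · right; refine ⟨hw, ?_⟩
    have := sum_hom_units_eq_zero ((R.ω h) ^ (j + n)) (fun h0 => hw fun w => by
      have := DFunLike.congr_fun h0 w; simpa using this)
    simp only [MonoidHom.pow_apply] at this
    rw [ev, this, add_zero]

/-- The integer exponent. -/
def evN (h : H) (j n : ℕ) : ℕ :=
  if ∀ w : R.S h, R.ω h w ^ (j + n) = 1 then n else n - Fintype.card (R.S h)

lemma ev_eq (h : H) (j n : ℕ) (hn : Fintype.card (R.S h) ≤ n) : R.ev h j n = R.evN h j n := by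
  rcases R.ev_cases h j n with ⟨h1, h2⟩ | ⟨h1, h2⟩
  · rw [h2, evN, if_pos h1]
  · rw [h2, evN, if_neg h1, Nat.cast_sub hn]

lemma evN_le (h : H) (j n : ℕ) : R.evN h j n ≤ n := by
  rw [evN]; split_ifs <;> omega

lemma evN_inj (h : H) (j m n : ℕ) (hm : Fintype.card (R.S h) ≤ m) (hn : Fintype.card (R.S h) ≤ n)
    (hmn : R.evN h j m = R.evN h j n) : m = n := by
  have key : ∀ n, (∀ w : R.S h, R.ω h w ^ (j + (n + Fintype.card (R.S h))) = 1) ↔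
      ∀ w : R.S h, R.ω h w ^ (j + n) = 1 := by
    intro n
    refine forall_congr' fun w => ?_
    rw [← add_assoc, pow_add, ω_pow_card, mul_one]
  unfold evN at hmn
  split_ifs at hmn with h1 h2 h2
  · exact hmn
  · exfalso; apply h2
    rw [show n = m + Fintype.card (R.S h) by omega, key]; exact h1
  · exfalso; apply h1
    rw [show m = n + Fintype.card (R.S h) by omega, key]; exact h2
  · omega

open Polynomial in
lemma Iso_prod (h : H) (j : ℕ) {F : Matrix κ κ K} (hF : R.Iso h j F)
    (he : F ∈ R.Fil K h (Fintype.card (R.S h))) (k : ℕ) :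
    (aeval (R.Th K h) (∏ i ∈ Finset.range k, (Polynomial.X - Polynomial.C (i : ℂ)))) F ∈ R.Fil K h k := by
  set e := Fintype.card (R.S h) with hedef
  have hpol : ∀ (n : ℕ) (p : ℂ[X]) (G : Matrix κ κ K), G ∈ R.Fil K h n → (aeval (R.Th K h) p) G ∈ R.Fil K h n := by
    intro n p G hG
    induction p using Polynomial.induction_on' with
    | add p q hp hq => rw [map_add, LinearMap.add_apply]; exact add_mem hp hq
    | monomial m c =>
      rw [Polynomial.aeval_monomial, Module.End.mul_apply, Module.algebraMap_end_apply]
      apply Submodule.smul_mem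
      induction m with
      | zero => simpa using hG
      | succ m ih => rw [pow_succ', Module.End.mul_apply]; exact R.Th_Fil h ih
  rcases le_total k e with hk | hk
  · exact R.Fil_anti h hk (hpol e _ F he)
  · have hstep : ∀ m, R.Iso h j ((aeval (R.Th K h) (∏ i ∈ Finset.Ico e (e + m),
        (Polynomial.X - Polynomial.C (R.ev h j i)))) F) ∧ ((aeval (R.Th K h) (∏ i ∈ Finset.Ico e (e + m),
        (Polynomial.X - Polynomial.C (R.ev h j i)))) F) ∈ R.Fil K h (e + m) := by
      intro m
      induction m with
      | zero => simpa using ⟨hF, he⟩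
      | succ m ih =>
        rw [← add_assoc, Finset.prod_Ico_succ_top (by omega), mul_comm, map_mul,
          Module.End.mul_apply]
        set G := (aeval (R.Th K h) (∏ i ∈ Finset.Ico e (e + m),
          (Polynomial.X - Polynomial.C (R.ev h j i)))) F with hG
        have : (aeval (R.Th K h) (Polynomial.X - Polynomial.C (R.ev h j (e + m)))) G =
            R.Th K h G - R.ev h j (e + m) • G := by
          simp
        rw [this]
        refine ⟨?_, R.Iso_step h j _ ih.1 ih.2⟩
        intro w
        have h1 := R.Iso_Th h j ih.1 w
        have h2 := ih.1 w
        rw [sub_eq_add_neg, ← neg_smul, ← algebraMap_smul K, tau_add, tau_smul, sigK_C, h1, h2,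
          smul_add, smul_comm]
    have himg : (Finset.Ico e k).image (R.evN h j) ⊆ Finset.range k := by
      intro x hx
      obtain ⟨y, hy, rfl⟩ := Finset.mem_image.mp hx
      rw [Finset.mem_Ico] at hy
      rw [Finset.mem_range]
      exact (R.evN_le h j y).trans_lt hy.2
    rw [← Finset.prod_sdiff himg, map_mul, Module.End.mul_apply]
    apply hpol
    rw [Finset.prod_image (fun x hx y hy hxy => R.evN_inj h j x y (Finset.mem_Ico.mp hx).1
      (Finset.mem_Ico.mp hy).1 hxy)]
    have := (hstep (k - e)).2
    rw [Nat.add_sub_cancel' hk] at this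
    rw [Finset.prod_congr rfl (fun i hi => by rw [← R.ev_eq h j i (Finset.mem_Ico.mp hi).1])]
    exact this

open Polynomial in
lemma nab_iter (h : H) (F : Matrix κ κ K) (k : ℕ) :
    (aeval (R.Th K h) (∏ i ∈ Finset.range k, (Polynomial.X - Polynomial.C (i : ℂ)))) F =
      R.ell K h ^ k • (R.nab (R.a h))^[k] F := by
  induction k with
  | zero => simp
  | succ k ih =>
    rw [Finset.prod_range_succ, mul_comm, map_mul, Module.End.mul_apply, ih]
    simp only [map_sub, Polynomial.aeval_X, Polynomial.aeval_C, LinearMap.sub_apply, Module.algebraMap_end_apply]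
    rw [Th_pow_smul, Th_apply, ← algebraMap_smul K (k : ℂ), map_natCast, add_sub_cancel_left,
      smul_smul, ← pow_succ, Function.iterate_succ_apply']

lemma mem_of_pow_smul_mem (h : H) {k : ℕ} {G : Matrix κ κ K}
    (hG : R.ell K h ^ k • G ∈ R.Fil K h k) : G ∈ R.MO K h := by
  obtain ⟨Y, hY, h1⟩ := hG
  have := smul_right_injective (Matrix κ κ K) (pow_ne_zero k (R.ell_ne K h)) h1
  rwa [this]

lemma nab_iterate_add (y : ι → ℂ) (k : ℕ) (F G : Matrix κ κ K) :
    (R.nab y)^[k] (F + G) = (R.nab y)^[k] F + (R.nab y)^[k] G := by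
  induction k with
  | zero => rfl
  | succ k ih => simp only [Function.iterate_succ_apply', ih, nab_addF]

lemma nab_iterate_zero (y : ι → ℂ) (k : ℕ) : (R.nab y)^[k] (0 : Matrix κ κ K) = 0 := by
  induction k with
  | zero => rfl
  | succ k ih => simp only [Function.iterate_succ_apply', ih, nab_zeroF]

lemma nab_iterate_sum (y : ι → ℂ) (k : ℕ) {J : Type*} (s : Finset J) (F : J → Matrix κ κ K) :
    (R.nab y)^[k] (∑ j ∈ s, F j) = ∑ j ∈ s, (R.nab y)^[k] (F j) := by
  induction s using Finset.induction_on with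
  | empty => simp [nab_iterate_zero]
  | insert a s ha ih => rw [Finset.sum_insert ha, Finset.sum_insert ha, nab_iterate_add, ih]

/-- Isotypic projection. -/
def pj (h : H) (j : ℕ) (F : Matrix κ κ K) : Matrix κ κ K :=
  ∑ w : R.S h, algebraMap ℂ K (R.ω h w⁻¹ ^ j) • R.tau w F

lemma Iso_pj (h : H) (j : ℕ) (F : Matrix κ κ K) : R.Iso h j (R.pj h j F) := by
  intro w
  rw [pj, tau_sum, Finset.smul_sum]
  refine Fintype.sum_equiv (Equiv.mulLeft w) _ _ (fun x => ?_)
  rw [tau_smul, sigK_C, ← tau_mul, smul_smul, ← map_mul, ← mul_pow]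
  have := R.ω_ne h w
  congr 3
  simp only [Equiv.coe_mulLeft, _root_.mul_inv_rev, map_mul, ω_inv]
  field_simp

lemma pj_Fil (h : H) (j n : ℕ) {F : Matrix κ κ K} (hF : F ∈ R.Fil K h n) :
    R.pj h j F ∈ R.Fil K h n :=
  sum_mem fun w _ => by
    rw [algebraMap_smul]; exact Submodule.smul_mem _ _ (R.tau_Fil h w hF)

lemma tau_one (F : Matrix κ κ K) : R.tau 1 F = F := by
  have h1 : R.tau 1 (R.tau 1 F) = R.tau 1 F := by rw [← tau_mul, one_mul]
  have hs : ∀ x : K, R.sigK K 1 x = x := by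
    intro x
    have : R.sigK K 1 (R.sigK K 1 x) = R.sigK K 1 x := by rw [← sigK_mul, one_mul]
    exact (R.sigK K 1).injective this
  rw [tau, map_one, map_one, one_mul]
  ext i j; simp [hs]

lemma sum_pj (h : H) (F : Matrix κ κ K) :
    ∑ j ∈ Finset.range (Fintype.card (R.S h)), R.pj h j F = (Fintype.card (R.S h) : K) • F := by
  simp only [pj]
  rw [Finset.sum_comm]
  simp only [← Finset.sum_smul]
  rw [Finset.sum_eq_single 1]
  · simp [tau_one]
  · intro w _ hw
    have h1 : R.ω h w⁻¹ ≠ 1 := R.ω_ne_one h _ (by simpa using hw)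
    rw [← map_sum, geom_sum_eq h1, ω_pow_card]; simp
  · simp

/-- The key local statement: all transverse covariant derivatives are regular. -/
lemma nab_iter_mem (h : H) {F : Matrix κ κ K} (hF : F ∈ R.Fil K h (Fintype.card (R.S h))) (k : ℕ) :
    (R.nab (R.a h))^[k] F ∈ R.MO K h := by
  have hc : (Fintype.card (R.S h) : ℂ) ≠ 0 := by simp [Fintype.card_ne_zero]
  set e := Fintype.card (R.S h) with he
  have hF' : F = ∑ j ∈ Finset.range e, R.pj h j ((e : ℂ)⁻¹ • F) := by
    rw [he, sum_pj, ← he, ← algebraMap_smul K (e : ℂ)⁻¹ F, smul_smul, ← map_natCast (algebraMap ℂ K), ← map_mul,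
      mul_inv_cancel₀ hc, map_one, one_smul]
  rw [hF', nab_iterate_sum]
  refine sum_mem fun j _ => ?_
  apply R.mem_of_pow_smul_mem h (k := k)
  rw [← nab_iter]
  apply R.Iso_prod h j (R.Iso_pj h j _)
  exact R.pj_Fil h j _ (Submodule.smul_mem _ _ hF)

end K2
end Arr
end KZ

namespace KZ
open MvPolynomial Matrix
namespace Arr
variable {W ι κ H : Type*} [Group W] [Fintype W] [Fintype ι] [DecidableEq ι]
    [Fintype κ] [DecidableEq κ] [Fintype H] [DecidableEq H] [MulAction W H] (R : Arr W ι κ H)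

section K2
variable {K : Type*} [Field K] [Algebra (MvPolynomial ι ℂ) K] [IsFractionRing (MvPolynomial ι ℂ) K]
  [Algebra ℂ K] [IsScalarTower ℂ (MvPolynomial ι ℂ) K]

lemma nab_zero_dir (F : Matrix κ κ K) : R.nab 0 F = 0 := by
  have := R.nab_smul 0 0 F
  simpa using this

lemma nab_sum_dir {J : Type*} (s : Finset J) (f : J → ι → ℂ) (F : Matrix κ κ K) :
    R.nab (∑ j ∈ s, f j) F = ∑ j ∈ s, R.nab (f j) F := by
  classical
  induction s using Finset.induction_on with
  | empty => simp [nab_zero_dir]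
  | insert a s ha ih => rw [Finset.sum_insert ha, Finset.sum_insert ha, nab_add, ih]

lemma nab_basis (y : ι → ℂ) (F : Matrix κ κ K) :
    R.nab y F = ∑ i, algebraMap ℂ K (y i) • R.nab (Pi.single i 1) F := by
  conv_lhs => rw [show y = ∑ i, y i • Pi.single i (1 : ℂ) from by
    funext j; simp [Finset.sum_apply, Pi.single_apply]]
  rw [nab_sum_dir]
  exact Finset.sum_congr rfl fun i _ => R.nab_smul _ _ _

/-- Functions all of whose covariant derivatives are polynomial. -/
def Good (F : Matrix κ κ K) : Prop :=
  (∀ h k, (R.nab (R.a h))^[k] F ∈ R.MO K h) ∧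
  ∀ (p : MvPolynomial ι ℂ) (hp : Prime p), (∀ h, ¬ p ∣ lf (R.α h)) → F ∈ (locRing K p hp).matrix

lemma M_mem_loc {p : MvPolynomial ι ℂ} (hp : Prime p) (hh : ∀ h, ¬ p ∣ lf (R.α h)) (y : ι → ℂ) :
    R.M K y ∈ (locRing K p hp).matrix :=
  sum_mem fun h _ => smul_mem_mat (by
    rw [u, div_eq_mul_inv]
    exact mul_mem (C_mem_loc _) (inv_mem_locRing (hh h))) (cM_mem_loc _)

lemma Good_nab {F : Matrix κ κ K} (hF : R.Good F) (y : ι → ℂ) : R.Good (R.nab y F) := by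
  refine ⟨fun h k => ?_, fun p hp hh => ?_⟩
  · have hc : (R.nab (R.a h))^[k] (R.nab y F) = R.nab y ((R.nab (R.a h))^[k] F) := by
      have : Function.Commute (R.nab (K := K) (R.a h)) (R.nab y) := fun G => R.nab_comm _ _ G
      exact (this.iterate_left k) F
    rw [hc]
    set G := (R.nab (R.a h))^[k] F with hG
    have hy : y = (R.α h ⬝ᵥ y) • R.a h + (y - (R.α h ⬝ᵥ y) • R.a h) := by abel
    rw [hy, nab_add, nab_smul]
    refine add_mem (R.smul_mem h (R.C_mem h _) ?_) (R.nab_tangent_mem h _ ?_ (hF.1 h k))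
    · have := hF.1 h (k + 1)
      rwa [Function.iterate_succ_apply'] at this
    · rw [dotProduct_sub, dotProduct_smul, R.α_a]; simp
  · exact sub_mem (dm_mem_loc _ (hF.2 p hp hh)) (mul_mem (R.M_mem_loc hp hh y) (hF.2 p hp hh))

variable (K) in
/-- Polynomial matrices inside matrices of rational functions. -/
def pm : Matrix κ κ (MvPolynomial ι ℂ) →+* Matrix κ κ K :=
  (algebraMap (MvPolynomial ι ℂ) K).mapMatrix

lemma pm_apply (G : Matrix κ κ (MvPolynomial ι ℂ)) (i j) : pm K G i j = algebraMap _ K (G i j) := rfl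

lemma pm_injective : Function.Injective (pm K : Matrix κ κ (MvPolynomial ι ℂ) →+* Matrix κ κ K) := by
  intro S T h
  ext1 i j
  exact IsFractionRing.injective (MvPolynomial ι ℂ) K (congrFun (congrFun h i) j)

/-- A matrix regular at every prime is polynomial. -/
lemma poly_of_loc {F : Matrix κ κ K} (h1 : ∀ h, F ∈ R.MO K h)
    (h2 : ∀ (p : MvPolynomial ι ℂ) (hp : Prime p), (∀ h, ¬ p ∣ lf (R.α h)) →
      F ∈ (locRing K p hp).matrix) : ∃ G : Matrix κ κ (MvPolynomial ι ℂ), F = pm K G := by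
  have : ∀ i j, ∃ a : MvPolynomial ι ℂ, F i j = algebraMap _ K a := by
    intro i j
    apply mem_range_of_forall
    intro p hp
    by_cases hh : ∀ h, ¬ p ∣ lf (R.α h)
    · exact h2 p hp hh i j
    · push Not at hh
      obtain ⟨h, hh⟩ := hh
      have has : Associated p (lf (R.α h)) := hp.associated_of_dvd (prime_lf (R.α_a h)) hh
      obtain ⟨s, q, hq, hs⟩ := h1 h i j
      exact ⟨s, q, fun hd => hq (has.dvd_iff_dvd_left.mp hd), hs⟩
  choose G hG using this
  exact ⟨Matrix.of G, by ext i j; rw [hG]; rfl⟩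

lemma Good_poly {F : Matrix κ κ K} (hF : R.Good F) : ∃ G : Matrix κ κ (MvPolynomial ι ℂ), F = pm K G :=
  R.poly_of_loc (fun h => hF.1 h 0) hF.2

/-- Homogeneity of degree `n`. -/
def Deg (n : ℤ) (F : Matrix κ κ K) : Prop := dm (extDer K (eP ι)) F = (n : K) • F

lemma eK_M (y : ι → ℂ) : dm (extDer K (eP ι)) (R.M K y) = - R.M K y := by
  simp only [M, dm_sum, dm_smul, eK_u, dm_cM, smul_zero, add_zero, neg_smul, Finset.sum_neg_distrib]

lemma Deg_nab {n : ℤ} {F : Matrix κ κ K} (hF : Deg (ι := ι) n F) (y : ι → ℂ) :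
    Deg (ι := ι) (n - 1) (R.nab y F) := by
  have h1 : dm (extDer K (eP ι)) (dm (extDer K (dP y)) F) =
      dm (extDer K (dP y)) (dm (extDer K (eP ι)) F) - dm (extDer K (dP y)) F := by
    ext i j; simp only [dm_apply, Matrix.sub_apply, eK_dK]
  rw [Deg] at hF ⊢
  rw [nab, dm_sub, h1, hF, dm_mul, hF, eK_M, dm_smul]
  have : extDer K (dP y) (n : K) = 0 := Derivation.map_intCast _ n
  rw [this]
  push_cast
  simp only [zero_smul, zero_add, neg_mul, mul_smul_comm, sub_smul, one_smul, smul_sub]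
  abel

lemma Good_neg {n : ℤ} {F : Matrix κ κ K} (hF : R.Good F) (hd : Deg (ι := ι) n F) (hn : n < 0) :
    F = 0 := by
  obtain ⟨G, rfl⟩ := R.Good_poly hF
  ext i j
  have h1 := congrFun (congrFun hd i) j
  rw [dm_apply, Matrix.smul_apply, pm_apply, extDer_algebraMap, smul_eq_mul] at h1
  have h2 : eP ι (G i j) = C (n : ℂ) * G i j := by
    apply IsFractionRing.injective (MvPolynomial ι ℂ) K
    rw [h1, map_mul, algC]; simp
  rw [pm_apply, eP_eq_zero_of_neg hn h2]; simp

/-- Iterated Taylor operator at the base point. -/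
def T : ℕ → Matrix κ κ K → Matrix κ κ K
  | 0, F => F
  | k + 1, F => ∑ i, algebraMap (MvPolynomial ι ℂ) K (C (R.v i) - X i) •
      T k (R.nab (Pi.single i 1) F)

lemma nab_T (j : ι) (k : ℕ) (F : Matrix κ κ K) :
    R.nab (Pi.single j 1) (R.T (k + 1) F) = R.T (k + 1) (R.nab (Pi.single j 1) F) -
      ((k + 1 : ℕ) : K) • R.T k (R.nab (Pi.single j 1) F) := by
  have hd : ∀ i, extDer K (dP (Pi.single j (1:ℂ))) (algebraMap (MvPolynomial ι ℂ) K (C (R.v i) - X i))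
      = if i = j then -1 else 0 := by
    intro i
    rw [extDer_algebraMap, map_sub, dP_C, dP_X, Pi.single_apply]
    split_ifs <;> simp
  induction k generalizing F with
  | zero =>
    simp only [T, nab_sumF, nab_smulF, hd, Finset.sum_add_distrib, ite_smul, zero_smul, neg_smul,
      one_smul, Finset.sum_ite_eq', Finset.mem_univ, if_true]
    simp only [R.nab_comm (Pi.single j 1)]
    simp
    abel
  | succ k ih =>
    rw [T, nab_sumF]
    simp only [nab_smulF, hd, Finset.sum_add_distrib, ite_smul, zero_smul, neg_smul,
      one_smul, Finset.sum_ite_eq', Finset.mem_univ, if_true, ih]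
    simp only [R.nab_comm (Pi.single j 1), smul_sub, Finset.sum_sub_distrib]
    rw [show R.T (k + 1 + 1) (R.nab (Pi.single j 1) F) =
      ∑ i, algebraMap (MvPolynomial ι ℂ) K (C (R.v i) - X i) •
      R.T (k + 1) (R.nab (Pi.single i 1) (R.nab (Pi.single j 1) F)) from rfl]
    have h2 : ∑ i, algebraMap (MvPolynomial ι ℂ) K (C (R.v i) - X i) • ((k + 1 : ℕ) : K) •
        R.T k (R.nab (Pi.single i 1) (R.nab (Pi.single j 1) F)) =
        ((k + 1 : ℕ) : K) • R.T (k + 1) (R.nab (Pi.single j 1) F) := by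
      rw [T, Finset.smul_sum]
      exact Finset.sum_congr rfl fun i _ => smul_comm _ _ _
    rw [h2]
    rw [show ((k + 1 + 1 : ℕ) : K) = 1 + ((k + 1 : ℕ) : K) by push_cast; ring, add_smul, one_smul]
    abel

lemma T_zero_of_lt (k : ℕ) {n : ℤ} {F : Matrix κ κ K} (hF : R.Good F) (hd : Deg (ι := ι) n F)
    (hn : n < k) : R.T k F = 0 := by
  induction k generalizing n F with
  | zero => exact R.Good_neg hF hd (by simpa using hn)
  | succ k ih =>
    rw [T]
    refine Finset.sum_eq_zero fun i _ => ?_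
    rw [ih (R.Good_nab hF _) (R.Deg_nab hd _) (by push_cast at hn; omega), smul_zero]

lemma T_poly (k : ℕ) {F : Matrix κ κ K} (hF : R.Good F) :
    ∃ G : Matrix κ κ (MvPolynomial ι ℂ), R.T k F = pm K G ∧
      (0 < k → (eval R.v).mapMatrix G = 0) := by
  induction k generalizing F with
  | zero => obtain ⟨G, hG⟩ := R.Good_poly hF; exact ⟨G, hG, by simp⟩
  | succ k ih =>
    choose G hG _ using fun i => ih (R.Good_nab hF (Pi.single i 1))
    refine ⟨∑ i, (C (R.v i) - X i) • G i, ?_, fun _ => ?_⟩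
    · rw [T, map_sum]
      refine Finset.sum_congr rfl fun i _ => ?_
      rw [hG]; ext a b; simp [pm_apply]
    · ext a b
      simp [Matrix.sum_apply, map_sum]

variable (K) in
/-- The discriminant type product. -/
def Q : K := ∏ h, R.ell K h

lemma eK_prod (s : Finset H) : extDer K (eP ι) (∏ h ∈ s, R.ell K h) =
    (s.card : K) * ∏ h ∈ s, R.ell K h := by
  induction s using Finset.induction_on with
  | empty => simp
  | insert a s ha ih =>
    rw [Finset.prod_insert ha, Derivation.leibniz, ih, extDer_ell, eP_lf, Finset.card_insert_of_notMem ha]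
    simp only [smul_eq_mul]
    rw [show algebraMap (MvPolynomial ι ℂ) K (lf (R.α a)) = R.ell K a from rfl]
    push_cast; ring

lemma Q_Deg (m : ℕ) : Deg (ι := ι) (m * Fintype.card H : ℕ) (R.Q K ^ m • (1 : Matrix κ κ K)) := by
  rw [Deg, dm_smul, dm_one, smul_zero, add_zero, Derivation.leibniz_pow, Q, eK_prod]
  simp only [Finset.card_univ, smul_eq_mul, nsmul_eq_mul, smul_smul]
  congr 1
  cases m with
  | zero => simp
  | succ m => simp; ring

open scoped Classical in
lemma Q_Good (m : ℕ) (hm : ∀ h, Fintype.card (R.S h) ≤ m) :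
    R.Good (R.Q K ^ m • (1 : Matrix κ κ K)) := by
  have hQ : ∃ q, R.Q K ^ m = algebraMap (MvPolynomial ι ℂ) K q :=
    ⟨(∏ h, lf (R.α h)) ^ m, by simp [Q, ell]⟩
  refine ⟨fun h k => R.nab_iter_mem h ?_ k, fun p hp _ => ?_⟩
  · apply R.Fil_anti h (hm h)
    refine ⟨(∏ k ∈ Finset.univ.erase h, R.ell K k) ^ m • 1,
      R.smul_mem h (pow_mem (prod_mem fun k _ => R.ell_mem h k) _) (one_mem _), ?_⟩
    rw [smul_smul, ← mul_pow, Q, Finset.mul_prod_erase Finset.univ (fun k => R.ell K k) (Finset.mem_univ h)]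
  · obtain ⟨q, hq⟩ := hQ
    rw [hq]
    exact smul_mem_mat (algebraMap_mem_locRing _) (one_mem _)

lemma exists_B : ∃ B : Matrix κ κ (MvPolynomial ι ℂ),
    (∀ y, R.nab y (pm K B) = 0) ∧ (eval R.v).mapMatrix B = 1 := by
  classical
  set m := Fintype.card W with hm
  set F : Matrix κ κ K := R.Q K ^ m • 1 with hF
  have hg : R.Good F := R.Q_Good m fun h => Fintype.card_subtype_le _
  set n := m * Fintype.card H with hn
  have hd : Deg (ι := ι) (n : ℕ) F := R.Q_Deg m
  choose G hG hG0 using fun k => R.T_poly k hg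
  set Bh : Matrix κ κ (MvPolynomial ι ℂ) :=
    ∑ k ∈ Finset.range (n + 1), (C ((k.factorial : ℂ)⁻¹) : MvPolynomial ι ℂ) • G k with hB
  have hpB : pm K Bh = ∑ k ∈ Finset.range (n + 1), ((k.factorial : K)⁻¹) • R.T k F := by
    rw [hB, map_sum]
    refine Finset.sum_congr rfl fun k _ => ?_
    rw [hG]
    ext a b
    simp only [pm_apply, Matrix.smul_apply, smul_eq_mul, map_mul, algC]
    simp
  have : CharZero K := charZero_of_injective_algebraMap (algebraMap ℂ K).injective
  have hflat : ∀ j, R.nab (Pi.single j 1) (pm K Bh) = 0 := by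
    intro j
    have hdc : ∀ k : ℕ, extDer K (dP (Pi.single j (1 : ℂ))) ((k.factorial : K)⁻¹) = 0 := by
      intro k
      rw [← map_natCast (algebraMap ℂ K), ← map_inv₀]; exact Derivation.map_algebraMap _ _
    rw [hpB, nab_sumF]
    simp only [nab_smulF, hdc, zero_smul, zero_add]
    rw [Finset.sum_range_succ']
    simp only [nab_T, smul_sub, smul_smul, Finset.sum_sub_distrib]
    have h1 : ∀ k : ℕ, (((k + 1).factorial : K)⁻¹ * ((k + 1 : ℕ) : K)) = (k.factorial : K)⁻¹ := by
      intro k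
      rw [Nat.factorial_succ]
      have : ((k + 1 : ℕ) : K) ≠ 0 := Nat.cast_ne_zero.mpr (by omega)
      have := Nat.cast_ne_zero (R := K).mpr k.factorial_ne_zero
      push_cast at *
      field_simp
    simp only [h1]
    have h2 := R.T_zero_of_lt n (R.Good_nab hg (Pi.single j 1)) (R.Deg_nab hd (Pi.single j 1))
      (by push_cast; omega)
    have h3 := Finset.sum_range_succ' (fun k => (k.factorial : K)⁻¹ • R.T k (R.nab (Pi.single j 1) F)) n
    rw [Finset.sum_range_succ, h2, smul_zero, add_zero] at h3
    rw [h3]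
    simp only [T]
    abel
  have hev : (eval R.v).mapMatrix Bh = (∏ h, (R.α h ⬝ᵥ R.v)) ^ m • 1 := by
    rw [hB, map_sum, Finset.sum_range_succ', Finset.sum_eq_zero, zero_add]
    · have : G 0 = ((∏ h, lf (R.α h)) ^ m) • (1 : Matrix κ κ (MvPolynomial ι ℂ)) := by
        apply pm_injective (K := K)
        rw [← hG 0, T, hF]
        ext a b
        simp only [pm_apply, Matrix.smul_apply, smul_eq_mul, map_mul, map_pow, map_prod, Q, ell]
        by_cases h : a = b <;> simp [h, Matrix.one_apply]
      rw [this]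
      ext a b
      simp only [RingHom.mapMatrix_apply, Matrix.map_apply, Matrix.smul_apply, smul_eq_mul, map_mul,
        map_pow, map_prod, eval_lf]
      by_cases h : a = b <;> simp [h, Matrix.one_apply]
    · intro k _
      have := hG0 (k + 1) (by omega)
      ext a b
      have h1 := congrFun (congrFun this a) b
      simp only [RingHom.mapMatrix_apply, Matrix.map_apply, Matrix.zero_apply] at h1
      simp [h1]
  set c : ℂ := (∏ h, (R.α h ⬝ᵥ R.v)) ^ m with hc
  have hc0 : c ≠ 0 := pow_ne_zero _ (Finset.prod_ne_zero_iff.mpr fun h _ => R.v_reg h)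
  have hpm : pm K ((C c⁻¹ : MvPolynomial ι ℂ) • Bh) = algebraMap ℂ K c⁻¹ • pm K Bh := by
    ext a b; simp only [pm_apply, Matrix.smul_apply, smul_eq_mul, map_mul, algC]
  refine ⟨(C c⁻¹ : MvPolynomial ι ℂ) • Bh, fun y => ?_, ?_⟩
  · rw [nab_basis]
    refine Finset.sum_eq_zero fun j _ => ?_
    rw [hpm, nab_smulF, hflat, Derivation.map_algebraMap]; simp
  · ext a b
    have h1 := congrFun (congrFun hev a) b
    simp only [RingHom.mapMatrix_apply, Matrix.map_apply, Matrix.smul_apply, smul_eq_mul] at h1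
    simp only [RingHom.mapMatrix_apply, Matrix.map_apply, Matrix.smul_apply, smul_eq_mul, map_mul, h1,
      eval_C]
    rw [← mul_assoc, inv_mul_cancel₀ hc0, one_mul]

end K2
end Arr
end KZ

namespace KZ
open MvPolynomial Matrix
namespace Arr
variable {W ι κ H : Type*} [Group W] [Fintype W] [Fintype ι] [DecidableEq ι]
    [Fintype κ] [DecidableEq κ] [Fintype H] [DecidableEq H] [MulAction W H] (R : Arr W ι κ H)

section K2
variable {K : Type*} [Field K] [Algebra (MvPolynomial ι ℂ) K] [IsFractionRing (MvPolynomial ι ℂ) K]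
  [Algebra ℂ K] [IsScalarTower ℂ (MvPolynomial ι ℂ) K]

lemma exists_pow_mat {p : MvPolynomial ι ℂ} (hp : Prime p) (F : Matrix κ κ K) :
    ∃ r : ℕ, algebraMap (MvPolynomial ι ℂ) K p ^ r • F ∈ (locRing K p hp).matrix := by
  choose r hr using fun i j => exists_pow_mul_mem p hp (F i j)
  refine ⟨∑ i, ∑ j, r i j, fun i j => ?_⟩
  have hle : r i j ≤ ∑ i, ∑ j, r i j :=
    (Finset.single_le_sum (f := fun j => r i j) (fun _ _ => Nat.zero_le _) (Finset.mem_univ j)).trans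
      (Finset.single_le_sum (f := fun i => ∑ j, r i j) (fun _ _ => Nat.zero_le _) (Finset.mem_univ i))
  rw [Matrix.smul_apply, smul_eq_mul, ← Nat.sub_add_cancel hle, pow_add, mul_assoc]
  exact (locRing K p hp).mul_mem ((locRing K p hp).pow_mem (algebraMap_mem_locRing _) _) (hr i j)

lemma loc_of_comm {p : MvPolynomial ι ℂ} (hp : Prime p) (Ms : ι → Matrix κ κ K)
    (hMs : ∀ i, Ms i ∈ (locRing K p hp).matrix) (F : Matrix κ κ K)
    (hF : ∀ i, dm (extDer K (dP (Pi.single i 1))) F = Ms i * F - F * Ms i) :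
    F ∈ (locRing K p hp).matrix := by
  classical
  have hex := exists_pow_mat hp F
  set r := Nat.find hex with hr
  have hspec := Nat.find_spec hex
  rw [← hr] at hspec
  rcases Nat.eq_zero_or_pos r with h0 | h0
  · rw [h0] at hspec; simpa using hspec
  exfalso
  obtain ⟨s, hs⟩ : ∃ s, r = s + 1 := ⟨r - 1, by omega⟩
  set q := algebraMap (MvPolynomial ι ℂ) K p with hq
  have hq0 : q ≠ 0 := fun h => hp.ne_zero
    (IsFractionRing.injective (MvPolynomial ι ℂ) K (h.trans (map_zero _).symm))
  have hmin := Nat.find_min hex (m := s) (by omega)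
  apply hmin
  obtain ⟨i, hi⟩ := exists_not_dvd_dP hp
  set Z := q ^ r • F with hZ
  have h1 : (algebraMap (MvPolynomial ι ℂ) K (C (r : ℂ) * dP (Pi.single i 1) p)) • Z =
      q • (dm (extDer K (dP (Pi.single i 1))) Z - (Ms i * Z - Z * Ms i)) := by
    have hdq : extDer K (dP (Pi.single i 1)) q =
      algebraMap (MvPolynomial ι ℂ) K (dP (Pi.single i 1) p) := by rw [hq, extDer_algebraMap]
    rw [hZ, dm_smul, hF, Derivation.leibniz_pow, hdq, hs]
    rw [map_mul, algC]
    simp only [mul_smul_comm, smul_mul_assoc, ← smul_sub, add_sub_cancel_right, smul_smul]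
    congr 1
    simp
    ring
  have hZm : dm (extDer K (dP (Pi.single i 1))) Z - (Ms i * Z - Z * Ms i) ∈ (locRing K p hp).matrix :=
    sub_mem (dm_mem_loc _ hspec) (sub_mem (mul_mem (hMs i) hspec) (mul_mem hspec (hMs i)))
  intro a b
  obtain ⟨z, hz, hz'⟩ := mem_of_mul_mem (hp := hp) (K := K) (x := Z a b)
    (q := C (r : ℂ) * dP (Pi.single i 1) p) (by
      intro hd
      rcases hp.dvd_or_dvd hd with hd | hd
      · apply hp.not_isUnit
        apply isUnit_of_dvd_unit hd
        rw [isUnit_map_iff]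
        · exact isUnit_iff_ne_zero.mpr (by simp; omega)
      · exact hi hd) (hZm a b) (by
      have := congrFun (congrFun h1 a) b
      exact this)
  have : (q ^ s • F) a b = z := by
    apply mul_left_cancel₀ hq0
    rw [← hz', hZ, Matrix.smul_apply, Matrix.smul_apply, hs, pow_succ', smul_eq_mul, smul_eq_mul,
      mul_assoc]
  rw [this]; exact hz

/-- Rational functions killed by all derivations are constant. -/
lemma const_of_dm {F : Matrix κ κ K}
    (hF : ∀ i : ι, dm (extDer K (dP (Pi.single i (1 : ℂ) : ι → ℂ))) F = 0) : ∃ T : Matrix κ κ ℂ, F = cM K T := by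
  have h1 : ∀ i j, ∃ a : MvPolynomial ι ℂ, F i j = algebraMap _ K a := fun i j =>
    mem_range_of_forall _ fun p hp =>
      loc_of_comm hp (fun _ => 0) (fun _ => zero_mem _) F (fun i => by simp [hF]) i j
  choose G hG using h1
  have h2 : ∀ i j, G i j = C (coeff 0 (G i j)) := by
    intro i j
    apply eq_C_of_dP
    intro k
    have := congrFun (congrFun (hF k) i) j
    rw [dm_apply, hG, extDer_algebraMap] at this
    exact IsFractionRing.injective (MvPolynomial ι ℂ) K (this.trans (map_zero _).symm)
  refine ⟨Matrix.of fun i j => coeff 0 (G i j), ?_⟩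
  ext i j
  rw [hG, h2, algC, cM_apply, Matrix.of_apply]

open scoped Classical

/-- The sum of the stabilizer. -/
def sS (h : H) : Matrix κ κ ℂ := ∑ w : R.S h, R.lam w

lemma A_eq (h : H) : R.A h = (Fintype.card (R.S h) : ℂ) • 1 - R.sS h := by
  rw [A, Finset.sum_sub_distrib, sS]
  simp [Nat.cast_smul_eq_nsmul]

lemma lam_sS (h : H) (w : R.S h) : R.lam w * R.sS h = R.sS h := by
  rw [sS, Finset.mul_sum]
  exact Fintype.sum_equiv (Equiv.mulLeft w) _ _ (fun x => by simp)

lemma sS_lam (h : H) (w : R.S h) : R.sS h * R.lam w = R.sS h := by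
  rw [sS, Finset.sum_mul]
  exact Fintype.sum_equiv (Equiv.mulRight w) _ _ (fun x => by simp)

lemma sS_sS (h : H) : R.sS h * R.sS h = (Fintype.card (R.S h) : ℂ) • R.sS h := by
  conv_lhs => enter [1]; rw [sS]
  rw [Finset.sum_mul]
  simp [lam_sS, Nat.cast_smul_eq_nsmul]

lemma A_A (h : H) : R.A h * R.A h = (Fintype.card (R.S h) : ℂ) • R.A h := by
  rw [A_eq, sub_mul, mul_sub, mul_sub, sS_sS]
  simp [smul_smul, smul_sub]

lemma Fil_cM_mul (h : H) {n : ℕ} (T : Matrix κ κ ℂ) {F : Matrix κ κ K} (hF : F ∈ R.Fil K h n) :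
    cM K T * F ∈ R.Fil K h n := by
  obtain ⟨Y, hY, rfl⟩ := hF
  exact ⟨cM K T * Y, mul_mem (R.cM_mem h T) hY, by rw [mul_smul_comm]⟩

lemma Fil_mul_cM (h : H) {n : ℕ} (T : Matrix κ κ ℂ) {F : Matrix κ κ K} (hF : F ∈ R.Fil K h n) :
    F * cM K T ∈ R.Fil K h n := by
  obtain ⟨Y, hY, rfl⟩ := hF
  exact ⟨Y * cM K T, mul_mem hY (R.cM_mem h T), by rw [smul_mul_assoc]⟩

lemma cM_A_A (h : H) : cM K (R.A h) * cM K (R.A h) = (Fintype.card (R.S h) : ℂ) • cM K (R.A h) := by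
  rw [← map_mul, A_A, cM_smul, algebraMap_smul]

lemma loc_h (h : H) (F : Matrix κ κ K)
    (hF : dm (extDer K (dP (R.a h))) F = R.M K (R.a h) * F - F * R.M K (R.a h))
    (hw : ∀ w : R.S h, R.tau w F = F * cM K (R.lam w)) : F ∈ R.MO K h := by
  classical
  have hex := exists_pow_mat (prime_lf (R.α_a h)) F
  set r := Nat.find hex with hr
  have hspec := Nat.find_spec hex
  rw [← hr] at hspec
  rcases Nat.eq_zero_or_pos r with h0 | h0
  · rw [h0, pow_zero, one_smul] at hspec; exact hspec
  exfalso
  obtain ⟨s, hs⟩ : ∃ s, r = s + 1 := ⟨r - 1, by omega⟩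
  have hmin := Nat.find_min hex (m := s) (by omega)
  apply hmin
  have hq0 := R.ell_ne K h
  change R.ell K h ^ r • F ∈ R.MO K h at hspec
  change R.ell K h ^ s • F ∈ R.MO K h
  set Z := R.ell K h ^ r • F with hZ
  suffices hsuff : Z ∈ R.Fil K h 1 by
    obtain ⟨Y, hY, h1⟩ := hsuff
    have : R.ell K h ^ s • F = Y := by
      apply smul_right_injective (Matrix κ κ K) hq0
      simp only
      rw [smul_smul, ← pow_succ', ← hs, ← hZ, h1, pow_one]
    rwa [this]
  obtain ⟨B, hB, hM⟩ := R.M_split (K := K) h (R.a h)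
  set A' := cM K (R.A h) with hA'
  set e := Fintype.card (R.S h) with he
  -- the residue relation
  have h1 : (r : ℂ) • Z + A' * Z - Z * A' ∈ R.Fil K h 1 := by
    refine ⟨dm (extDer K (dP (R.a h))) Z - (B * Z - Z * B),
      sub_mem (R.dm_mem h _ hspec) (sub_mem (mul_mem hB hspec) (mul_mem hspec hB)), ?_⟩
    have h2 : R.ell K h • dm (extDer K (dP (R.a h))) Z = (r : K) • Z +
        R.ell K h • (R.M K (R.a h) * Z - Z * R.M K (R.a h)) := by
      rw [hZ, dm_smul, hF, smul_add, smul_smul, dK_ell_pow, mul_smul_comm, smul_mul_assoc, smul_sub,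
        smul_smul]
    rw [pow_one, smul_sub, h2, hM, u_a, ← algebraMap_smul K (r : ℂ), map_natCast]
    simp only [add_mul, mul_add, smul_add, smul_sub, smul_mul_assoc, mul_smul_comm, smul_smul,
      mul_inv_cancel₀ hq0, one_smul, ← hA']
    abel
  have hAA : A' * A' = (e : ℂ) • A' := R.cM_A_A h
  have hr0 : (r : ℂ) ≠ 0 := by simp; omega
  have h2 : A' * Z * A' ∈ R.Fil K h 1 := by
    have := R.Fil_mul_cM h (R.A h) (R.Fil_cM_mul h (R.A h) h1)
    rw [← hA'] at this
    rw [← Submodule.smul_mem_iff _ hr0]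
    convert this using 1
    simp only [mul_add, mul_sub, add_mul, sub_mul, mul_smul_comm, smul_mul_assoc]
    rw [← mul_assoc A' A' Z, hAA, ← mul_assoc A' Z A', mul_assoc (A' * Z) A' A', hAA]
    simp only [mul_smul_comm, smul_mul_assoc]
    abel
  have h3 : A' * Z ∈ R.Fil K h 1 := by
    have := R.Fil_cM_mul h (R.A h) h1
    rw [← hA'] at this
    have hre : (r : ℂ) + e ≠ 0 := by
      rw [← Nat.cast_add]; exact Nat.cast_ne_zero.mpr (by omega)
    rw [← Submodule.smul_mem_iff _ hre]
    have h4 := add_mem this h2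
    convert h4 using 1
    simp only [mul_add, mul_sub, mul_smul_comm]
    rw [← mul_assoc A' A' Z, hAA, smul_mul_assoc, ← mul_assoc A' Z A', add_smul]
    abel
  have h5 : Z * A' ∈ R.Fil K h 1 := by
    by_cases hre : r = e
    · have hcomm : ∀ w : R.S h, Z * cM K (R.lam w) - cM K (R.lam w) * Z ∈ R.Fil K h 1 := by
        intro w
        obtain ⟨Y, hY, hY'⟩ := R.sig_sub_mem h w hspec
        have h6 : R.tau w Z = Z * cM K (R.lam w) := by
          rw [hZ, tau_smul, map_pow, sigK_ell_S, mul_pow, ← map_pow (algebraMap ℂ K), inv_pow, hre,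
            ω_pow_card, inv_one, map_one, one_mul, hw w, smul_mul_assoc]
        refine ⟨cM K (R.lam w) * Y, mul_mem (R.cM_mem h _) hY, ?_⟩
        rw [← h6, tau, sub_eq_iff_eq_add.mp hY', mul_add, pow_one, mul_smul_comm]
        abel
      have h7 : A' * Z - Z * A' ∈ R.Fil K h 1 := by
        have : A' * Z - Z * A' = ∑ w : R.S h, (Z * cM K (R.lam w) - cM K (R.lam w) * Z) := by
          rw [hA', A]
          simp only [map_sum, map_sub, map_one, Finset.sum_mul, Finset.mul_sum, sub_mul, mul_sub,
            one_mul, mul_one, Finset.sum_sub_distrib]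
          abel
        rw [this]; exact sum_mem fun w _ => hcomm w
      have h8 := sub_mem h3 h7
      simpa using h8
    · have := R.Fil_mul_cM h (R.A h) h1
      rw [← hA'] at this
      have hre' : (r : ℂ) - e ≠ 0 := by
        rw [sub_ne_zero]; exact_mod_cast hre
      rw [← Submodule.smul_mem_iff _ hre']
      have h4 := sub_mem this h2
      convert h4 using 1
      simp only [add_mul, sub_mul, smul_mul_assoc]
      rw [mul_assoc Z A' A', hAA, show Z * ((e:ℂ) • A') = (e:ℂ) • (Z * A') from mul_smul_comm _ _ _, sub_smul]
      abel
  have h9 := add_mem (sub_mem h1 h3) h5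
  rw [← Submodule.smul_mem_iff _ hr0]
  convert h9 using 1
  abel

/-- Horizontal equivariant endomorphisms are polynomial. -/
lemma lemma3 (F : Matrix κ κ K)
    (hF : ∀ y, dm (extDer K (dP y)) F = R.M K y * F - F * R.M K y)
    (hw : ∀ w, R.tau w F = F * cM K (R.lam w)) : ∃ G : Matrix κ κ (MvPolynomial ι ℂ), F = pm K G :=
  R.poly_of_loc (fun h => R.loc_h h F (hF _) (fun w => hw w))
    (fun p hp hh => loc_of_comm hp (fun i => R.M K (Pi.single i 1)) (fun i => R.M_mem_loc hp hh _) F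
      (fun i => hF _))

variable (K) in
/-- The normalised flat section. -/
def B : Matrix κ κ (MvPolynomial ι ℂ) := (R.exists_B (K := K)).choose

lemma B_flat (y : ι → ℂ) : R.nab y (pm K (R.B K)) = 0 := (R.exists_B (K := K)).choose_spec.1 y
variable (K) in
lemma B_v : (eval R.v).mapMatrix (R.B K) = 1 := (R.exists_B (K := K)).choose_spec.2

/-- constant polynomial matrices -/
def cP : Matrix κ κ ℂ →+* Matrix κ κ (MvPolynomial ι ℂ) := (C : ℂ →+* MvPolynomial ι ℂ).mapMatrix

lemma pm_cP (T : Matrix κ κ ℂ) : pm K (cP T : Matrix κ κ (MvPolynomial ι ℂ)) = cM K T := by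
  ext i j; exact algC K (T i j)
lemma ev_cP (x : ι → ℂ) (T : Matrix κ κ ℂ) : (eval x).mapMatrix (cP T) = T := by
  ext i j; simp [cP]

lemma B_det : (pm K (R.B K)).det ≠ 0 := by
  have h1 : (R.B K).det ≠ 0 := by
    intro h0
    have := congrArg (eval R.v) h0
    rw [RingHom.map_det, B_v] at this
    simp at this
  rw [pm, ← RingHom.map_det]
  intro h0
  exact h1 (IsFractionRing.injective (MvPolynomial ι ℂ) K (h0.trans (map_zero _).symm))

variable (K) in
/-- inverse of the flat section -/
def Bi : Matrix κ κ K := (pm K (R.B K))⁻¹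

lemma B_Bi : pm K (R.B K) * R.Bi K = 1 := Matrix.mul_nonsing_inv _ (isUnit_iff_ne_zero.mpr R.B_det)
lemma Bi_B : R.Bi K * pm K (R.B K) = 1 := Matrix.nonsing_inv_mul _ (isUnit_iff_ne_zero.mpr R.B_det)

lemma dm_B (y : ι → ℂ) : dm (extDer K (dP y)) (pm K (R.B K)) = R.M K y * pm K (R.B K) :=
  sub_eq_zero.mp (R.B_flat y)

lemma dm_Bi (y : ι → ℂ) : dm (extDer K (dP y)) (R.Bi K) = - (R.Bi K * R.M K y) := by
  have h := congrArg (dm (extDer K (dP y))) (R.Bi_B (K := K))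
  rw [dm_mul, dm_B, dm_one] at h
  have h2 := congrArg (· * R.Bi K) h
  simp only [add_mul, zero_mul, mul_assoc, B_Bi, mul_one] at h2
  exact eq_neg_of_add_eq_zero_left h2

/-- Uniqueness of flat sections. -/
lemma flat_unique (F : Matrix κ κ (MvPolynomial ι ℂ)) (hF : ∀ y, R.nab y (pm K F) = 0) :
    F = R.B K * cP ((eval R.v).mapMatrix F) := by
  have h1 : ∀ y : ι → ℂ, dm (extDer K (dP y)) (R.Bi K * pm K F) = 0 := by
    intro y
    rw [dm_mul, dm_Bi, sub_eq_zero.mp (hF y)]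
    rw [neg_mul, mul_assoc, neg_add_cancel]
  obtain ⟨T, hT⟩ := const_of_dm (ι := ι) (fun i => h1 (Pi.single i 1))
  have h2 : F = R.B K * cP T := by
    apply pm_injective (K := K)
    rw [map_mul, pm_cP, ← hT, ← mul_assoc, B_Bi, one_mul]
  have h3 := congrArg (eval R.v).mapMatrix h2
  rw [map_mul, B_v, one_mul, ev_cP] at h3
  rw [h3]; exact h2

end K2
end Arr
end KZ

namespace KZ
open MvPolynomial Matrix
namespace Arr
variable {W ι κ H : Type*} [Group W] [Fintype W] [Fintype ι] [DecidableEq ι]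
    [Fintype κ] [DecidableEq κ] [Fintype H] [DecidableEq H] [MulAction W H] (R : Arr W ι κ H)

section K2
variable {K : Type*} [Field K] [Algebra (MvPolynomial ι ℂ) K] [IsFractionRing (MvPolynomial ι ℂ) K]
  [Algebra ℂ K] [IsScalarTower ℂ (MvPolynomial ι ℂ) K]

/-- evaluation of polynomial matrices -/
def evM (x : ι → ℂ) : Matrix κ κ (MvPolynomial ι ℂ) →+* Matrix κ κ ℂ := (eval x).mapMatrix

lemma evM_apply (x : ι → ℂ) (G : Matrix κ κ (MvPolynomial ι ℂ)) (i j) : evM x G i j = eval x (G i j) := rfl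

lemma nab_tau_B (w : W) (y : ι → ℂ) : R.nab y (R.tau w (pm K (R.B K))) = 0 := by
  have h : y = R.act w *ᵥ (R.act w⁻¹ *ᵥ y) := by
    rw [mulVec_mulVec, act_mul_inv, one_mulVec]
  rw [h, ← tau_nab, B_flat, tau, map_zero, mul_zero]

/-- polynomial version of tau -/
def tauP (w : W) (F : Matrix κ κ (MvPolynomial ι ℂ)) : Matrix κ κ (MvPolynomial ι ℂ) :=
  cP (R.lam w) * F.map (R.sigP w)

lemma pm_tauP (w : W) (F : Matrix κ κ (MvPolynomial ι ℂ)) : pm K (R.tauP w F) = R.tau w (pm K F) := by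
  rw [tauP, tau, map_mul, pm_cP]
  congr 1
  ext i j
  simp [pm_apply]

variable (K) in
/-- the monodromy matrices -/
def rh (w : W) : Matrix κ κ ℂ := R.lam w * evM (R.act w⁻¹ *ᵥ R.v) (R.B K)

lemma tauP_B (w : W) : R.tauP w (R.B K) = R.B K * cP (R.rh K w) := by
  have h := R.flat_unique (K := K) (R.tauP w (R.B K)) (fun y => by rw [pm_tauP, nab_tau_B])
  rw [h]
  congr 2
  rw [tauP, map_mul, ev_cP, rh]
  congr 1
  ext i j
  simp [sigP, eval_subP, evM_apply]

lemma tau_B (w : W) : R.tau w (pm K (R.B K)) = pm K (R.B K) * cM K (R.rh K w) := by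
  rw [← pm_tauP, tauP_B, map_mul, pm_cP]

lemma cancel_B {S T : Matrix κ κ ℂ} (h : pm K (R.B K) * cM K S = pm K (R.B K) * cM K T) : S = T := by
  have := congrArg (R.Bi K * ·) h
  simp only [← mul_assoc, Bi_B, one_mul] at this
  exact cM_injective this

variable (K) in
/-- the monodromy representation -/
def rho : W →* Matrix κ κ ℂ where
  toFun := R.rh K
  map_one' := by
    apply R.cancel_B (K := K)
    rw [← tau_B, map_one, mul_one, tau_one]
  map_mul' := by
    intro w w'
    apply R.cancel_B (K := K)
    rw [← tau_B, tau_mul, tau_B, tau_mul_cM, tau_B, map_mul, mul_assoc]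

lemma rho_eq (w : W) : R.rho K w = R.lam w * evM (R.act w⁻¹ *ᵥ R.v) (R.B K) := rfl
lemma tau_B' (w : W) : R.tau w (pm K (R.B K)) = pm K (R.B K) * cM K (R.rho K w) := R.tau_B w

lemma comm_B (T : Matrix κ κ ℂ) (hT : ∀ h, T * R.A h = R.A h * T) :
    cP T * R.B K = R.B K * cP T := by
  have hM : ∀ y, cM K T * R.M K y = R.M K y * cM K T := by
    intro y
    simp only [M, Finset.mul_sum, Finset.sum_mul, mul_smul_comm, smul_mul_assoc, ← map_mul, hT]
  have h := R.flat_unique (K := K) (cP T * R.B K) (fun y => by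
    rw [map_mul, pm_cP, nab, dm_mul, dm_cM, dm_B, zero_mul, zero_add, ← mul_assoc, hM, mul_assoc,
      sub_self])
  rw [h, map_mul, ev_cP, B_v, mul_one]

lemma comm_ev {T : Matrix κ κ ℂ} (hT : cP T * R.B K = R.B K * cP T) (x : ι → ℂ) :
    T * evM x (R.B K) = evM x (R.B K) * T := by
  have := congrArg (evM x) hT
  rw [map_mul, map_mul] at this
  rwa [show evM x (cP T) = T from ev_cP x T] at this

lemma N_B : cP R.N * R.B K = R.B K * cP R.N := R.comm_B _ R.N_A

lemma X_M : ∑ i, algebraMap (MvPolynomial ι ℂ) K (X i) • R.M K (Pi.single i 1) = cM K R.N := by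
  simp only [M, Finset.smul_sum, N, map_sum]
  rw [Finset.sum_comm]
  refine Finset.sum_congr rfl fun h _ => ?_
  simp only [smul_smul]
  rw [← Finset.sum_smul]
  convert one_smul K _
  have h0 := R.ell_ne K h
  have : ∀ i, algebraMap (MvPolynomial ι ℂ) K (X i) * R.u K h (Pi.single i 1) =
      algebraMap (MvPolynomial ι ℂ) K (C (R.α h i) * X i) / R.ell K h := by
    intro i
    rw [u, map_mul, algC, dotProduct_single, mul_one]; ring
  simp only [this]
  rw [← Finset.sum_div, ← map_sum]
  exact div_self h0

lemma euler_K : dm (extDer K (eP ι)) (pm K (R.B K)) = cM K R.N * pm K (R.B K) := by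
  have : dm (extDer K (eP ι)) (pm K (R.B K)) = ∑ i, algebraMap (MvPolynomial ι ℂ) K (X i) •
      dm (extDer K (dP (Pi.single i 1))) (pm K (R.B K)) := by
    ext a b
    simp only [dm_apply, eK_eq, Matrix.sum_apply, Matrix.smul_apply, smul_eq_mul]
  rw [this]
  simp only [dm_B]
  rw [← X_M, Finset.sum_mul]
  simp only [smul_mul_assoc]

lemma euler_B : (R.B K).map (eP ι) = cP R.N * R.B K := by
  apply pm_injective (K := K)
  rw [map_mul, pm_cP, ← euler_K]
  ext i j
  simp [pm_apply, dm_apply, extDer_algebraMap]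

/-- coefficient matrices -/
lemma N_coeff (s : ι →₀ ℕ) : R.N * (R.B K).map (coeff s) = (s.degree : ℂ) • (R.B K).map (coeff s) := by
  have h := R.euler_B (K := K)
  ext i j
  have := congrArg (coeff s) (congrFun (congrFun h i) j)
  rw [Matrix.map_apply, coeff_eP, Matrix.mul_apply, coeff_sum] at this
  rw [Matrix.smul_apply, Matrix.map_apply, smul_eq_mul, this, Matrix.mul_apply]
  simp [cP, coeff_C_mul]

lemma coeff_N (s : ι →₀ ℕ) : (R.B K).map (coeff s) * R.N = (s.degree : ℂ) • (R.B K).map (coeff s) := by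
  rw [← N_coeff]
  have h := R.N_B (K := K)
  ext i j
  have := congrArg (coeff s) (congrFun (congrFun h i) j)
  rw [Matrix.mul_apply, Matrix.mul_apply, coeff_sum, coeff_sum] at this
  simpa [cP, coeff_C_mul, mul_comm _ (C _), mul_comm _ (R.N _ _), Matrix.mul_apply] using this.symm

variable (K) in
/-- The spectral projections of the Euler element. -/
def e (n : ℕ) : Matrix κ κ ℂ := evM R.v ((R.B K).map (homogeneousComponent n))

variable (K) in
/-- bound of the degrees -/
def D : ℕ := (∑ i, ∑ j, (R.B K i j).totalDegree) + 1

lemma lt_D (i j) : (R.B K i j).totalDegree < R.D K := by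
  rw [D, Nat.lt_succ_iff]
  exact (Finset.single_le_sum (f := fun j => (R.B K i j).totalDegree) (fun _ _ => Nat.zero_le _) (Finset.mem_univ j)).trans
      (Finset.single_le_sum (f := fun i => ∑ j, (R.B K i j).totalDegree) (fun _ _ => Nat.zero_le _) (Finset.mem_univ i))

lemma sum_hc (i j) : ∑ n ∈ Finset.range (R.D K), homogeneousComponent n (R.B K i j) = R.B K i j := by
  conv_rhs => rw [← sum_homogeneousComponent (R.B K i j)]
  symm
  apply Finset.sum_subset
  · intro n hn
    have := R.lt_D (K := K) i j
    simp only [Finset.mem_range] at hn ⊢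
    omega
  · intro n _ hn
    apply homogeneousComponent_eq_zero
    simp only [Finset.mem_range] at hn
    omega

lemma ev_smul (c : ℂ) : evM (c • R.v) (R.B K) = ∑ n ∈ Finset.range (R.D K), c ^ n • R.e K n := by
  ext i j
  rw [evM_apply, ← sum_hc, map_sum, Matrix.sum_apply]
  refine Finset.sum_congr rfl fun n _ => ?_
  rw [Matrix.smul_apply, e, evM_apply, Matrix.map_apply]
  rw [smul_eq_mul, homogeneousComponent_apply, map_sum, map_sum, Finset.mul_sum]
  refine Finset.sum_congr rfl fun m hm => ?_
  rw [eval_monomial, eval_monomial, ← (Finset.mem_filter.mp hm).2, Finsupp.degree_apply,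
    ← Finset.prod_pow_eq_pow_sum, Finsupp.prod, Finsupp.prod]
  simp only [Pi.smul_apply, smul_eq_mul, mul_pow, Finset.prod_mul_distrib]
  ring

lemma sum_e : ∑ n ∈ Finset.range (R.D K), R.e K n = 1 := by
  have := R.ev_smul (K := K) 1
  simp only [one_pow, one_smul] at this
  rw [← this]; exact R.B_v K

lemma e_eq (n : ℕ) : ∃ s : Finset (ι →₀ ℕ), R.e K n = ∑ m ∈ s.filter (fun m => m.degree = n),
    (m.prod fun i k => R.v i ^ k) • (R.B K).map (coeff m) := by
  classical
  refine ⟨Finset.univ.biUnion fun i => Finset.univ.biUnion fun j => (R.B K i j).support, ?_⟩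
  ext i j
  rw [e, evM_apply, Matrix.map_apply, homogeneousComponent_apply, map_sum, Matrix.sum_apply]
  simp only [eval_monomial, Matrix.smul_apply, Matrix.map_apply, smul_eq_mul]
  have : ∀ m, coeff m (R.B K i j) * (m.prod fun i k => R.v i ^ k) =
    (m.prod fun i k => R.v i ^ k) * coeff m (R.B K i j) := fun m => mul_comm _ _
  simp only [this]
  apply Finset.sum_subset
  · intro m hm
    simp only [Finset.mem_filter, Finset.mem_biUnion, Finset.mem_univ, true_and] at hm ⊢
    exact ⟨⟨i, j, hm.1⟩, hm.2⟩
  · intro m hm hn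
    simp only [Finset.mem_filter] at hm hn
    have : m ∉ (R.B K i j).support := fun h => hn ⟨h, hm.2⟩
    rw [notMem_support_iff.mp this, mul_zero]

lemma N_e (n : ℕ) : R.N * R.e K n = (n : ℂ) • R.e K n := by
  obtain ⟨s, hs⟩ := R.e_eq (K := K) n
  rw [hs, Finset.mul_sum, Finset.smul_sum]
  refine Finset.sum_congr rfl fun m hm => ?_
  rw [mul_smul_comm, N_coeff, (Finset.mem_filter.mp hm).2, smul_comm]

lemma e_N (n : ℕ) : R.e K n * R.N = (n : ℂ) • R.e K n := by
  obtain ⟨s, hs⟩ := R.e_eq (K := K) n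
  rw [hs, Finset.sum_mul, Finset.smul_sum]
  refine Finset.sum_congr rfl fun m hm => ?_
  rw [smul_mul_assoc, coeff_N, (Finset.mem_filter.mp hm).2, smul_comm]

lemma e_comm_zero {T : Matrix κ κ ℂ} (hT : T * R.N = R.N * T) {m n : ℕ} (hmn : m ≠ n) :
    R.e K m * T * R.e K n = 0 := by
  have h1 : R.e K m * T * (R.N * R.e K n) = R.e K m * R.N * (T * R.e K n) := by
    rw [← mul_assoc, mul_assoc _ T, hT]; simp only [mul_assoc]
  rw [N_e, e_N, mul_smul_comm, smul_mul_assoc, ← mul_assoc, ← sub_eq_zero, ← sub_smul] at h1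
  rcases smul_eq_zero.mp h1 with h | h
  · exfalso; apply hmn; rw [sub_eq_zero] at h; exact_mod_cast h.symm
  · exact h

lemma e_big {n : ℕ} (hn : R.D K ≤ n) : R.e K n = 0 := by
  have h : R.e K n = ∑ m ∈ Finset.range (R.D K), R.e K m * 1 * R.e K n := by
    rw [← Finset.sum_mul, ← Finset.sum_mul, sum_e, one_mul, one_mul]
  rw [h]
  refine Finset.sum_eq_zero fun m hm => R.e_comm_zero (by simp) ?_
  rw [Finset.mem_range] at hm; omega

lemma e_comm {T : Matrix κ κ ℂ} (hT : T * R.N = R.N * T) (n : ℕ) : T * R.e K n = R.e K n * T := by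
  by_cases hn : n < R.D K
  · have h1 : T * R.e K n = R.e K n * T * R.e K n := by
      have : T * R.e K n = ∑ m ∈ Finset.range (R.D K), R.e K m * T * R.e K n := by
        rw [← Finset.sum_mul, ← Finset.sum_mul, sum_e, one_mul]
      rw [this]
      rw [Finset.sum_eq_single n]
      · intro m _ hm; exact R.e_comm_zero hT hm
      · intro h; exact absurd (Finset.mem_range.mpr hn) h
    have h2 : R.e K n * T = R.e K n * T * R.e K n := by
      have : R.e K n * T = ∑ m ∈ Finset.range (R.D K), R.e K n * T * R.e K m := by
        rw [← Finset.mul_sum, sum_e, mul_one]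
      refine this.trans ?_
      rw [Finset.sum_eq_single n]
      · intro m _ hm; exact R.e_comm_zero hT hm.symm
      · intro h; exact absurd (Finset.mem_range.mpr hn) h
    exact h1.trans h2.symm
  · rw [R.e_big (not_lt.mp hn), mul_zero, zero_mul]

lemma N_pow (l : ℕ) : R.N ^ l = ∑ n ∈ Finset.range (R.D K), (n : ℂ) ^ l • R.e K n := by
  induction l with
  | zero => simp [sum_e]
  | succ l ih =>
    rw [pow_succ', ih, Finset.mul_sum]
    refine Finset.sum_congr rfl fun n _ => ?_
    rw [mul_smul_comm, N_e, smul_smul, pow_succ]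

lemma rho_N (w : W) : R.rho K w * R.N = R.N * R.rho K w := by
  rw [rho_eq, mul_assoc, ← R.comm_ev R.N_B, ← mul_assoc, lam_N, mul_assoc]

end K2
end Arr
end KZ

namespace KZ
open MvPolynomial Matrix
namespace Arr
variable {W ι κ H : Type*} [Group W] [Fintype W] [Fintype ι] [DecidableEq ι]
    [Fintype κ] [DecidableEq κ] [Fintype H] [DecidableEq H] [MulAction W H] (R : Arr W ι κ H)

/-- restriction of a polynomial to a line -/
def psi (p a : ι → ℂ) : MvPolynomial ι ℂ →ₐ[ℂ] Polynomial ℂ :=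
  aeval (fun i => Polynomial.C (p i) + Polynomial.C (a i) * Polynomial.X)

lemma psi_C (p a : ι → ℂ) (c : ℂ) : psi p a (C c) = Polynomial.C c := by
  rw [psi, algHom_C]; rfl
lemma psi_X (p a : ι → ℂ) (i : ι) :
    psi p a (X i) = Polynomial.C (p i) + Polynomial.C (a i) * Polynomial.X := by
  rw [psi, MvPolynomial.aeval_X]

lemma eval_psi (p a : ι → ℂ) (z : ℂ) (f : MvPolynomial ι ℂ) :
    (psi p a f).eval z = eval (p + z • a) f := by
  have : (Polynomial.evalRingHom z).comp (psi p a).toRingHom = eval (p + z • a) := by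
    apply MvPolynomial.ringHom_ext
    · intro c; simp [psi_C]
    · intro i; simp [psi_X]; ring
  exact congrArg (fun f' => f' f) this

lemma psi_dP (p a : ι → ℂ) (f : MvPolynomial ι ℂ) :
    psi p a (dP a f) = Polynomial.derivative (psi p a f) := by
  induction f using MvPolynomial.induction_on with
  | C c => simp [psi_C]
  | add f g hf hg => simp [hf, hg]
  | mul_X f i hf => simp [hf, psi_X, psi_C]; ring

lemma psi_lf (p a α : ι → ℂ) :
    psi p a (lf α) = Polynomial.C (α ⬝ᵥ p) + Polynomial.C (α ⬝ᵥ a) * Polynomial.X := by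
  simp only [lf, map_sum, map_mul, psi_C, psi_X, dotProduct, mul_add, Finset.sum_add_distrib,
    Finset.sum_mul, mul_assoc]

lemma psi_subP (p a : ι → ℂ) (g : Matrix ι ι ℂ) (c : ℂ) (hp : g *ᵥ p = p) (ha : g *ᵥ a = c • a)
    (f : MvPolynomial ι ℂ) :
    psi p a (subP g f) = (psi p a f).comp (Polynomial.C c * Polynomial.X) := by
  induction f using MvPolynomial.induction_on with
  | C c => simp [psi_C]
  | add f g hf hg => simp [hf, hg]
  | mul_X f i hf =>
    have h1 : g i ⬝ᵥ p = p i := congrFun hp i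
    have h2 : g i ⬝ᵥ a = c * a i := congrFun ha i
    simp [hf, psi_X, psi_lf, h1, h2]
    ring_nf
    tauto

/-- coefficient matrices of one variable polynomial matrices -/
def cf (k : ℕ) (F : Matrix κ κ (Polynomial ℂ)) : Matrix κ κ ℂ := F.map fun f => f.coeff k

/-- constant matrices -/
def cX : Matrix κ κ ℂ →+* Matrix κ κ (Polynomial ℂ) := (Polynomial.C : ℂ →+* Polynomial ℂ).mapMatrix

lemma cf_cX_mul (k : ℕ) (T : Matrix κ κ ℂ) (F : Matrix κ κ (Polynomial ℂ)) :
    cf k (cX T * F) = T * cf k F := by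
  ext i j; simp [cf, cX, Matrix.mul_apply]
lemma cf_mul_cX (k : ℕ) (T : Matrix κ κ ℂ) (F : Matrix κ κ (Polynomial ℂ)) :
    cf k (F * cX T) = cf k F * T := by
  ext i j; simp [cf, cX, Matrix.mul_apply]
lemma cf_zero {F : Matrix κ κ (Polynomial ℂ)} (h : ∀ k, cf k F = 0) : F = 0 := by
  ext i j k; exact congrFun (congrFun (h k) i) j

lemma ode_coeff {F S : Matrix κ κ (Polynomial ℂ)} {q : Polynomial ℂ} (hq : ¬ Polynomial.X ∣ q)
    (A : Matrix κ κ ℂ)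
    (hode : q • ((Polynomial.X : Polynomial ℂ) • F.map (Polynomial.derivative (R := ℂ)) - cX A * F) = (Polynomial.X : Polynomial ℂ) • (S * F))
    (k : ℕ) (hk : ∀ j < k, cf j F = 0) : (k : ℂ) • cf k F = A * cf k F := by
  have hd : ∀ i j, Polynomial.X ^ k ∣ F i j := by
    intro i j
    rw [Polynomial.X_pow_dvd_iff]
    intro m hm
    exact congrFun (congrFun (hk m hm) i) j
  rw [← cf_cX_mul, ← sub_eq_zero]
  ext i j
  have h1 := congrFun (congrFun hode i) j
  simp only [Matrix.smul_apply, Matrix.sub_apply, smul_eq_mul, Matrix.map_apply] at h1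
  have h2 : Polynomial.X ^ (k + 1) ∣ q * (Polynomial.X * Polynomial.derivative (F i j) - (cX A * F) i j) := by
    rw [h1, pow_succ']
    apply mul_dvd_mul_left
    rw [Matrix.mul_apply]
    exact Finset.dvd_sum fun m _ => (hd m j).mul_left _
  have h3 := Polynomial.prime_X.pow_dvd_of_dvd_mul_left _ hq h2
  rw [Polynomial.X_pow_dvd_iff] at h3
  have h4 := h3 k (by omega)
  rw [Polynomial.coeff_sub] at h4
  rw [Matrix.sub_apply, Matrix.smul_apply, Matrix.zero_apply, ← h4]
  congr 1
  rcases k with _ | k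
  · simp
  · rw [Polynomial.coeff_X_mul, Polynomial.coeff_derivative, cf, Matrix.map_apply, smul_eq_mul]
    push_cast; ring

section K2
variable {K : Type*} [Field K] [Algebra (MvPolynomial ι ℂ) K] [IsFractionRing (MvPolynomial ι ℂ) K]
  [Algebra ℂ K] [IsScalarTower ℂ (MvPolynomial ι ℂ) K]

lemma common_den {p : MvPolynomial ι ℂ} (hp : Prime p) {F : Matrix κ κ K}
    (hF : F ∈ (locRing K p hp).matrix) : ∃ (q : MvPolynomial ι ℂ) (S : Matrix κ κ (MvPolynomial ι ℂ)),
      ¬ p ∣ q ∧ algebraMap _ K q • F = pm K S := by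
  have : ∀ i j, ∃ s q : MvPolynomial ι ℂ, ¬ p ∣ q ∧ F i j * algebraMap _ K q = algebraMap _ K s :=
    fun i j => (mem_locRing (hp := hp)).mp (hF i j)
  choose s q hq hs using this
  refine ⟨∏ x : κ × κ, q x.1 x.2,
    Matrix.of fun i j => s i j * ∏ x ∈ Finset.univ.erase (i, j), q x.1 x.2, ?_, ?_⟩
  · intro h
    obtain ⟨x, _, hx⟩ := hp.exists_mem_finset_dvd h
    exact hq _ _ hx
  · ext i j
    rw [Matrix.smul_apply, pm_apply, Matrix.of_apply, map_mul, ← hs,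
      ← Finset.mul_prod_erase _ _ (Finset.mem_univ (i, j)), map_mul, smul_eq_mul]
    ring

/-- polynomial form of the flatness in the normal direction -/
lemma ode_poly (h : H) : ∃ (q : MvPolynomial ι ℂ) (S : Matrix κ κ (MvPolynomial ι ℂ)),
    ¬ lf (R.α h) ∣ q ∧ q • (lf (R.α h) • (R.B K).map (dP (R.a h)) - cP (R.A h) * R.B K) =
      lf (R.α h) • (S * R.B K) := by
  obtain ⟨B', hB, hM⟩ := R.M_split (K := K) h (R.a h)
  obtain ⟨q, S, hq, hS⟩ := common_den _ hB
  refine ⟨q, S, hq, ?_⟩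
  apply pm_injective (K := K)
  have hsm : ∀ (c : MvPolynomial ι ℂ) (F : Matrix κ κ (MvPolynomial ι ℂ)),
      pm K (c • F) = algebraMap _ K c • pm K F := by
    intro c F; ext i j; simp [pm_apply]
  have hd : pm K ((R.B K).map (dP (R.a h))) = dm (extDer K (dP (R.a h))) (pm K (R.B K)) := by
    ext i j; simp [pm_apply, dm_apply, extDer_algebraMap]
  rw [hsm, map_sub, hsm, hd, dm_B, map_mul, pm_cP, hsm, map_mul, ← hS, hM, u_a, add_mul,
    smul_mul_assoc, smul_mul_assoc]
  rw [show algebraMap (MvPolynomial ι ℂ) K (lf (R.α h)) = R.ell K h from rfl, smul_add, smul_smul,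
    mul_inv_cancel₀ (R.ell_ne K h), one_smul, add_sub_cancel_left, smul_comm]

open scoped Classical

lemma sS_A (h : H) : R.sS h * R.A h = 0 := by
  rw [A_eq, mul_sub, sS_sS]; simp
lemma A_sS (h : H) : R.A h * R.sS h = 0 := by
  rw [A_eq, sub_mul, sS_sS]; simp

/-- The monodromy around a hyperplane is conjugate to the original action. -/
lemma trace_local (h : H) (t : R.S h) (T : Matrix κ κ ℂ) (hT : ∀ w, T * R.lam w = R.lam w * T) :
    (R.rho K t * T).trace = (R.lam t * T).trace := by
  have hTS : T * R.sS h = R.sS h * T := by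
    simp only [sS, Finset.mul_sum, Finset.sum_mul, hT]
  have hTA : ∀ h, T * R.A h = R.A h * T := by
    intro h
    simp only [A, Finset.mul_sum, Finset.sum_mul, mul_sub, sub_mul, hT, one_mul, mul_one]
  have hTB := R.comm_B (K := K) T hTA
  obtain ⟨q, S, hq, hode⟩ := R.ode_poly (K := K) h
  have hBd : (R.B K).det ≠ 0 := by
    intro h0
    apply R.B_det (K := K)
    rw [pm, ← RingHom.map_det, h0, map_zero]
  have hq' : subP (prM (R.a h) (R.α h)) q ≠ 0 := fun h0 => hq ((lf_dvd_iff (R.α_a h) q).mpr h0)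
  obtain ⟨x, hx⟩ : ∃ x, eval x (subP (prM (R.a h) (R.α h)) q * (R.B K).det) ≠ 0 := by
    by_contra! hc
    exact mul_ne_zero hq' hBd (MvPolynomial.funext (fun x => by rw [hc x, map_zero]))
  rw [map_mul, eval_subP] at hx
  set p := prM (R.a h) (R.α h) *ᵥ x with hp
  have hpx : p = x - (R.α h ⬝ᵥ x) • R.a h := by
    rw [hp, prM, sub_mulVec, one_mulVec, vecMulVec_mulVec]
    simp
  have hαp : R.α h ⬝ᵥ p = 0 := by
    rw [hpx, dotProduct_sub, dotProduct_smul, R.α_a]; simp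
  set ps := psi p (R.a h) with hps
  have hell : ps (lf (R.α h)) = Polynomial.X := by
    rw [hps, psi_lf, hαp, R.α_a]; simp
  have hqX : ¬ Polynomial.X ∣ ps q := by
    rw [Polynomial.X_dvd_iff, Polynomial.coeff_zero_eq_eval_zero, hps, eval_psi]
    simpa using left_ne_zero_of_mul hx
  set b : Matrix κ κ (Polynomial ℂ) := ps.toRingHom.mapMatrix (R.B K) with hb
  have hbd : b.det ≠ 0 := by
    intro h0
    rw [hb, ← RingHom.map_det] at h0
    have := congrArg (Polynomial.eval (R.α h ⬝ᵥ x)) h0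
    rw [Polynomial.eval_zero] at this
    change Polynomial.eval _ (psi p (R.a h) _) = 0 at this
    rw [eval_psi, hpx, sub_add_cancel] at this
    exact right_ne_zero_of_mul hx this
  have hcP : ∀ T : Matrix κ κ ℂ, ps.toRingHom.mapMatrix (cP T) = cX T := by
    intro T; ext1 i j; exact psi_C _ _ _
  have hode' : ps q • ((Polynomial.X : Polynomial ℂ) • b.map (Polynomial.derivative (R := ℂ)) - cX (R.A h) * b) =
      (Polynomial.X : Polynomial ℂ) • (ps.toRingHom.mapMatrix S * b) := by
    have := congrArg ps.toRingHom.mapMatrix hode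
    have hsm : ∀ (c : MvPolynomial ι ℂ) (F : Matrix κ κ (MvPolynomial ι ℂ)),
        ps.toRingHom.mapMatrix (c • F) = ps c • ps.toRingHom.mapMatrix F := by
      intro c F; ext1 i j; simp
    have hd : ps.toRingHom.mapMatrix ((R.B K).map (dP (R.a h))) = b.map (Polynomial.derivative (R := ℂ)) := by
      ext1 i j; exact psi_dP _ _ _
    rw [hsm, map_sub, hsm, hd, map_mul, hcP, hsm, map_mul, hell] at this
    exact this
  have hmon : ∀ k, R.lam t * ((R.ω h t)⁻¹ ^ k • cf k b) = cf k b * R.rho K t := by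
    intro k
    have h1 := congrArg ps.toRingHom.mapMatrix (R.tauP_B (K := K) t)
    rw [tauP, map_mul, map_mul, hcP, hcP] at h1
    have h2 := congrArg (cf k) h1
    rw [cf_cX_mul, cf_mul_cX] at h2
    rw [show R.rho K t = R.rh K t from rfl, ← h2]
    congr 1
    ext i j
    simp only [Matrix.smul_apply, cf, Matrix.map_apply, RingHom.mapMatrix_apply]
    change _ = (psi p (R.a h) (subP _ _)).coeff k
    rw [psi_subP p (R.a h) _ (R.ω h t)⁻¹, Polynomial.comp_C_mul_X_coeff]
    · rw [smul_eq_mul, mul_comm]; rfl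
    · have := R.act_ker h t⁻¹ p hαp
      simpa using this
    · have := R.act_a h t⁻¹
      rw [ω_inv] at this
      simpa using this
  set n := Fintype.card (R.S h) with hn
  have hn0 : (n : ℂ) ≠ 0 := by simp [hn]
  have hlA : R.lam t * R.A h = R.A h * R.lam t := by
    rw [A_eq, mul_sub, sub_mul, lam_sS, sS_lam]; simp
  set Cm := R.sS h * cf 0 b + R.A h * cf n b with hC
  have hC1 : R.lam t * Cm = Cm * R.rho K t := by
    have h0 := hmon 0
    have h1 := hmon n
    rw [pow_zero, one_smul] at h0
    rw [inv_pow, ω_pow_card, inv_one, one_smul] at h1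
    rw [hC, mul_add, add_mul, ← mul_assoc, lam_sS, ← mul_assoc, hlA, mul_assoc, h1, mul_assoc, ← h0,
      ← mul_assoc (R.sS h), sS_lam, ← mul_assoc]
  have hTb : ∀ k, T * cf k b = cf k b * T := by
    intro k
    rw [← cf_cX_mul, ← cf_mul_cX, ← hcP, hb, ← map_mul, ← map_mul, hTB]
  have hC2 : T * Cm = Cm * T := by
    rw [hC, mul_add, add_mul, ← mul_assoc, ← mul_assoc, hTS, hTA, mul_assoc, mul_assoc, hTb, hTb,
      mul_assoc, mul_assoc]
  have hCd : Cm.det ≠ 0 := by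
    intro h0
    obtain ⟨y, hy, hy0⟩ := Matrix.exists_mulVec_eq_zero_iff.mpr h0
    set Y : Matrix κ κ ℂ := Matrix.of fun i _ => y i with hY
    have hCY : Cm * Y = 0 := by
      ext i j; exact congrFun hy0 i
    rw [hC, add_mul, mul_assoc, mul_assoc] at hCY
    have e1 : R.sS h * (cf 0 b * Y) = 0 := by
      have := congrArg (R.sS h * ·) hCY
      simp only [mul_add, ← mul_assoc, sS_A, sS_sS, zero_mul, add_zero, mul_zero, smul_mul_assoc] at this
      rw [← mul_assoc]
      exact (smul_eq_zero.mp this).resolve_left hn0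
    have e2 : R.A h * (cf n b * Y) = 0 := by
      have := congrArg (R.A h * ·) hCY
      simp only [mul_add, ← mul_assoc, A_sS, A_A, zero_mul, zero_add, mul_zero, smul_mul_assoc] at this
      rw [← mul_assoc]
      exact (smul_eq_zero.mp this).resolve_left hn0
    have hode2 : ps q • ((Polynomial.X : Polynomial ℂ) • (b * cX Y).map (Polynomial.derivative (R := ℂ)) - cX (R.A h) * (b * cX Y)) =
      (Polynomial.X : Polynomial ℂ) • (ps.toRingHom.mapMatrix S * (b * cX Y)) := by
      have hder : (b * cX Y).map (Polynomial.derivative (R := ℂ)) = b.map (Polynomial.derivative (R := ℂ)) * cX Y := by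
        ext1 i j
        simp [Matrix.mul_apply, cX]
      rw [hder, ← mul_assoc, ← mul_assoc, ← smul_mul_assoc, ← smul_mul_assoc, ← sub_mul,
        ← smul_mul_assoc, hode']
    have hall : ∀ k, cf k (b * cX Y) = 0 := by
      intro k
      induction k using Nat.strong_induction_on with
      | _ k ih =>
        have h1 := ode_coeff hqX (R.A h) hode2 k ih
        rw [← cf_mul_cX] at e1 e2
        have f1 : R.sS h * cf k (b * cX Y) = 0 := by
          by_cases hk : k = 0
          · rw [hk]; exact e1
          · have := congrArg (R.sS h * ·) h1
            simp only [mul_smul_comm, ← mul_assoc, sS_A, zero_mul] at this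
            exact (smul_eq_zero.mp this).resolve_left (by simpa using hk)
        have f2 : R.A h * cf k (b * cX Y) = 0 := by
          by_cases hk : k = n
          · rw [hk]; exact e2
          · have := congrArg (R.A h * ·) h1
            simp only [mul_smul_comm, ← mul_assoc, A_A, smul_mul_assoc] at this
            rw [← sub_eq_zero, ← sub_smul] at this
            exact (smul_eq_zero.mp this).resolve_left (by
              rw [sub_eq_zero]; exact_mod_cast hk)
        have f3 : (n : ℂ) • cf k (b * cX Y) = 0 := by
          have : (n : ℂ) • (1 : Matrix κ κ ℂ) = R.A h + R.sS h := by rw [A_eq, sub_add_cancel]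
          rw [← one_mul (cf k (b * cX Y)), ← smul_mul_assoc, this, add_mul, f1, f2, add_zero]
        exact (smul_eq_zero.mp f3).resolve_left hn0
    have hbY := cf_zero hall
    have hcY : cX Y = 0 := by
      have := congrArg (b.adjugate * ·) hbY
      simp only [← mul_assoc, adjugate_mul, mul_zero, smul_mul_assoc, one_mul] at this
      exact (smul_eq_zero.mp this).resolve_left hbd
    apply hy
    ext i
    have := congrFun (congrFun hcY i) i
    exact Polynomial.C_eq_zero.mp this
  have hu : IsUnit Cm.det := isUnit_iff_ne_zero.mpr hCd
  have hr : R.rho K t = Cm⁻¹ * (R.lam t * Cm) := by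
    rw [hC1, ← mul_assoc, Matrix.nonsing_inv_mul _ hu, one_mul]
  rw [hr, mul_assoc, mul_assoc, ← hC2, Matrix.trace_mul_comm, mul_assoc, mul_assoc,
    Matrix.mul_nonsing_inv _ hu, mul_one]

end K2
end Arr
end KZ

namespace KZ
open MvPolynomial Matrix
namespace Arr
variable {W ι κ H : Type*} [Group W] [Fintype W] [Fintype ι] [DecidableEq ι]
    [Fintype κ] [DecidableEq κ] [Fintype H] [DecidableEq H] [MulAction W H] (R : Arr W ι κ H)

section K2
variable {K : Type*} [Field K] [Algebra (MvPolynomial ι ℂ) K] [IsFractionRing (MvPolynomial ι ℂ) K]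
  [Algebra ℂ K] [IsScalarTower ℂ (MvPolynomial ι ℂ) K]

lemma N_pmB : cM K R.N * pm K (R.B K) = pm K (R.B K) * cM K R.N := by
  rw [← pm_cP (ι := ι), ← map_mul, N_B, map_mul]

lemma euler_Bi : dm (extDer K (eP ι)) (R.Bi K) = - (R.Bi K * cM K R.N) := by
  have h := congrArg (dm (extDer K (eP ι))) (R.Bi_B (K := K))
  rw [dm_mul, euler_K, dm_one] at h
  have h2 := congrArg (· * R.Bi K) h
  simp only [add_mul, zero_mul, mul_assoc, B_Bi, mul_one] at h2
  exact eq_neg_of_add_eq_zero_left h2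

/-- the horizontal endomorphism attached to a matrix commuting with the monodromy is polynomial -/
lemma end_poly (T : Matrix κ κ ℂ) (hT : ∀ w, R.rho K w * T = T * R.rho K w) :
    ∃ G : Matrix κ κ (MvPolynomial ι ℂ), pm K (R.B K) * cM K T * R.Bi K = pm K G := by
  apply R.lemma3
  · intro y
    rw [dm_mul, dm_mul, dm_cM, dm_B, dm_Bi, mul_zero, add_zero]
    simp only [mul_assoc, mul_neg]
    abel
  · intro w
    have h1 : R.tau w (pm K (R.B K)) = cM K (R.lam w) * (R.sigK K w).mapMatrix (pm K (R.B K)) := rfl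
    rw [tau_B'] at h1
    have h2 : (R.sigK K w).mapMatrix (pm K (R.B K)) * (R.sigK K w).mapMatrix (R.Bi K) = 1 := by
      rw [← map_mul, B_Bi, map_one]
    have h3 : cM K (R.rho K w) * (R.sigK K w).mapMatrix (R.Bi K) = R.Bi K * cM K (R.lam w) := by
      have := congrArg (fun F => R.Bi K * (F * (R.sigK K w).mapMatrix (R.Bi K))) h1
      simp only [mul_assoc, h2, mul_one] at this
      rw [← mul_assoc, Bi_B, one_mul] at this
      exact this
    rw [tau, map_mul, map_mul, sig_cM, ← mul_assoc, ← mul_assoc, ← h1, mul_assoc (pm K (R.B K)),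
      ← map_mul, hT, map_mul, mul_assoc, mul_assoc (cM K T), h3]
    simp only [mul_assoc]

lemma end_euler (T : Matrix κ κ ℂ) (c : ℂ) (hc : R.N * T - T * R.N = c • T) :
    dm (extDer K (eP ι)) (pm K (R.B K) * cM K T * R.Bi K) =
      algebraMap ℂ K c • (pm K (R.B K) * cM K T * R.Bi K) := by
  have h1 : cM K R.N * cM K T - cM K T * cM K R.N = algebraMap ℂ K c • cM K T := by
    rw [← cM_smul, ← hc, map_sub, map_mul, map_mul]
  have h2 : R.Bi K * cM K R.N = cM K R.N * R.Bi K := by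
    have := congrArg (fun F => R.Bi K * F * R.Bi K) (R.N_pmB (K := K))
    simp only [mul_assoc, B_Bi, mul_one] at this
    rw [this, ← mul_assoc, Bi_B, one_mul]
  rw [dm_mul, dm_mul, dm_cM, euler_K, euler_Bi, mul_zero, add_zero, N_pmB, h2, ← smul_mul_assoc,
    ← mul_smul_comm, ← h1]
  simp only [mul_assoc, mul_neg, sub_mul, mul_sub]
  abel

lemma end_neg (T : Matrix κ κ ℂ) (hT : ∀ w, R.rho K w * T = T * R.rho K w) (c : ℤ) (hc0 : c < 0)
    (hc : R.N * T - T * R.N = (c : ℂ) • T) : T = 0 := by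
  obtain ⟨G, hG⟩ := R.end_poly T hT
  have h1 := R.end_euler (K := K) T c hc
  rw [hG] at h1
  have hG0 : G = 0 := by
    ext1 i j
    apply eP_eq_zero_of_neg hc0
    apply IsFractionRing.injective (MvPolynomial ι ℂ) K
    have := congrFun (congrFun h1 i) j
    rw [dm_apply, pm_apply, extDer_algebraMap] at this
    rw [this, Matrix.smul_apply, pm_apply]
    simp [Algebra.smul_def]
  rw [hG0, map_zero] at hG
  apply R.cancel_B (K := K)
  have := congrArg (· * pm K (R.B K)) hG
  simp only [mul_assoc, Bi_B, mul_one, zero_mul] at this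
  rw [this, map_zero, mul_zero]

lemma end_zero (T : Matrix κ κ ℂ) (hT : ∀ w, R.rho K w * T = T * R.rho K w)
    (hc : R.N * T = T * R.N) : ∀ w, T * R.lam w = R.lam w * T := by
  obtain ⟨G, hG⟩ := R.end_poly T hT
  have h1 := R.end_euler (K := K) T 0 (by rw [hc, sub_self, zero_smul])
  rw [hG, map_zero, zero_smul] at h1
  have hG0 : ∀ i j, G i j = C (coeff 0 (G i j)) := by
    intro i j
    apply eq_C_of_eP
    apply IsFractionRing.injective (MvPolynomial ι ℂ) K
    have := congrFun (congrFun h1 i) j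
    rw [dm_apply, pm_apply, extDer_algebraMap] at this
    rw [this]; simp
  have hG1 : G = cP (G.map (coeff 0)) := by
    ext1 i j; exact hG0 i j
  have h2 : pm K (R.B K) * cM K T = pm K (cP (G.map (coeff 0)) * R.B K) := by
    rw [map_mul, ← hG1, ← hG, mul_assoc, Bi_B, mul_one]
  have h3 : R.B K * cP T = cP (G.map (coeff 0)) * R.B K := by
    apply pm_injective (K := K)
    rw [← h2, map_mul, pm_cP]
  have h4 := congrArg (eval R.v).mapMatrix h3
  rw [map_mul, map_mul, B_v, ev_cP, ev_cP, one_mul, mul_one] at h4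
  rw [← h4] at h3
  intro w
  have h5 := R.rho_eq (K := K) w
  have h6 := R.comm_ev h3.symm (R.act w⁻¹ *ᵥ R.v)
  have h7 : IsUnit (evM (R.act w⁻¹ *ᵥ R.v) (R.B K)) := by
    apply isUnit_of_mul_isUnit_right (x := R.lam w)
    rw [← h5]
    exact IsUnit.map _ (Group.isUnit w)
  have h8 := hT w
  rw [h5, mul_assoc, ← h6, ← mul_assoc, ← mul_assoc] at h8
  exact (h7.mul_right_cancel h8).symm

open scoped ComplexOrder

variable (K) in
/-- invariant hermitian form -/
def Hf : Matrix κ κ ℂ := ∑ w, (R.rho K w)ᴴ * R.rho K w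

lemma Hf_rho (u : W) : R.Hf K * R.rho K u = (R.rho K u⁻¹)ᴴ * R.Hf K := by
  have h1 : R.rho K u * R.rho K u⁻¹ = 1 := by rw [← map_mul]; simp
  have h2 : (R.rho K u)ᴴ * R.Hf K * R.rho K u = R.Hf K := by
    rw [Hf, Finset.mul_sum, Finset.sum_mul]
    refine Fintype.sum_equiv (Equiv.mulRight u) _ _ (fun w => ?_)
    simp only [Equiv.coe_mulRight, map_mul, conjTranspose_mul, mul_assoc]
  have h3 : (R.rho K u⁻¹)ᴴ * (R.rho K u)ᴴ = 1 := by rw [← conjTranspose_mul, h1, conjTranspose_one]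
  conv_rhs => rw [← h2]
  rw [mul_assoc ((R.rho K u)ᴴ), ← mul_assoc, h3, one_mul]

lemma Hf_pos : (R.Hf K).PosDef := by
  classical
  rw [Hf, ← Finset.add_sum_erase _ _ (Finset.mem_univ (1 : W))]
  apply Matrix.PosDef.add_posSemidef
  · rw [map_one]; simpa using Matrix.PosDef.one
  · apply Matrix.posSemidef_sum
    intro w _
    exact Matrix.posSemidef_conjTranspose_mul_self _

lemma Hf_unit : IsUnit (R.Hf K) := R.Hf_pos.isUnit

section U
variable (hU : ∀ w, (R.lam w)ᴴ = R.lam w⁻¹)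

lemma A_herm (hU : ∀ w, (R.lam w)ᴴ = R.lam w⁻¹) (h : H) : (R.A h)ᴴ = R.A h := by
  classical
  rw [A, conjTranspose_sum]
  refine Fintype.sum_equiv (Equiv.inv _) _ _ (fun w => ?_)
  simp [hU]

lemma N_herm (hU : ∀ w, (R.lam w)ᴴ = R.lam w⁻¹) : (R.N)ᴴ = R.N := by
  rw [N, conjTranspose_sum]
  exact Finset.sum_congr rfl fun h _ => R.A_herm hU h

lemma e_herm (hU : ∀ w, (R.lam w)ᴴ = R.lam w⁻¹) (n : ℕ) : (R.e K n)ᴴ = R.e K n := by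
  have h0 : ∀ m n : ℕ, m ≠ n → R.e K m * (R.e K n)ᴴ = 0 := by
    intro m n hmn
    have h1 : R.N * (R.e K n)ᴴ = (n : ℂ) • (R.e K n)ᴴ := by
      have := congrArg conjTranspose (R.e_N (K := K) n)
      rw [conjTranspose_mul, N_herm R hU, conjTranspose_smul] at this
      simpa using this
    have h2 : R.e K m * (R.N * (R.e K n)ᴴ) = R.e K m * R.N * (R.e K n)ᴴ := by rw [mul_assoc]
    rw [h1, e_N, mul_smul_comm, smul_mul_assoc, ← sub_eq_zero, ← sub_smul] at h2
    exact (smul_eq_zero.mp h2).resolve_left (by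
      rw [sub_eq_zero]; intro h; exact hmn (by exact_mod_cast h.symm))
  by_cases hn : n < R.D K
  · have h1 : (R.e K n)ᴴ = R.e K n * (R.e K n)ᴴ := by
      have : (R.e K n)ᴴ = ∑ m ∈ Finset.range (R.D K), R.e K m * (R.e K n)ᴴ := by
        rw [← Finset.sum_mul, sum_e, one_mul]
      refine this.trans ?_
      rw [Finset.sum_eq_single n]
      · intro m _ hm; exact h0 _ _ hm
      · intro h; exact absurd (Finset.mem_range.mpr hn) h
    have h2 := congrArg conjTranspose h1
    rw [conjTranspose_mul, conjTranspose_conjTranspose] at h2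
    rw [h1, ← h2]
  · rw [R.e_big (not_lt.mp hn), conjTranspose_zero]

lemma e_rho (n : ℕ) (w : W) : R.rho K w * R.e K n = R.e K n * R.rho K w :=
  R.e_comm (R.rho_N w) n

lemma comm_low (T : Matrix κ κ ℂ) (hT : ∀ w, R.rho K w * T = T * R.rho K w) {m n : ℕ} (hmn : m < n) :
    R.e K m * T * R.e K n = 0 := by
  apply R.end_neg (K := K) _ _ ((m : ℤ) - n) (by omega)
  · rw [← mul_assoc, ← mul_assoc, N_e, mul_assoc _ (R.e K n), e_N]
    push_cast
    rw [smul_mul_assoc, smul_mul_assoc, mul_smul_comm, sub_smul]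
  · intro w
    rw [← mul_assoc, ← mul_assoc, e_rho, mul_assoc _ (R.rho K w), hT, mul_assoc, mul_assoc,
      mul_assoc, e_rho]
    simp only [mul_assoc]

lemma Hf_N (hU : ∀ w, (R.lam w)ᴴ = R.lam w⁻¹) : R.Hf K * R.N = R.N * R.Hf K := by
  rw [Hf, Finset.sum_mul, Finset.mul_sum]
  refine Finset.sum_congr rfl fun w _ => ?_
  have := congrArg conjTranspose (R.rho_N (K := K) w)
  rw [conjTranspose_mul, conjTranspose_mul, N_herm R hU] at this
  rw [← mul_assoc, this, mul_assoc, mul_assoc, rho_N]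

lemma comm_N (hU : ∀ w, (R.lam w)ᴴ = R.lam w⁻¹)
    (T : Matrix κ κ ℂ) (hT : ∀ w, R.rho K w * T = T * R.rho K w) : R.N * T = T * R.N := by
  obtain ⟨Hi, h1⟩ := R.Hf_unit (K := K)
  have hHi : R.Hf K * (↑Hi⁻¹ : Matrix κ κ ℂ) = 1 := by rw [← h1]; exact Hi.mul_inv
  have hHi' : (↑Hi⁻¹ : Matrix κ κ ℂ) * R.Hf K = 1 := by rw [← h1]; exact Hi.inv_mul
  set J := (↑Hi⁻¹ : Matrix κ κ ℂ) with hJ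
  have hstar : ∀ w, R.rho K w * (J * Tᴴ * R.Hf K) = (J * Tᴴ * R.Hf K) * R.rho K w := by
    intro w
    have e1 : R.rho K w * J = J * (R.rho K w⁻¹)ᴴ := by
      have := congrArg (fun F => J * F * J) (R.Hf_rho (K := K) w)
      simp only [mul_assoc, hHi, mul_one] at this
      rw [← mul_assoc, hHi', one_mul] at this
      exact this
    have e2 := congrArg conjTranspose (hT w⁻¹)
    rw [conjTranspose_mul, conjTranspose_mul] at e2
    rw [mul_assoc _ _ (R.rho K w), Hf_rho, ← mul_assoc, ← mul_assoc, e1, mul_assoc J, ← e2]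
    simp only [mul_assoc]
  have hz : ∀ m n : ℕ, m ≠ n → R.e K m * T * R.e K n = 0 := by
    intro m n hmn
    rcases lt_or_gt_of_ne hmn with h | h
    · exact R.comm_low T hT h
    · have e1 := R.comm_low (K := K) _ hstar h
      have e3 : R.Hf K * R.e K m = R.e K m * R.Hf K := R.e_comm (R.Hf_N hU) m
      have e4 : R.Hf K * R.e K n = R.e K n * R.Hf K := R.e_comm (R.Hf_N hU) n
      have e2 : R.e K n * Tᴴ * R.e K m = 0 := by
        have := congrArg (fun F => R.Hf K * F * J) e1
        simp only [mul_zero, zero_mul] at this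
        rw [← this]
        simp only [← mul_assoc]
        rw [e4, mul_assoc _ (R.Hf K) J, hHi, mul_one]
        simp only [mul_assoc]
        rw [← mul_assoc (R.Hf K) (R.e K m), e3, mul_assoc _ _ J, hHi, mul_one]
      have := congrArg conjTranspose e2
      rw [conjTranspose_mul, conjTranspose_mul, conjTranspose_conjTranspose, e_herm R hU,
        e_herm R hU, conjTranspose_zero, ← mul_assoc] at this
      exact this
  have hsum : T = ∑ n ∈ Finset.range (R.D K), R.e K n * T * R.e K n := by
    have h2 : T = ∑ m ∈ Finset.range (R.D K), ∑ n ∈ Finset.range (R.D K), R.e K m * T * R.e K n := by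
      simp only [← Finset.mul_sum, sum_e, mul_one, ← Finset.sum_mul, one_mul]
    refine h2.trans (Finset.sum_congr rfl fun m hm => ?_)
    rw [Finset.sum_eq_single m]
    · intro n _ hn; exact hz _ _ hn.symm
    · intro h; exact absurd hm h
  rw [hsum, Finset.mul_sum, Finset.sum_mul]
  refine Finset.sum_congr rfl fun n _ => ?_
  rw [mul_assoc _ _ R.N, e_N, ← mul_assoc, ← mul_assoc, N_e, smul_mul_assoc, smul_mul_assoc, mul_smul_comm]

/-- The commutant of the monodromy is contained in the commutant of `lam`. -/
lemma comm_sub (hU : ∀ w, (R.lam w)ᴴ = R.lam w⁻¹)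
    (T : Matrix κ κ ℂ) (hT : ∀ w, R.rho K w * T = T * R.rho K w) (w : W) :
    T * R.lam w = R.lam w * T := R.end_zero T hT (R.comm_N hU T hT) w
end U
end K2
end Arr
end KZ

namespace KZ
open MvPolynomial Matrix

section Gen
open scoped ComplexOrder MatrixOrder

/-- a matrix self-adjoint for a positive form whose square has trace zero vanishes -/
lemma selfadj_zero {κ : Type*} [Fintype κ] [DecidableEq κ] (P Z : Matrix κ κ ℂ) (hP : P.PosDef)
    (h : P * Z = Zᴴ * P) (ht : (Z * Z).trace = 0) : Z = 0 := by
  obtain ⟨C, hC⟩ := CStarAlgebra.nonneg_iff_eq_star_mul_self.mp hP.posSemidef.nonneg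
  rw [Matrix.star_eq_conjTranspose] at hC
  have hu : IsUnit C := isUnit_of_mul_isUnit_right (hC ▸ hP.isUnit : IsUnit (Cᴴ * C))
  obtain ⟨c, rfl⟩ := hu
  have h1 : (c : Matrix κ κ ℂ) * (↑c⁻¹ : Matrix κ κ ℂ) = 1 := c.mul_inv
  have h2 : (↑c⁻¹ : Matrix κ κ ℂ) * (c : Matrix κ κ ℂ) = 1 := c.inv_mul
  set D := (↑c⁻¹ : Matrix κ κ ℂ)
  set E := (c : Matrix κ κ ℂ)
  have h3 : Dᴴ * Eᴴ = 1 := by rw [← conjTranspose_mul, h1, conjTranspose_one]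
  have h4 : E * Z * D = (E * Z * D)ᴴ := by
    have := congrArg (fun F => Dᴴ * F * D) h
    simp only [hC] at this
    rw [conjTranspose_mul, conjTranspose_mul]
    calc E * Z * D = (Dᴴ * Eᴴ) * (E * Z * D) := by rw [h3, one_mul]
      _ = Dᴴ * (Eᴴ * E * Z) * D := by simp only [mul_assoc]
      _ = Dᴴ * (Zᴴ * (Eᴴ * E)) * D := this
      _ = Dᴴ * (Zᴴ * Eᴴ) * (E * D) := by simp only [mul_assoc]
      _ = _ := by rw [h1, mul_one]
  have h5 : ((E * Z * D)ᴴ * (E * Z * D)).trace = 0 := by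
    rw [← h4]
    have : E * Z * D * (E * Z * D) = E * (Z * Z * D) := by
      calc E * Z * D * (E * Z * D) = E * Z * (D * E) * Z * D := by simp only [mul_assoc]
        _ = _ := by rw [h2, mul_one]; simp only [mul_assoc]
    rw [this, trace_mul_comm, mul_assoc, h2, mul_one, ht]
  rw [Matrix.trace_conjTranspose_mul_self_eq_zero_iff] at h5
  calc Z = D * E * Z * (D * E) := by rw [h2, one_mul, mul_one]
    _ = D * (E * Z * D) * E := by simp only [mul_assoc]
    _ = 0 := by rw [h5, mul_zero, zero_mul]

lemma char_norm {W κ : Type*} [Group W] [Fintype W] [Fintype κ] [DecidableEq κ]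
    (P : W →* Matrix κ κ ℂ) (x₀ : κ → ℂ)
    (hx : ∀ T : Matrix κ κ ℂ, (∀ w, P w * T = T * P w) → T *ᵥ x₀ = 0 → T = 0) :
    ∃ m : ℕ, m ≤ Fintype.card κ ∧
      ∑ w, (P w).trace * (P w⁻¹).trace = (Fintype.card W : ℂ) * m := by
  let ρ : Representation ℂ W (κ → ℂ) := (Matrix.toLinAlgEquiv' (R := ℂ) (n := κ)).toAlgHom.toRingHom.toMonoidHom.comp P
  have hρ : ∀ w, ρ w = Matrix.toLin' (P w) := fun w => rfl
  have hch : ∀ w, ρ.character w = (P w).trace := by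
    intro w
    show LinearMap.trace ℂ (κ → ℂ) (ρ w) = _
    rw [hρ, Matrix.trace_toLin'_eq]
  haveI : Invertible (Nat.card W : ℂ) := invertibleOfNonzero (by
    rw [Nat.card_eq_fintype_card]; exact_mod_cast Fintype.card_ne_zero)
  have h1 := Representation.card_inv_mul_sum_char_mul_char_eq_finrank ρ ρ
  refine ⟨Module.finrank ℂ (Representation.IntertwiningMap ρ ρ), ?_, ?_⟩
  · let E : Representation.IntertwiningMap ρ ρ →ₗ[ℂ] (κ → ℂ) :=
      { toFun := fun f => f x₀
        map_add' := fun f g => rfl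
        map_smul' := fun c f => rfl }
    have hE : Function.Injective E := by
      rw [← LinearMap.ker_eq_bot, LinearMap.ker_eq_bot']
      intro f hf
      apply Representation.IntertwiningMap.ext
      have : LinearMap.toMatrix' f.toLinearMap = 0 := by
        apply hx
        · intro w
          apply Matrix.toLin'.injective
          rw [Matrix.toLin'_mul, Matrix.toLin'_mul, Matrix.toLin'_toMatrix', ← hρ]
          exact LinearMap.ext fun u =>
            (Representation.IntertwiningMap.isIntertwining ρ ρ f w u).symm
        · rw [← Matrix.toLin'_apply, Matrix.toLin'_toMatrix']
          exact hf
      have h := congrArg Matrix.toLin' this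
      rw [Matrix.toLin'_toMatrix'] at h
      rw [h, map_zero]; rfl
    have := LinearMap.finrank_le_finrank_of_injective hE
    rwa [Module.finrank_fintype_fun_eq_card] at this
  · rw [← h1]
    simp only [hch, Nat.card_eq_fintype_card]
    rw [mul_inv_cancel_left₀]
    exact_mod_cast Fintype.card_ne_zero
end Gen

namespace Arr
variable {W ι κ H : Type*} [Group W] [Fintype W] [Fintype ι] [DecidableEq ι]
    [Fintype κ] [DecidableEq κ] [Fintype H] [DecidableEq H] [MulAction W H] (R : Arr W ι κ H)
section K2
variable {K : Type*} [Field K] [Algebra (MvPolynomial ι ℂ) K] [IsFractionRing (MvPolynomial ι ℂ) K]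
  [Algebra ℂ K] [IsScalarTower ℂ (MvPolynomial ι ℂ) K]
open scoped ComplexOrder

variable (K) in
/-- the arrangement with the monodromy representation -/
def Rr : Arr W ι κ H := { R with lam := R.rho K }

lemma Rr_A (h : H) : (R.Rr K).A h = (by classical exact ∑ w : R.S h, (1 - R.rho K w)) := rfl

lemma Rr_A_tr (h : H) (T : Matrix κ κ ℂ) (hT : ∀ w, T * R.lam w = R.lam w * T) :
    ((R.Rr K).A h * T).trace = (R.A h * T).trace := by
  classical
  rw [Rr_A, A, Finset.sum_mul, Finset.sum_mul, trace_sum, trace_sum]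
  refine Finset.sum_congr rfl fun w _ => ?_
  rw [sub_mul, sub_mul, trace_sub, trace_sub, R.trace_local (K := K) h w T hT]

lemma Rr_N (hU : ∀ w, (R.lam w)ᴴ = R.lam w⁻¹) : (R.Rr K).N = R.N := by
  classical
  rw [← sub_eq_zero]
  have hc : ∀ w, R.rho K w * ((R.Rr K).N - R.N) = ((R.Rr K).N - R.N) * R.rho K w := by
    intro w
    rw [mul_sub, sub_mul, rho_N]
    congr 1
    exact (R.Rr K).lam_N w
  have hc2 := R.comm_sub hU _ hc
  apply selfadj_zero (R.Hf K) _ R.Hf_pos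
  · rw [mul_sub, conjTranspose_sub, sub_mul, N_herm R hU, Hf_N R hU]
    congr 1
    rw [N, conjTranspose_sum, Finset.mul_sum, Finset.sum_mul]
    refine Finset.sum_congr rfl fun h _ => ?_
    rw [Rr_A, conjTranspose_sum, Finset.mul_sum, Finset.sum_mul]
    refine Fintype.sum_equiv (Equiv.inv _) _ _ (fun w => ?_)
    rw [mul_sub, Hf_rho, conjTranspose_sub, sub_mul]
    simp
  · rw [sub_mul, trace_sub, sub_eq_zero, N, N, Finset.sum_mul, Finset.sum_mul, trace_sum, trace_sum]
    exact Finset.sum_congr rfl fun h _ => R.Rr_A_tr h _ hc2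

lemma rho_tr_conj (w : W) : (R.rho K w⁻¹).trace = star (R.rho K w).trace := by
  obtain ⟨Hi, h1⟩ := R.Hf_unit (K := K)
  have hHi : R.Hf K * (↑Hi⁻¹ : Matrix κ κ ℂ) = 1 := by rw [← h1]; exact Hi.mul_inv
  have hHi' : (↑Hi⁻¹ : Matrix κ κ ℂ) * R.Hf K = 1 := by rw [← h1]; exact Hi.inv_mul
  have h2 := R.Hf_rho (K := K) w⁻¹
  rw [inv_inv] at h2
  rw [← trace_conjTranspose]
  have h3 : R.rho K w⁻¹ = (↑Hi⁻¹ : Matrix κ κ ℂ) * ((R.rho K w)ᴴ * R.Hf K) := by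
    rw [← h2, ← mul_assoc, hHi', one_mul]
  rw [h3, trace_mul_comm, mul_assoc, hHi, mul_one]
end K2
end Arr

section Reg
variable {W ι H : Type*} [Group W] [Fintype W] [DecidableEq W] [Fintype ι] [DecidableEq ι]
    [Fintype H] [DecidableEq H] [MulAction W H] (R : Arr W ι W H)

/-- left regular representation -/
def regM (w : W) : Matrix W W ℂ := Matrix.of fun i j => if i = w * j then 1 else 0

lemma regM_apply (w i j : W) : regM w i j = if i = w * j then 1 else 0 := rfl

/-- left regular representation as a homomorphism -/
def reg : W →* Matrix W W ℂ where
  toFun := regM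
  map_one' := by
    ext i j
    simp [regM_apply, Matrix.one_apply]
  map_mul' x y := by
    ext i j
    simp [regM_apply, Matrix.mul_apply, mul_assoc]

lemma reg_apply (w i j : W) : reg w i j = if i = w * j then 1 else 0 := rfl

lemma reg_single (w u : W) : reg w *ᵥ Pi.single u 1 = Pi.single (w * u) 1 := by
  ext i
  simp [reg_apply, Pi.single_apply]

lemma reg_trace (w : W) : (reg w).trace = if w = 1 then (Fintype.card W : ℂ) else 0 := by
  simp only [Matrix.trace, Matrix.diag, reg_apply]
  split_ifs with h
  · subst h; simp
  · apply Finset.sum_eq_zero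
    intro i _
    rw [if_neg]
    intro h2
    exact h (by simpa using h2)

lemma reg_unitary (w : W) : (reg w)ᴴ = reg w⁻¹ := by
  ext i j
  simp only [conjTranspose_apply, reg_apply]
  by_cases h : j = w * i
  · subst h; simp
  · rw [if_neg h, if_neg]
    · simp
    · rintro rfl; simp at h

namespace Arr
variable {K : Type*} [Field K] [Algebra (MvPolynomial ι ℂ) K] [IsFractionRing (MvPolynomial ι ℂ) K]
  [Algebra ℂ K] [IsScalarTower ℂ (MvPolynomial ι ℂ) K]

lemma lam_unitary (hL : R.lam = reg) (w : W) : (R.lam w)ᴴ = R.lam w⁻¹ := by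
  rw [hL]; exact reg_unitary w

lemma tr_rho (hL : R.lam = reg) (w : W) : (R.rho K w).trace = (R.lam w).trace := by
  have hU := R.lam_unitary hL
  obtain ⟨m, hm, hs⟩ := char_norm (R.rho K) (Pi.single 1 1) (by
    intro T hT h0
    have h1 := R.comm_sub hU T hT
    have h2 : ∀ u, T *ᵥ Pi.single u 1 = 0 := by
      intro u
      have h3 : Pi.single u (1 : ℂ) = R.lam u *ᵥ Pi.single 1 1 := by
        rw [hL, reg_single, mul_one]
      rw [h3, mulVec_mulVec, h1, ← mulVec_mulVec, h0, mulVec_zero]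
    ext i u
    have := congrFun (h2 u) i
    simpa using this)
  have hone : (R.rho K 1).trace = (Fintype.card W : ℂ) := by
    rw [map_one, trace_one]
  have hs2 : ∑ w, Complex.normSq ((R.rho K w).trace) = (Fintype.card W : ℝ) * m := by
    have : ((∑ w, Complex.normSq ((R.rho K w).trace) : ℝ) : ℂ) = (Fintype.card W : ℂ) * m := by
      rw [← hs]; push_cast
      refine Finset.sum_congr rfl fun w _ => ?_
      rw [rho_tr_conj, ← Complex.mul_conj]; rfl
    exact_mod_cast this
  have hle : ∑ w, Complex.normSq ((R.rho K w).trace) ≤ (Fintype.card W : ℝ) * Fintype.card W := by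
    rw [hs2]
    gcongr
  rw [← Finset.add_sum_erase _ _ (Finset.mem_univ (1 : W)), hone, Complex.normSq_natCast] at hle
  have h0 : ∑ w ∈ Finset.univ.erase (1 : W), Complex.normSq ((R.rho K w).trace) = 0 :=
    le_antisymm (by linarith) (Finset.sum_nonneg fun w _ => Complex.normSq_nonneg _)
  rw [Finset.sum_eq_zero_iff_of_nonneg (fun w _ => Complex.normSq_nonneg _)] at h0
  rw [hL, reg_trace]
  split_ifs with hw
  · rw [hw, hone]
  · exact Complex.normSq_eq_zero.mp (h0 w (Finset.mem_erase.mpr ⟨hw, Finset.mem_univ _⟩))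

lemma tr_rho_N (hL : R.lam = reg) (l : ℕ) : ∀ w : W,
    (R.rho K w * R.N ^ l).trace = (R.lam w * R.N ^ l).trace := by
  classical
  have hU := R.lam_unitary hL
  induction l with
  | zero => intro w; simpa using R.tr_rho hL w
  | succ l ih =>
    intro w
    have h1 : R.rho K w * R.N ^ (l + 1) = (R.Rr K).N * R.rho K w * R.N ^ l := by
      rw [Rr_N R hU, ← rho_N, pow_succ', mul_assoc]
    have h2 : R.lam w * R.N ^ (l + 1) = R.N * R.lam w * R.N ^ l := by
      rw [← lam_N, pow_succ', mul_assoc]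
    rw [h1, h2]
    generalize hX : R.N ^ l = X at ih ⊢
    rw [N, N]
    simp only [Finset.sum_mul, trace_sum]
    refine Finset.sum_congr rfl fun h _ => ?_
    rw [Rr_A, A]
    simp only [Finset.sum_mul, trace_sum]
    refine Finset.sum_congr rfl fun t _ => ?_
    rw [sub_mul, sub_mul, sub_mul, sub_mul, one_mul, one_mul, trace_sub, trace_sub, ← map_mul,
      ← map_mul, ih, ih]

/-- the spectral coefficients -/
def cc (K : Type*) [Field K] [Algebra (MvPolynomial ι ℂ) K] [IsFractionRing (MvPolynomial ι ℂ) K]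
  [Algebra ℂ K] [IsScalarTower ℂ (MvPolynomial ι ℂ) K] (g : W) (n : ℕ) : ℂ := (R.lam g⁻¹ * R.e K n).trace

lemma e_N_pow (n l : ℕ) : R.e K n * R.N ^ l = (n : ℂ) ^ l • R.e K n := by
  induction l with
  | zero => simp
  | succ l ih => rw [pow_succ, ← mul_assoc, ih, smul_mul_assoc, e_N, smul_smul, pow_succ]

lemma cc_zero (hL : R.lam = reg) (g : W) (ζ : ℂ) (hg : R.act g *ᵥ R.v = ζ • R.v) (n : ℕ)
    (hn : ζ ^ n ≠ 1) : R.cc K g n = 0 := by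
  have key : ∀ l : ℕ, ∑ n ∈ Finset.range (R.D K), (n : ℂ) ^ l * (ζ ^ n - 1) * R.cc K g n = 0 := by
    intro l
    have h := R.tr_rho_N (K := K) hL l g⁻¹
    rw [rho_eq, inv_inv, hg, ev_smul, mul_assoc, R.N_pow (K := K)] at h
    have h2 : (∑ n ∈ Finset.range (R.D K), ζ ^ n • R.e K n) *
        (∑ n ∈ Finset.range (R.D K), (n : ℂ) ^ l • R.e K n) =
        ∑ n ∈ Finset.range (R.D K), (ζ ^ n * (n : ℂ) ^ l) • R.e K n := by
      rw [← R.N_pow (K := K), Finset.sum_mul]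
      refine Finset.sum_congr rfl fun n _ => ?_
      rw [smul_mul_assoc, R.e_N_pow, smul_smul]
    rw [h2] at h
    simp only [Finset.mul_sum, trace_sum, mul_smul_comm, trace_smul] at h
    rw [← sub_eq_zero, ← Finset.sum_sub_distrib] at h
    rw [← h]
    refine Finset.sum_congr rfl fun n _ => ?_
    simp only [cc, smul_eq_mul]; ring
  by_cases hD : n < R.D K
  · have h1 := Matrix.eq_zero_of_forall_pow_sum_mul_pow_eq_zero
      (f := fun j : Fin (R.D K) => ((j : ℕ) : ℂ)) (v := fun j : Fin (R.D K) => (ζ ^ (j : ℕ) - 1) * R.cc K g j)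
      (fun i j hij => Fin.ext (Nat.cast_injective (R := ℂ) hij)) (by
        intro i
        have := key i
        rw [Finset.sum_range] at this
        rw [← this]
        refine Finset.sum_congr rfl fun n _ => ?_
        ring)
    have h2 := congrFun h1 ⟨n, hD⟩
    exact (mul_eq_zero.mp h2).resolve_left (by rw [sub_eq_zero]; exact hn)
  · rw [cc, R.e_big (not_lt.mp hD), mul_zero, trace_zero]
end Arr
end Reg
end KZ

namespace KZ
open MvPolynomial Matrix

lemma findiff (n : ℕ) (a b : ℂ) {l : ℕ} (hl : l < n) :
    ∑ k ∈ Finset.range (n + 1), (-1 : ℂ) ^ k * (n.choose k) * (a - k * b) ^ l = 0 := by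
  have h1 : ((Polynomial.C a - Polynomial.C b * Polynomial.X : Polynomial ℂ) ^ l).natDegree < n := by
    refine lt_of_le_of_lt (Polynomial.natDegree_pow_le) ?_
    have : (Polynomial.C a - Polynomial.C b * Polynomial.X : Polynomial ℂ).natDegree ≤ 1 := by
      compute_degree
    calc _ ≤ l * 1 := Nat.mul_le_mul_left _ this
      _ < n := by omega
  have h2 := congrFun (Polynomial.fwdDiff_iter_eq_zero_of_degree_lt h1) 0
  rw [fwdDiff_iter_eq_sum_shift] at h2
  have h3 := congrArg (fun z => (-1 : ℂ) ^ n * z) h2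
  simp only [Finset.mul_sum, Pi.zero_apply, mul_zero] at h3
  rw [← h3]
  refine Finset.sum_congr rfl fun k hk => ?_
  have hk' : k ≤ n := Nat.lt_succ_iff.mp (Finset.mem_range.mp hk)
  obtain ⟨m, rfl⟩ := Nat.exists_eq_add_of_le hk'
  have h4 : (-1 : ℂ) ^ (k + m) * (-1) ^ m = (-1) ^ k := by
    rw [pow_add, mul_assoc, ← pow_add, ← two_mul, pow_mul]; simp
  simp only [zsmul_eq_mul, Polynomial.eval_pow, Polynomial.eval_sub, Polynomial.eval_mul,
    Polynomial.eval_C, Polynomial.eval_X, zero_add, nsmul_eq_mul, mul_one, Nat.add_sub_cancel_left]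
  push_cast
  rw [← mul_assoc, ← mul_assoc, h4]
  ring

lemma coeffs_unique (n : ℕ) (r b : ℂ) (hb : b ≠ 0) (c : ℕ → ℂ) (h0 : c 0 = 1)
    (h : ∀ l < n, ∑ k ∈ Finset.range (n + 1), (r - k * b) ^ l * c k = 0) :
    ∀ k ≤ n, c k = (-1 : ℂ) ^ k * (n.choose k) := by
  have h1 := Matrix.eq_zero_of_forall_pow_sum_mul_pow_eq_zero
      (f := fun j : Fin n => r - ((j : ℕ) + 1 : ℕ) * b)
      (v := fun j : Fin n => c (j + 1) - (-1 : ℂ) ^ ((j : ℕ) + 1) * (n.choose (j + 1)))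
      (fun i j hij => by
        have h2 : (((i : ℕ) + 1 : ℕ) : ℂ) * b = (((j : ℕ) + 1 : ℕ) : ℂ) * b := by
          have := hij
          simp only at this
          exact sub_right_injective this
        have h3 := Nat.cast_injective (R := ℂ) (mul_right_cancel₀ hb h2)
        exact Fin.ext (by omega)) (by
      intro i
      have e1 := h i i.2
      have e2 := findiff n r b i.2
      rw [Finset.sum_range_succ', Finset.sum_range] at e1 e2
      simp only [h0] at e1
      have e3 : ∀ j : Fin n, (c (j + 1) - (-1 : ℂ) ^ ((j : ℕ) + 1) * (n.choose (j + 1))) *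
          (r - ((j : ℕ) + 1 : ℕ) * b) ^ (i : ℕ) = (r - ((j : ℕ) + 1 : ℕ) * b) ^ (i : ℕ) * c (j + 1) -
          (-1 : ℂ) ^ ((j : ℕ) + 1) * (n.choose (j + 1)) * (r - ((j : ℕ) + 1 : ℕ) * b) ^ (i : ℕ) := by
        intro j; ring
      simp only [e3, Finset.sum_sub_distrib]
      have e4 : (-1 : ℂ) ^ 0 * ((n.choose 0 : ℕ) : ℂ) = 1 := by simp
      rw [e4] at e2
      linear_combination e1 - e2)
  intro k hk
  rcases k with _ | k
  · simp [h0]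
  · have := congrFun h1 ⟨k, hk⟩
    exact sub_eq_zero.mp this

section Reg
variable {W ι H : Type*} [Group W] [Fintype W] [DecidableEq W] [Fintype ι] [DecidableEq ι]
    [Fintype H] [DecidableEq H] [MulAction W H] (R : Arr W ι W H)

lemma reg_pow (χ : W → ℂ) (l : ℕ) : (∑ t, χ t • reg t) ^ l =
    ∑ f : Fin l → W, (∏ i, χ (f i)) • reg (List.ofFn f).prod := by
  induction l with
  | zero => simp
  | succ l ih =>
    rw [pow_succ', ih, Finset.sum_mul]
    simp only [Finset.mul_sum]
    rw [← Fintype.sum_prod_type' (f := fun t (f : Fin l → W) =>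
      (χ t • reg t) * ((∏ i, χ (f i)) • reg (List.ofFn f).prod))]
    refine Fintype.sum_equiv (Fin.consEquiv (fun _ => W)) _ _ (fun p => ?_)
    rw [smul_mul_smul_comm, ← map_mul]
    simp [Fin.consEquiv, List.ofFn_succ, Fin.prod_univ_succ]

lemma fact_trace (S : Set W) (g : W) (l : ℕ) :
    (by classical exact (reg g⁻¹ * (∑ t, (if t ∈ S then (1 : ℂ) else 0) • reg t) ^ l).trace) =
    (Nat.card W : ℂ) * (Nat.card {f : Fin l → W // (∀ i, f i ∈ S) ∧ (List.ofFn f).prod = g} : ℂ) := by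
  classical
  rw [reg_pow, Finset.mul_sum, trace_sum]
  have h1 : ∀ f : Fin l → W, (reg g⁻¹ * ((∏ i, if f i ∈ S then (1 : ℂ) else 0) • reg (List.ofFn f).prod)).trace
      = if ((∀ i, f i ∈ S) ∧ (List.ofFn f).prod = g) then (Fintype.card W : ℂ) else 0 := by
    intro f
    rw [mul_smul_comm, ← map_mul, trace_smul, reg_trace, Finset.prod_boole]
    simp only [inv_mul_eq_one, Finset.mem_univ, forall_const, smul_eq_mul]
    by_cases h2 : ∀ i, f i ∈ S
    · by_cases h3 : (List.ofFn f).prod = g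
      · simp [h2, h3]
      · simp [h2, h3, Ne.symm h3]
    · simp [h2]
  simp only [h1]
  rw [Finset.sum_ite, Finset.sum_const_zero, add_zero, Finset.sum_const, nsmul_eq_mul,
    Nat.card_eq_fintype_card, Nat.card_eq_fintype_card, Fintype.card_subtype, mul_comm]

namespace Arr
open scoped Classical ComplexOrder

lemma sum_S {M : Type*} [AddCommMonoid M] (S : Set W)
    (hS : ∀ t, t ∈ S ↔ t ≠ 1 ∧ ∃ h, t ∈ R.S h)
    (huniq : ∀ t h k, t ≠ 1 → t ∈ R.S h → t ∈ R.S k → h = k) (f : W → M) (hf : f 1 = 0) :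
    ∑ h, ∑ w : R.S h, f w = ∑ t, if t ∈ S then f t else 0 := by
  have h1 : ∀ h, ∑ w : R.S h, f w = ∑ w, if w ∈ R.S h then f w else 0 := by
    intro h
    rw [← Finset.sum_filter]
    exact (Finset.sum_subtype _ (by simp) f).symm
  simp only [h1]
  rw [Finset.sum_comm]
  refine Finset.sum_congr rfl fun t _ => ?_
  by_cases ht : t = 1
  · simp [ht, hf]
  by_cases hS' : t ∈ S
  · obtain ⟨-, h, hh⟩ := (hS t).mp hS'
    rw [if_pos hS', Finset.sum_eq_single h]
    · rw [if_pos hh]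
    · intro k _ hk
      rw [if_neg]
      intro hk2
      exact hk (huniq t k h ht hk2 hh)
    · simp
  · rw [if_neg hS']
    apply Finset.sum_eq_zero
    intro h _
    rw [if_neg]
    intro hh
    exact hS' ((hS t).mpr ⟨ht, h, hh⟩)

lemma N_eq_S (hL : R.lam = reg) (S : Set W)
    (hS : ∀ t, t ∈ S ↔ t ≠ 1 ∧ ∃ h, t ∈ R.S h)
    (huniq : ∀ t h k, t ≠ 1 → t ∈ R.S h → t ∈ R.S k → h = k) :
    (∑ t, (if t ∈ S then (1 : ℂ) else 0) • reg t) = (S.ncard : ℂ) • 1 - R.N := by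
  have h1 : R.N = ∑ t, if t ∈ S then (1 - reg t : Matrix W W ℂ) else 0 := by
    rw [← R.sum_S S hS huniq (fun w => 1 - reg w) (by simp), N]
    refine Finset.sum_congr rfl fun h _ => ?_
    rw [A, hL]
  have h2 : (S.ncard : ℂ) • (1 : Matrix W W ℂ) = ∑ t, if t ∈ S then (1 : Matrix W W ℂ) else 0 := by
    rw [← Finset.sum_filter, Finset.sum_const, Set.ncard_eq_toFinset_card', ← Nat.cast_smul_eq_nsmul ℂ]
    congr 3
    ext; simp
  rw [h1, h2, ← Finset.sum_sub_distrib]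
  refine Finset.sum_congr rfl fun t _ => ?_
  split_ifs <;> simp

lemma sum_card_S (S : Set W)
    (hS : ∀ t, t ∈ S ↔ t ≠ 1 ∧ ∃ h, t ∈ R.S h)
    (huniq : ∀ t h k, t ≠ 1 → t ∈ R.S h → t ∈ R.S k → h = k) :
    ∑ h, Fintype.card (R.S h) = S.ncard + Fintype.card H := by
  have h1 := R.sum_S S hS huniq (fun w => if w = 1 then 0 else 1) (by simp)
  have h2 : ∀ h, Fintype.card (R.S h) = (∑ w : R.S h, if (w : W) = 1 then 0 else 1) + 1 := by
    intro h
    have : ∀ w : R.S h, (if (w : W) = 1 then 0 else 1) + (if w = 1 then 1 else 0) = 1 := by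
      intro w
      by_cases hw : w = 1
      · simp [hw]
      · have : (w : W) ≠ 1 := fun h => hw (Subtype.ext h)
        simp [hw, this]
    have h3 := Finset.sum_congr (s₁ := (Finset.univ : Finset (R.S h))) rfl (fun w _ => this w)
    rw [Finset.sum_add_distrib] at h3
    simp only [Finset.sum_ite_eq', Finset.mem_univ, if_true, Finset.sum_const, Finset.card_univ,
      smul_eq_mul, mul_one] at h3
    exact h3.symm
  simp only [h2, Finset.sum_add_distrib, h1]
  simp only [Finset.sum_const, Finset.card_univ, smul_eq_mul, mul_one, Nat.add_right_cancel_iff]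
  rw [Set.ncard_eq_toFinset_card']
  rw [← Finset.sum_filter]
  rw [Finset.sum_congr rfl (g := fun _ => 1), Finset.sum_const, smul_eq_mul, mul_one]
  · congr 1; ext; simp
  · intro x hx
    rw [if_neg ((hS x).mp (Finset.mem_filter.mp hx).2).1]

section PSD
variable (hU : ∀ w, (R.lam w)ᴴ = R.lam w⁻¹)

lemma sS_herm (hU : ∀ w, (R.lam w)ᴴ = R.lam w⁻¹) (h : H) : (R.sS h)ᴴ = R.sS h := by
  rw [sS, conjTranspose_sum]
  refine Fintype.sum_equiv (Equiv.inv _) _ _ (fun w => ?_)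
  simp [hU]

lemma card_pos (h : H) : 0 < (Fintype.card (R.S h) : ℂ) := by
  exact_mod_cast Fintype.card_pos

lemma psd_tr {M : Matrix W W ℂ} {c : ℂ} (hc : 0 < c) (hM : Mᴴ = M) (hMM : M * M = c • M)
    (T : Matrix W W ℂ) : c * (Tᴴ * (M * T)).trace = ((M * T)ᴴ * (M * T)).trace := by
  rw [conjTranspose_mul, hM, mul_assoc, ← mul_assoc M M T, hMM, smul_mul_assoc, mul_smul_comm,
    trace_smul, smul_eq_mul]

lemma psd_tr_nonneg {M : Matrix W W ℂ} {c : ℂ} (hc : 0 < c) (hM : Mᴴ = M) (hMM : M * M = c • M)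
    (T : Matrix W W ℂ) : 0 ≤ (Tᴴ * (M * T)).trace := by
  have h1 := (Matrix.posSemidef_conjTranspose_mul_self (M * T)).trace_nonneg
  rw [← psd_tr hc hM hMM] at h1
  exact le_of_mul_le_mul_left (by rwa [mul_zero]) hc

lemma psd_tr_zero {M : Matrix W W ℂ} {c : ℂ} (hc : 0 < c) (hM : Mᴴ = M) (hMM : M * M = c • M)
    (T : Matrix W W ℂ) (h : (Tᴴ * (M * T)).trace = 0) : M * T = 0 := by
  have h1 := psd_tr hc hM hMM T
  rw [h, mul_zero] at h1
  exact Matrix.trace_conjTranspose_mul_self_eq_zero_iff.mp h1.symm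

variable {K : Type*} [Field K] [Algebra (MvPolynomial ι ℂ) K] [IsFractionRing (MvPolynomial ι ℂ) K]
  [Algebra ℂ K] [IsScalarTower ℂ (MvPolynomial ι ℂ) K]

lemma e_zero_of_lt (hU : ∀ w, (R.lam w)ᴴ = R.lam w⁻¹) (n : ℕ)
    (hn : ∑ h, Fintype.card (R.S h) < n) : R.e K n = 0 := by
  by_contra hne
  set T := R.e K n with hT
  have hpos : 0 < (Tᴴ * T).trace := by
    refine lt_of_le_of_ne (Matrix.posSemidef_conjTranspose_mul_self T).trace_nonneg ?_
    intro h
    exact hne (Matrix.trace_conjTranspose_mul_self_eq_zero_iff.mp h.symm)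
  have h1 : (Tᴴ * (R.N * T)).trace = n * (Tᴴ * T).trace := by
    rw [hT, N_e, mul_smul_comm, trace_smul, smul_eq_mul]
  have h2 : (Tᴴ * (R.N * T)).trace = (∑ h, Fintype.card (R.S h) : ℕ) * (Tᴴ * T).trace -
      ∑ h, (Tᴴ * (R.sS h * T)).trace := by
    rw [N, Finset.sum_mul, Finset.mul_sum, trace_sum]
    push_cast
    rw [Finset.sum_mul, ← Finset.sum_sub_distrib]
    refine Finset.sum_congr rfl fun h _ => ?_
    rw [A_eq, sub_mul, mul_sub, trace_sub, smul_mul_assoc, mul_smul_comm, trace_smul, one_mul, smul_eq_mul]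
  have h3 : 0 ≤ ∑ h, (Tᴴ * (R.sS h * T)).trace := Finset.sum_nonneg fun h _ =>
    psd_tr_nonneg (R.card_pos h) (R.sS_herm hU h) (R.sS_sS h) T
  rw [h1] at h2
  have h4 : (n : ℂ) * (Tᴴ * T).trace ≤ (∑ h, Fintype.card (R.S h) : ℕ) * (Tᴴ * T).trace := by
    rw [h2]; exact sub_le_self _ h3
  have h5 : (n : ℂ) ≤ ((∑ h, Fintype.card (R.S h) : ℕ) : ℂ) := le_of_mul_le_mul_right h4 hpos
  have h6 : n ≤ ∑ h, Fintype.card (R.S h) := by exact_mod_cast h5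
  omega

lemma lam_e_zero (hU : ∀ w, (R.lam w)ᴴ = R.lam w⁻¹) (hgen : ⨆ h, R.S h = ⊤) (w : W) :
    R.lam w * R.e K 0 = R.e K 0 := by
  have h0 : R.N * R.e K 0 = 0 := by rw [N_e]; simp
  have hA : ∀ h, R.A h * R.e K 0 = 0 := by
    have h1 : ∑ h, ((R.e K 0)ᴴ * (R.A h * R.e K 0)).trace = 0 := by
      rw [← trace_sum, ← Finset.mul_sum, ← Finset.sum_mul]
      have : (∑ h, R.A h) = R.N := rfl
      rw [this, h0, mul_zero, trace_zero]
    rw [Finset.sum_eq_zero_iff_of_nonneg (fun h _ =>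
      psd_tr_nonneg (R.card_pos h) (R.A_herm hU h) (R.A_A h) _)] at h1
    intro h
    exact psd_tr_zero (R.card_pos h) (R.A_herm hU h) (R.A_A h) _ (h1 h (Finset.mem_univ _))
  have hS : ∀ h, ∀ t : R.S h, R.lam t * R.e K 0 = R.e K 0 := by
    intro h t
    have h2 := hA h
    rw [A_eq, sub_mul, sub_eq_zero, smul_mul_assoc, one_mul] at h2
    have h3 := congrArg (fun F => R.lam t * F) h2
    simp only [mul_smul_comm, ← mul_assoc, lam_sS] at h3
    rw [← h2] at h3
    exact smul_right_injective _ (R.card_pos h).ne' h3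
  let G : Subgroup W :=
    { carrier := {w | R.lam w * R.e K 0 = R.e K 0}
      one_mem' := by simp
      mul_mem' := by
        intro a b ha hb
        simp only [Set.mem_setOf_eq] at *
        rw [map_mul, mul_assoc, hb, ha]
      inv_mem' := by
        intro a ha
        simp only [Set.mem_setOf_eq] at *
        conv_lhs => rw [← ha, ← mul_assoc, ← map_mul, inv_mul_cancel, map_one, one_mul] }
  have hG : (⨆ h, R.S h) ≤ G := iSup_le fun h t ht => hS h ⟨t, ht⟩
  rw [hgen] at hG
  exact hG (Subgroup.mem_top w)

lemma cc_at_zero (hL : R.lam = reg) (hgen : ⨆ h, R.S h = ⊤) (g : W) : R.cc K g 0 = 1 := by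
  have hU := R.lam_unitary hL
  have he := R.lam_e_zero (K := K) hU hgen
  rw [cc, he]
  set J : Matrix W W ℂ := ∑ w, R.lam w with hJ
  have hJN : R.N * J = 0 := by
    have h1 : ∀ w, R.lam w * J = J := by
      intro w
      rw [hJ, Finset.mul_sum]
      exact Fintype.sum_equiv (Equiv.mulLeft w) _ _ (fun x => by simp)
    rw [N, Finset.sum_mul]
    apply Finset.sum_eq_zero
    intro h _
    rw [A, Finset.sum_mul]
    apply Finset.sum_eq_zero
    intro w _
    rw [sub_mul, one_mul, h1, sub_self]
  have h2 : R.e K 0 * J = J := by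
    have h3 : J = ∑ n ∈ Finset.range (R.D K), R.e K n * J := by
      rw [← Finset.sum_mul, sum_e, one_mul]
    rw [Finset.sum_eq_single 0] at h3
    · exact h3.symm
    · intro n _ hn
      have : R.e K n * (R.N * J) = (n : ℂ) • (R.e K n * J) := by
        rw [← mul_assoc, e_N, smul_mul_assoc]
      rw [hJN, mul_zero] at this
      exact (smul_eq_zero.mp this.symm).resolve_left (by exact_mod_cast hn)
    · intro h
      rw [R.e_big (by simpa using h), zero_mul]
  have h4 : J.trace = (Fintype.card W : ℂ) * (R.e K 0).trace := by
    rw [← h2, trace_mul_comm, hJ, Finset.sum_mul, trace_sum]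
    simp [he]
  have h5 : J.trace = (Fintype.card W : ℂ) := by
    rw [hJ, trace_sum, hL]
    simp [reg_trace]
  rw [h5] at h4
  have h6 : (Fintype.card W : ℂ) ≠ 0 := by exact_mod_cast Fintype.card_ne_zero
  exact (mul_left_cancel₀ h6 (by rw [← h4, mul_one])).symm

/-- The main count at the level of arrangements. -/
theorem main (hL : R.lam = reg) (hgen : ⨆ h, R.S h = ⊤) (S : Set W)
    (hS : ∀ t, t ∈ S ↔ t ≠ 1 ∧ ∃ h, t ∈ R.S h)
    (huniq : ∀ t h k, t ≠ 1 → t ∈ R.S h → t ∈ R.S k → h = k)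
    (g : W) (d : ℕ) (hd : 0 < d) (ζ : ℂ) (hζ : IsPrimitiveRoot ζ d) (hg : R.act g *ᵥ R.v = ζ • R.v)
    (lg : ℕ) (hdl : d * lg = S.ncard + Fintype.card H)
    (hmin : ∀ l < lg, ∀ f : Fin l → W, ¬ ((∀ i, f i ∈ S) ∧ (List.ofFn f).prod = g)) (l : ℕ) :
    (Nat.card W * Nat.card {f : Fin l → W // (∀ i, f i ∈ S) ∧ (List.ofFn f).prod = g} : ℤ) =
      ∑ k ∈ Finset.range (lg + 1), (-1 : ℤ) ^ k * (lg.choose k) * ((S.ncard : ℤ) - k * d) ^ l := by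
  let K := FractionRing (MvPolynomial ι ℂ)
  have hU := R.lam_unitary hL
  have hpow : ∀ n l : ℕ, ((S.ncard : ℂ) • 1 - R.N) ^ l * R.e K n = ((S.ncard : ℂ) - n) ^ l • R.e K n := by
    intro n l
    induction l with
    | zero => simp
    | succ l ih =>
      rw [pow_succ, mul_assoc, sub_mul, smul_mul_assoc, one_mul, N_e, ← sub_smul, mul_smul_comm, ih,
        smul_smul, pow_succ, mul_comm]
  have hfact : ∀ l, (Nat.card W : ℂ) * (Nat.card {f : Fin l → W // (∀ i, f i ∈ S) ∧ (List.ofFn f).prod = g} : ℂ)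
      = ∑ k ∈ Finset.range (lg + 1), ((S.ncard : ℂ) - k * d) ^ l * R.cc K g (d * k) := by
    intro l
    rw [← fact_trace]
    have h1 := R.N_eq_S hL S hS huniq
    have h2 : ((S.ncard : ℂ) • 1 - R.N) ^ l =
        ∑ n ∈ Finset.range (R.D K), ((S.ncard : ℂ) - n) ^ l • R.e K n := by
      have := congrArg (fun F => ((S.ncard : ℂ) • 1 - R.N) ^ l * F) (R.sum_e (K := K))
      simp only [mul_one, Finset.mul_sum, hpow] at this
      exact this.symm
    have h3 : (reg g⁻¹ * ((S.ncard : ℂ) • 1 - R.N) ^ l).trace =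
        ∑ n ∈ Finset.range (R.D K), ((S.ncard : ℂ) - n) ^ l * R.cc K g n := by
      rw [h2, Finset.mul_sum, trace_sum]
      refine Finset.sum_congr rfl fun n _ => ?_
      rw [mul_smul_comm, trace_smul, smul_eq_mul, cc, hL]
    have h4 : (reg g⁻¹ * ((S.ncard : ℂ) • 1 - R.N) ^ l).trace =
        ∑ k ∈ Finset.range (lg + 1), ((S.ncard : ℂ) - k * d) ^ l * R.cc K g (d * k) := by
      rw [h3]
      have himg : ∑ k ∈ Finset.range (lg + 1), ((S.ncard : ℂ) - k * d) ^ l * R.cc K g (d * k) =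
          ∑ n ∈ (Finset.range (lg + 1)).image (fun k => d * k), ((S.ncard : ℂ) - n) ^ l * R.cc K g n := by
        rw [Finset.sum_image]
        · refine Finset.sum_congr rfl fun k _ => ?_
          push_cast; ring
        · intro a _ b _ hab
          exact Nat.eq_of_mul_eq_mul_left hd hab
      rw [himg]
      have hz1 : ∀ n, n ∉ (Finset.range (lg + 1)).image (fun k => d * k) → R.cc K g n = 0 := by
        intro n hn
        by_cases hdn : d ∣ n
        · obtain ⟨k, rfl⟩ := hdn
          have hk : lg < k := by
            by_contra hk
            exact hn (Finset.mem_image.mpr ⟨k, Finset.mem_range.mpr (by omega), rfl⟩)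
          rw [cc, R.e_zero_of_lt hU, mul_zero, trace_zero]
          rw [R.sum_card_S S hS huniq, ← hdl]
          exact Nat.mul_lt_mul_of_pos_left hk hd
        · exact R.cc_zero hL g ζ hg n (fun h => hdn ((hζ.pow_eq_one_iff_dvd n).mp h))
      have hz2 : ∀ n, n ∉ Finset.range (R.D K) → R.cc K g n = 0 := by
        intro n hn
        rw [cc, R.e_big (by simpa using hn), mul_zero, trace_zero]
      refine (Finset.sum_subset (Finset.subset_union_left
          (s₂ := (Finset.range (lg + 1)).image (fun k => d * k))) ?_).trans
        (Finset.sum_subset (Finset.subset_union_right (s₁ := Finset.range (R.D K))) ?_).symm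
      · intro n _ hn
        rw [hz2 n hn, mul_zero]
      · intro n _ hn
        rw [hz1 n hn, mul_zero]
    rw [← h4, ← h1]
  have hc := coeffs_unique lg (S.ncard : ℂ) (d : ℂ) (by exact_mod_cast hd.ne') (fun k => R.cc K g (d * k))
    (by simpa using R.cc_at_zero (K := K) hL hgen g) (by
      intro l hl
      rw [← hfact l]
      have : IsEmpty {f : Fin l → W // (∀ i, f i ∈ S) ∧ (List.ofFn f).prod = g} :=
        ⟨fun f => hmin l hl f.1 f.2⟩
      simp)
  have h := hfact l
  have h' : ∑ k ∈ Finset.range (lg + 1), ((S.ncard : ℂ) - k * d) ^ l * R.cc K g (d * k) =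
      ∑ k ∈ Finset.range (lg + 1), (-1 : ℂ) ^ k * (lg.choose k) * ((S.ncard : ℂ) - k * d) ^ l := by
    refine Finset.sum_congr rfl fun k hk => ?_
    have := hc k (Nat.lt_succ_iff.mp (Finset.mem_range.mp hk))
    rw [this]; ring
  rw [h'] at h
  exact_mod_cast h
end PSD
end Arr
end Reg
end KZ

namespace KZ
open MvPolynomial Matrix
section Inst
variable {E : Type*} [AddCommGroup E] [Module ℂ E]

lemma mem_fixedSpace (w : (E →ₗ[ℂ] E)ˣ) (x : E) :
    x ∈ fixedSpace w ↔ (w : E →ₗ[ℂ] E) x = x := by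
  simp [fixedSpace, LinearMap.mem_ker, sub_eq_zero]

variable (W : Subgroup (E →ₗ[ℂ] E)ˣ)

lemma toLin_mul (x y : W) (u : E) : toLin W (x * y) u = toLin W x (toLin W y u) := rfl
lemma toLin_one (u : E) : toLin W 1 u = u := rfl
lemma toLin_inv_apply (x : W) (u : E) : toLin W x⁻¹ (toLin W x u) = u := by
  rw [← toLin_mul, inv_mul_cancel, toLin_one]
lemma toLin_apply_inv (x : W) (u : E) : toLin W x (toLin W x⁻¹ u) = u := by
  rw [← toLin_mul, mul_inv_cancel, toLin_one]
lemma toLin_ext {x y : W} (h : ∀ u, toLin W x u = toLin W y u) : x = y := by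
  apply Subtype.ext
  apply Units.ext
  exact LinearMap.ext h
lemma mem_fixedSpace' (x : W) (u : E) :
    u ∈ fixedSpace (x : (E →ₗ[ℂ] E)ˣ) ↔ toLin W x u = u := mem_fixedSpace _ _

/-- the linear automorphism attached to an element -/
def toEq (x : W) : E ≃ₗ[ℂ] E :=
  LinearEquiv.ofLinearMap (toLin W x) (toLin W x⁻¹) (LinearMap.ext fun u => toLin_apply_inv W x u)
    (LinearMap.ext fun u => toLin_inv_apply W x u)

lemma fixedSpace_conj (x t : W) : fixedSpace ((x * t * x⁻¹ : W) : (E →ₗ[ℂ] E)ˣ) =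
    (fixedSpace (t : (E →ₗ[ℂ] E)ˣ)).map (toLin W x) := by
  ext u
  rw [mem_fixedSpace', Submodule.mem_map]
  constructor
  · intro h
    refine ⟨toLin W x⁻¹ u, ?_, toLin_apply_inv W x u⟩
    rw [mem_fixedSpace']
    rw [toLin_mul, toLin_mul] at h
    have := congrArg (toLin W x⁻¹) h
    rwa [toLin_inv_apply] at this
  · rintro ⟨y, hy, rfl⟩
    rw [mem_fixedSpace'] at hy
    rw [toLin_mul, toLin_inv_apply, toLin_mul, hy]

lemma finrank_map (x : W) (p : Submodule ℂ E) :
    Module.finrank ℂ (p.map (toLin W x)) = Module.finrank ℂ p :=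
  LinearEquiv.finrank_map_eq (toEq W x) p

lemma map_mem_arr (x : W) {h : Submodule ℂ E} (hh : h ∈ arrangement W) :
    h.map (toLin W x) ∈ arrangement W := by
  obtain ⟨t, ht, rfl⟩ := hh
  refine ⟨x * t * x⁻¹, ?_, (fixedSpace_conj W x t).symm⟩
  show IsReflection _
  rw [IsReflection, fixedSpace_conj, finrank_map]
  exact ht

instance arrAct : MulAction W (arrangement W) where
  smul x h := ⟨h.1.map (toLin W x), map_mem_arr W x h.2⟩
  one_smul h := Subtype.ext (Submodule.map_id h.1)
  mul_smul x y h := Subtype.ext (Submodule.map_comp (toLin W y) (toLin W x) h.1)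

lemma smul_arr (x : W) (h : arrangement W) : (x • h).1 = h.1.map (toLin W x) := rfl

lemma mem_smul_arr (x : W) (h : arrangement W) (u : E) : toLin W x u ∈ (x • h).1 ↔ u ∈ h.1 := by
  rw [smul_arr, Submodule.mem_map]
  constructor
  · rintro ⟨y, hy, hyu⟩
    have := congrArg (toLin W x⁻¹) hyu
    rw [toLin_inv_apply, toLin_inv_apply] at this
    rwa [← this]
  · intro hu; exact ⟨u, hu, rfl⟩

/-- pointwise stabilizer as a subgroup -/
def stab (h : arrangement W) : Subgroup W where
  carrier := {w | ∀ u ∈ h.1, toLin W w u = u}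
  one_mem' := fun u _ => rfl
  mul_mem' := by
    intro x y hx hy u hu
    rw [toLin_mul, hy u hu, hx u hu]
  inv_mem' := by
    intro x hx u hu
    have := toLin_inv_apply W x u
    rwa [hx u hu] at this

lemma mem_stab (h : arrangement W) (w : W) : w ∈ stab W h ↔ ∀ u ∈ h.1, toLin W w u = u := Iff.rfl

variable [FiniteDimensional ℂ E]

lemma finrank_arr (h : arrangement W) : Module.finrank ℂ E = Module.finrank ℂ h.1 + 1 := by
  obtain ⟨_, t, ht, rfl⟩ := h
  exact ht

lemma fixedSpace_ne_top {t : W} (ht : t ≠ 1) : fixedSpace (t : (E →ₗ[ℂ] E)ˣ) ≠ ⊤ := by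
  intro h
  apply ht
  apply toLin_ext
  intro u
  rw [toLin_one, ← mem_fixedSpace', h]
  trivial

lemma stab_eq {t : W} (ht : t ≠ 1) (h : arrangement W) (hth : t ∈ stab W h) :
    h.1 = fixedSpace (t : (E →ₗ[ℂ] E)ˣ) := by
  have h1 : h.1 ≤ fixedSpace (t : (E →ₗ[ℂ] E)ˣ) := fun u hu => (mem_fixedSpace' W t u).mpr (hth u hu)
  apply Submodule.eq_of_le_of_finrank_le h1
  have h2 := Submodule.finrank_lt (fixedSpace_ne_top W ht)
  have h3 := finrank_arr W h
  omega

lemma refls_iff (t : W) : t ∈ refls W ↔ t ≠ 1 ∧ ∃ h, t ∈ stab W h := by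
  constructor
  · intro ht
    refine ⟨?_, ⟨⟨_, t, ht, rfl⟩, fun u hu => (mem_fixedSpace' W t u).mp hu⟩⟩
    rintro rfl
    have h1 : fixedSpace ((1 : W) : (E →ₗ[ℂ] E)ˣ) = ⊤ := by
      exact eq_top_iff.mpr fun u _ => (mem_fixedSpace' W 1 u).mpr rfl
    have h2 : Module.finrank ℂ E = Module.finrank ℂ (fixedSpace ((1 : W) : (E →ₗ[ℂ] E)ˣ)) + 1 := ht
    rw [h1, finrank_top] at h2
    omega
  · rintro ⟨h1, h, h2⟩
    show IsReflection _
    rw [IsReflection, ← stab_eq W h1 h h2]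
    exact finrank_arr W h

lemma exists_data [Finite W] (h : arrangement W) : ∃ (a : E) (α : E →ₗ[ℂ] ℂ), α a = 1 ∧
    (∀ u, α u = 0 ↔ u ∈ h.1) ∧
    ∀ w ∈ stab W h, ∃ c : ℂ, ∀ u, toLin W w u = u + (c * α u) • a := by
  classical
  haveI := Fintype.ofFinite (stab W h)
  set e : ℂ := (Fintype.card (stab W h) : ℂ) with he
  have he0 : e ≠ 0 := by rw [he]; exact_mod_cast Fintype.card_ne_zero
  set p : E →ₗ[ℂ] E := e⁻¹ • ∑ w : stab W h, toLin W w with hp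
  have hp_apply : ∀ u, p u = e⁻¹ • ∑ w : stab W h, toLin W w u := by
    intro u; rw [hp]; simp
  have hwp : ∀ w : stab W h, ∀ u, toLin W w (p u) = p u := by
    intro w u
    rw [hp_apply, map_smul, map_sum]
    congr 1
    exact Fintype.sum_equiv (Equiv.mulLeft w) _ _ (fun x => rfl)
  have hpw : ∀ w : stab W h, ∀ u, p (toLin W w u) = p u := by
    intro w u
    rw [hp_apply, hp_apply]
    congr 1
    exact Fintype.sum_equiv (Equiv.mulRight w) _ _ (fun x => rfl)
  have hph : ∀ u ∈ h.1, p u = u := by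
    intro u hu
    rw [hp_apply, Finset.sum_congr rfl (fun w _ => w.2 u hu)]
    rw [Finset.sum_const, Finset.card_univ, ← Nat.cast_smul_eq_nsmul ℂ, smul_smul, inv_mul_cancel₀ he0,
      one_smul]
  have hpm : ∀ u, p u ∈ h.1 := by
    obtain ⟨t, ht, hth⟩ := h.2
    intro u
    rw [hth, mem_fixedSpace']
    exact hwp ⟨t, fun u hu => by rw [hth] at hu; exact (mem_fixedSpace' W t u).mp hu⟩ u
  have hpp : ∀ u, p (p u) = p u := fun u => hph _ (hpm u)
  have hrange : LinearMap.range p = h.1 := by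
    ext u
    constructor
    · rintro ⟨y, rfl⟩; exact hpm y
    · intro hu; exact ⟨u, hph u hu⟩
  have hker : Module.finrank ℂ (LinearMap.ker p) = 1 := by
    have h1 := LinearMap.finrank_range_add_finrank_ker p
    rw [hrange, finrank_arr W h] at h1
    omega
  obtain ⟨⟨a, ha⟩, ha0, hspan⟩ := finrank_eq_one_iff'.mp hker
  have ha0' : a ≠ 0 := fun h => ha0 (Subtype.ext h)
  have hspan' : ∀ u, p u = 0 → ∃ c : ℂ, c • a = u := by
    intro u hu
    obtain ⟨c, hc⟩ := hspan ⟨u, hu⟩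
    exact ⟨c, congrArg Subtype.val hc⟩
  have hpa : p a = 0 := ha
  obtain ⟨f, hf⟩ := Module.Projective.exists_dual_eq_one ℂ ha0'
  refine ⟨a, f ∘ₗ (LinearMap.id - p), ?_, ?_, ?_⟩
  · simp [hpa, hf]
  · intro u
    constructor
    · intro hu
      obtain ⟨c, hc⟩ := hspan' (u - p u) (by rw [map_sub, hpp, sub_self])
      have : f (u - p u) = 0 := hu
      rw [← hc, map_smul, hf, smul_eq_mul, mul_one] at this
      rw [this, zero_smul, eq_comm, sub_eq_zero] at hc
      rw [hc]; exact hpm u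
    · intro hu
      simp [hph u hu]
  · intro w hw
    obtain ⟨c, hc⟩ := hspan' (toLin W w a) (by rw [hpw ⟨w, hw⟩ a, hpa])
    refine ⟨c - 1, fun u => ?_⟩
    obtain ⟨k, hk⟩ := hspan' (u - p u) (by rw [map_sub, hpp, sub_self])
    have h1 : f (u - p u) = k := by rw [← hk, map_smul, hf, smul_eq_mul, mul_one]
    show _ = u + ((c - 1) * f (u - p u)) • a
    have h2 : u = p u + k • a := by rw [hk]; abel
    rw [h1]
    have h3 : toLin W w u = p u + k • (c • a) := by
      conv_lhs => rw [h2]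
      rw [map_add, map_smul, ← hc, hwp ⟨w, hw⟩ u]
    rw [h3]
    conv_rhs => rw [h2]
    rw [sub_mul, sub_smul, smul_smul, one_mul, mul_comm k c]
    abel
lemma dot_repr {n : ℕ} (b : Module.Basis (Fin n) ℂ E) (f : E →ₗ[ℂ] ℂ) (u : E) :
    (fun i => f (b i)) ⬝ᵥ (fun i => b.repr u i) = f u := by
  conv_rhs => rw [← b.sum_repr u]
  rw [map_sum, dotProduct]
  refine Finset.sum_congr rfl fun i _ => ?_
  rw [map_smul, smul_eq_mul, mul_comm]

lemma exists_arr [Fintype W] [DecidableEq W] [Fintype (arrangement W)]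
    [DecidableEq (arrangement W)] (v : E) (hv : ∀ h ∈ arrangement W, v ∉ h) :
    ∃ (n : ℕ) (b : Module.Basis (Fin n) ℂ E) (R : Arr W (Fin n) W (arrangement W)),
      R.lam = reg ∧ R.S = stab W ∧ R.v = (fun i => b.repr v i) ∧
      ∀ w, R.act w = LinearMap.toMatrix b b (toLin W w) := by
  classical
  choose a α h1 h2 h3 using exists_data W
  let b := Module.finBasis ℂ E
  have key : ∀ h, ∀ w ∈ stab W h, ∀ u,
      toLin W w u = u + ((α h (toLin W w (a h)) - 1) * α h u) • a h := by
    intro h w hw u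
    obtain ⟨c, hc⟩ := h3 h w hw
    have : α h (toLin W w (a h)) = 1 + c := by
      rw [hc, map_add, map_smul, h1, smul_eq_mul]; ring
    rw [this, hc]
    congr 2
    ring
  have keya : ∀ h, ∀ w ∈ stab W h, toLin W w (a h) = α h (toLin W w (a h)) • a h := by
    intro h w hw
    conv_lhs => rw [key h w hw (a h)]
    rw [h1, mul_one, sub_smul, one_smul]
    abel
  refine ⟨_, b, 
    { act := 
        { toFun := fun w => LinearMap.toMatrix b b (toLin W w)
          map_one' := LinearMap.toMatrix_one b
          map_mul' := fun x y => LinearMap.toMatrix_mul b (toLin W x) (toLin W y) }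
      lam := reg
      α := fun h i => α h (b i)
      a := fun h i => b.repr (a h) i
      α_a := fun h => by rw [dot_repr, h1]
      S := stab W
      ω := fun h => 
        { toFun := fun w => α h (toLin W w (a h))
          map_one' := h1 h
          map_mul' := fun x y => by
            show α h (toLin W (x * y : W) (a h)) = _
            rw [toLin_mul, keya h y y.2, map_smul, map_smul, smul_eq_mul, mul_comm, map_smul, h1,
              smul_eq_mul, mul_one] }
      ω_ne_one := ?_
      act_S := ?_
      indep := ?_
      act_α := ?_
      S_conj := ?_
      v := fun i => b.repr v i
      v_reg := ?_ }, rfl, rfl, rfl, fun w => rfl⟩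
  · intro h w hw hω
    apply hw
    apply Subtype.ext
    apply toLin_ext
    intro u
    have hω' : α h (toLin W w (a h)) = 1 := hω
    rw [key h w w.2 u, hω', sub_self, zero_mul, zero_smul, add_zero]
    rfl
  · intro h w
    ext i j
    show LinearMap.toMatrix b b (toLin W w) i j = _
    rw [LinearMap.toMatrix_apply, key h w w.2]
    simp only [map_add, map_smul, Finsupp.add_apply, Finsupp.smul_apply, Matrix.add_apply,
      Matrix.smul_apply, vecMulVec_apply, smul_eq_mul, Module.Basis.repr_self, Matrix.one_apply,
      Finsupp.single_apply, MonoidHom.coe_mk, OneHom.coe_mk]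
    congr 1
    · simp [eq_comm]
    · show _ = (α h (toLin W w (a h)) - 1) * (b.repr (a h) i * α h (b j))
      ring
  · intro h k hhk c hc
    apply hhk
    apply Subtype.ext
    have hα : α k = c • α h := by
      apply b.ext
      intro i
      exact congrFun hc i
    apply Submodule.eq_of_le_of_finrank_eq
    · intro u hu
      rw [← h2, hα, LinearMap.smul_apply, (h2 h u).mpr hu, smul_zero]
    · have := finrank_arr W h
      have := finrank_arr W k
      omega
  · intro w h
    refine ⟨α (w • h) (toLin W w (a h)), ?_, ?_⟩
    · intro h0
      rw [h2, mem_smul_arr, ← h2, h1] at h0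
      exact one_ne_zero h0
    · ext j
      have e1 : ((fun i => α (w • h) (b i)) ᵥ* (LinearMap.toMatrix b b (toLin W w))) j
          = α (w • h) (toLin W w (b j)) := by
        rw [← dot_repr b (α (w • h)) (toLin W w (b j))]
        simp only [vecMul, dotProduct, LinearMap.toMatrix_apply]
      refine e1.trans ?_
      have e2 : b j - α h (b j) • a h ∈ h.1 := by
        rw [← h2, map_sub, map_smul, h1, smul_eq_mul, mul_one, sub_self]
      rw [← mem_smul_arr W w, ← h2, map_sub, map_sub, map_smul, map_smul, sub_eq_zero] at e2
      rw [e2]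
      simp [mul_comm]
  · intro w h x hx u hu
    obtain ⟨y, hy, rfl⟩ := hu
    rw [toLin_mul, toLin_inv_apply, toLin_mul, hx y hy]
  · intro h
    show (fun i => α h (b i)) ⬝ᵥ (fun i => b.repr v i) ≠ 0
    rw [dot_repr, Ne, h2]
    exact hv h.1 h.2

theorem final [Finite W] (hgen : Subgroup.closure (refls W) = ⊤)
    (d : ℕ) (g : W) (hg : IsRegularElt W g d)
    (lg : ℕ) (hlg : IsReflLength W g lg)
    (hdl : d * lg = (refls W).ncard + (arrangement W).ncard)
    (l : ℕ) :
    (Nat.card W * Nat.card {f : Fin l → W // IsReflFac W g l f} : ℤ) =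
      ∑ k ∈ Finset.range (lg + 1),
        (-1 : ℤ) ^ k * (lg.choose k) * (((refls W).ncard : ℤ) - k * d) ^ l := by
  classical
  haveI := Fintype.ofFinite W
  have hfin : (arrangement W).Finite := by
    refine (Set.finite_range fun t : W => fixedSpace (t : (E →ₗ[ℂ] E)ˣ)).subset ?_
    rintro _ ⟨t, _, rfl⟩
    exact ⟨t, rfl⟩
  haveI : Fintype (arrangement W) := hfin.fintype
  obtain ⟨hord, ζ, v, _, hζ, hgv, hv⟩ := hg
  obtain ⟨n, b, R, hL, hS, hRv, hact⟩ := exists_arr W v hv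
  refine Arr.main R hL ?_ (refls W) ?_ ?_ g d ?_ ζ hζ ?_ lg ?_ ?_ l
  · rw [hS, eq_top_iff, ← hgen, Subgroup.closure_le]
    intro t ht
    obtain ⟨_, h, hh⟩ := (refls_iff W t).mp ht
    exact Subgroup.mem_iSup_of_mem h hh
  · rw [hS]; exact refls_iff W
  · rw [hS]
    intro t h k ht hh hk
    exact Subtype.ext ((stab_eq W ht h hh).trans (stab_eq W ht k hk).symm)
  · rw [← hord]; exact orderOf_pos g
  · rw [hact, hRv]
    have := LinearMap.toMatrix_mulVec_repr b b (toLin W g) v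
    refine this.trans ?_
    rw [hgv]
    ext i
    simp
  · rw [hdl, ← Nat.card_coe_set_eq (arrangement W), Nat.card_eq_fintype_card]
  · intro k hk f hf
    exact absurd (hlg.2 k f hf) (by omega)
end Inst
end KZ

/-- Explicit count: for `W` irreducible and `g` regular of order `d` with
`d · l_R(g) = |R| + |A|`, the number of length-`l` reflection factorizations of `g`
satisfies `|W| · Fact_{W,g}(l) = Σ_{k=0}^{l_R(g)} (−1)^k (l_R(g) choose k) (|R| − kd)^l`. -/
theorem factorization_count_explicit_formula
    (V : Type*) [AddCommGroup V] [Module ℂ V] [FiniteDimensional ℂ V]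
    (W : Subgroup (V →ₗ[ℂ] V)ˣ) [Finite W]
    (hgen : Subgroup.closure (refls W) = ⊤)
    (hirr : IsIrredAction W)
    (d : ℕ) (g : W) (hg : IsRegularElt W g d)
    (lg : ℕ) (hlg : IsReflLength W g lg)
    (hdl : d * lg = (refls W).ncard + (arrangement W).ncard)
    (l : ℕ) :
    (Nat.card W * Nat.card {f : Fin l → W // IsReflFac W g l f} : ℤ) =
      ∑ k ∈ Finset.range (lg + 1),
        (-1 : ℤ) ^ k * (lg.choose k) * (((refls W).ncard : ℤ) - k * d) ^ l := by
  exact KZ.final W hgen d g hg lg hlg hdl l
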